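/- For every regular r-multipartition μ ∈ P^r_N and every λ ∈ P^r_N with λ ≥ μ in the dominance order, the one-variable polynomial K_{λμ}(t) has nonnegative integer coefficients, i.e. K_{λμ}(t) ∈ ℕ[t]. -/

import Mathlib

open scoped BigOperators

namespace KS

/-- A pseudoroot pair `(m, n)`: `1 ≤ m < n ≤ rN` and `n ≡ m + 1 (mod r)`. -/
def PseudoPair (r N : ℕ) (p : ℕ × ℕ) : Prop :=
  1 ≤ p.1 ∧ p.1 < p.2 ∧ p.2 ≤ r * N ∧ p.2 % r = (p.1 + 1) % r

instance (r N : ℕ) : DecidablePred (PseudoPair r N) := fun p => by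
  unfold PseudoPair; infer_instance

/-- The finite set of all pseudoroot pairs. -/
def pseudoPairs (r N : ℕ) : Finset (ℕ × ℕ) :=
  (Finset.range (r * N + 1) ×ˢ Finset.range (r * N + 1)).filter (PseudoPair r N)

/-- Standard basis vector `e_m` of `ℤ^{rN}` (1-based index `m`). -/
def stdVec (r N : ℕ) (m : ℕ) : Fin (r * N) → ℤ :=
  fun i => if (i : ℕ) + 1 = m then 1 else 0

/-- The vector `e_m - e_n` associated to a pseudoroot pair `(m, n)`. -/
def prVec (r N : ℕ) (p : ℕ × ℕ) : Fin (r * N) → ℤ :=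
  stdVec r N p.1 - stdVec r N p.2

/-- `M` is a decomposition of `β` into pseudoroot pairs. -/
def IsDecomp (r N : ℕ) (β : Fin (r * N) → ℤ) (M : Multiset (ℕ × ℕ)) : Prop :=
  (∀ p ∈ M, PseudoPair r N p) ∧ (M.map (prVec r N)).sum = β

/-- `d_s(M)`: number of elements `(m,n)` of `M` with `m ≡ s (mod r)`,
where `s : Fin r` encodes the residue `s + 1 ∈ {1, …, r}`. -/
def dCount (r : ℕ) (M : Multiset (ℕ × ℕ)) (s : Fin r) : ℕ :=
  Multiset.card (M.filter (fun p => p.1 % r = ((s : ℕ) + 1) % r))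

/-- The monomial `∏_s t_s ^ (d_s M)`. -/
noncomputable def dMono (r : ℕ) (M : Multiset (ℕ × ℕ)) : MvPolynomial (Fin r) ℤ :=
  ∏ s : Fin r, (MvPolynomial.X s) ^ (dCount r M s)

/-- The multivariable partition function `L^β(t_1, …, t_r)`. -/
noncomputable def Lmv (r N : ℕ) (β : Fin (r * N) → ℤ) : MvPolynomial (Fin r) ℤ :=
  ∑ᶠ M ∈ {M : Multiset (ℕ × ℕ) | IsDecomp r N β M}, dMono r M

/-- The one-variable partition function `L^β(t)`. -/
noncomputable def Lone (r N : ℕ) (β : Fin (r * N) → ℤ) : Polynomial ℤ :=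
  ∑ᶠ M ∈ {M : Multiset (ℕ × ℕ) | IsDecomp r N β M},
    (Polynomial.X : Polynomial ℤ) ^ (Multiset.card M)

/-- The position of the entry `λ^{(s)}_j` in the interleaved order: the
0-based index `r * j + s` (for 0-based `s : Fin r`, `j : Fin N`) corresponds
to the 1-based index `r(j − 1) + s`. -/
def pos (r N : ℕ) (s : Fin r) (j : Fin N) : Fin (r * N) :=
  ⟨r * (j : ℕ) + (s : ℕ), by
    have hs : (s : ℕ) < r := s.isLt
    have hj : (j : ℕ) + 1 ≤ N := j.isLt
    have h1 : r * ((j : ℕ) + 1) ≤ r * N := Nat.mul_le_mul (le_refl r) hj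
    have h2 : r * ((j : ℕ) + 1) = r * (j : ℕ) + r := by ring
    linarith⟩

theorem fin_aux_r {r N : ℕ} (i : Fin (r * N)) : 0 < r := by
  rcases Nat.eq_zero_or_pos r with h | h
  · exact absurd i.pos (by simp [h])
  · exact h

theorem mod_lt_of_fin {r N : ℕ} (i : Fin (r * N)) : (i : ℕ) % r < r :=
  Nat.mod_lt _ (fin_aux_r i)

theorem div_lt_of_fin {r N : ℕ} (i : Fin (r * N)) : (i : ℕ) / r < N := by
  have h := i.isLt
  exact (Nat.div_lt_iff_lt_mul (fin_aux_r i)).mpr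
    (lt_of_lt_of_le h (le_of_eq (Nat.mul_comm r N)))

/-- The action of `σ ∈ S_N^r` on `ℤ^{rN}`: the `s`-th copy of `S_N` permutes
the coordinates indexed by `r(j−1)+s`, `j = 1, …, N`. -/
def permAct (r N : ℕ) (σ : Fin r → Equiv.Perm (Fin N)) (ν : Fin (r * N) → ℤ) :
    Fin (r * N) → ℤ :=
  fun i =>
    ν (pos r N ⟨(i : ℕ) % r, mod_lt_of_fin i⟩
        ((σ ⟨(i : ℕ) % r, mod_lt_of_fin i⟩)⁻¹ ⟨(i : ℕ) / r, div_lt_of_fin i⟩))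

/-- The multipartition `ρ` with `ρ^{(s)} = (N, N−1, …, 1)` for every `s`. -/
def rhoVec (r N : ℕ) : Fin (r * N) → ℤ :=
  fun i => (N : ℤ) - ((i : ℕ) / r : ℕ)

/-- The sign `(−1)^σ` of `σ ∈ S_N^r`. -/
def signProd (r N : ℕ) (σ : Fin r → Equiv.Perm (Fin N)) : ℤ :=
  ∏ s : Fin r, (Equiv.Perm.sign (σ s) : ℤ)

/-- The multivariable Kostka–Shoji polynomial `K_{λμ}(t_1, …, t_r)`. -/
noncomputable def Kmv (r N : ℕ) (lam mu : Fin (r * N) → ℤ) : MvPolynomial (Fin r) ℤ :=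
  ∑ σ : Fin r → Equiv.Perm (Fin N),
    MvPolynomial.C (signProd r N σ) *
      Lmv r N (permAct r N σ (lam + rhoVec r N) - rhoVec r N - mu)

/-- The one-variable Kostka–Shoji polynomial `K_{λμ}(t)`. -/
noncomputable def Kone (r N : ℕ) (lam mu : Fin (r * N) → ℤ) : Polynomial ℤ :=
  ∑ σ : Fin r → Equiv.Perm (Fin N),
    Polynomial.C (signProd r N σ) *
      Lone r N (permAct r N σ (lam + rhoVec r N) - rhoVec r N - mu)

/-- `ν ∈ ℤ^{rN}` is (the interleaved vector of) an `r`-multipartition: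
each `ν^{(s)}` is weakly decreasing. -/
def IsMP (r N : ℕ) (ν : Fin (r * N) → ℤ) : Prop :=
  ∀ (s : Fin r) (j k : Fin N), j ≤ k → ν (pos r N s k) ≤ ν (pos r N s j)

/-- A regular multipartition: each `ν^{(s)}` is strictly decreasing. -/
def RegularMP (r N : ℕ) (ν : Fin (r * N) → ℤ) : Prop :=
  ∀ (s : Fin r) (j k : Fin N), j < k → ν (pos r N s k) < ν (pos r N s j)

/-- `Σ_n(ν)`: the sum of the first `n` coordinates of `ν` in the interleaved order. -/
def partialSum (r N : ℕ) (ν : Fin (r * N) → ℤ) (n : ℕ) : ℤ :=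
  ∑ i : Fin (r * N), if (i : ℕ) < n then ν i else 0

/-- Dominance order: `λ ≥ μ`. -/
def Dominates (r N : ℕ) (lam mu : Fin (r * N) → ℤ) : Prop :=
  (∀ n : ℕ, 1 ≤ n → n ≤ r * N - 1 → partialSum r N mu n ≤ partialSum r N lam n) ∧
    partialSum r N lam (r * N) = partialSum r N mu (r * N)

end KS

namespace KS
set_option linter.unusedSectionVars false

section Fock
variable {τ : Type*} [LinearOrder τ] {Y : Type*} [AddCommGroup Y] [Module ℚ Y]

/-- the fermionic sign -/
def sg (t : τ) (Φ : Finset τ) : ℚ := (-1) ^ (Φ.filter (· < t)).card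

theorem sg_mul_self (t : τ) (Φ : Finset τ) : sg t Φ * sg t Φ = 1 := by
  unfold sg; rw [← pow_add, ← two_mul, pow_mul]; simp

theorem sg_insert {t u : τ} {Φ : Finset τ} (h : u ∉ Φ) :
    sg t (insert u Φ) = (if u < t then -1 else 1) * sg t Φ := by
  unfold sg
  rw [Finset.filter_insert]
  split_ifs with h1
  · rw [Finset.card_insert_of_notMem (by simp [h]), pow_succ]; ring
  · simp

theorem sg_erase {t u : τ} {Φ : Finset τ} (h : u ∈ Φ) :
    sg t (Φ.erase u) = (if u < t then -1 else 1) * sg t Φ := by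
  have h1 := sg_insert (t := t) (u := u) (Φ := Φ.erase u) (by simp)
  rw [Finset.insert_erase h] at h1
  rw [h1]; split_ifs <;> ring

/-- creation operator -/
def cre (t : τ) : Module.End ℚ (Finset τ → Y) where
  toFun c := fun Φ => if t ∈ Φ then sg t Φ • c (Φ.erase t) else 0
  map_add' c c' := by ext Φ; simp only [Pi.add_apply]; split_ifs <;> simp
  map_smul' a c := by
    ext Φ; simp only [Pi.smul_apply, RingHom.id_apply]; split_ifs
    · rw [smul_comm]
    · simp

/-- annihilation operator -/
def ann (t : τ) : Module.End ℚ (Finset τ → Y) where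
  toFun c := fun Φ => if t ∈ Φ then 0 else sg t Φ • c (insert t Φ)
  map_add' c c' := by ext Φ; simp only [Pi.add_apply]; split_ifs <;> simp
  map_smul' a c := by
    ext Φ; simp only [Pi.smul_apply, RingHom.id_apply]; split_ifs
    · simp
    · rw [smul_comm]

theorem cre_apply (t : τ) (c : Finset τ → Y) (Φ : Finset τ) :
    cre t c Φ = if t ∈ Φ then sg t Φ • c (Φ.erase t) else 0 := rfl

theorem ann_apply (t : τ) (c : Finset τ → Y) (Φ : Finset τ) :
    ann t c Φ = if t ∈ Φ then 0 else sg t Φ • c (insert t Φ) := rfl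

theorem cre_cre (t u : τ) :
    (cre t * cre u : Module.End ℚ (Finset τ → Y)) = - (cre u * cre t) := by
  ext c Φ
  simp only [Module.End.mul_apply, LinearMap.neg_apply, Pi.neg_apply, cre_apply, Finset.mem_erase]
  by_cases htu : t = u
  · subst htu; simp
  by_cases ht : t ∈ Φ <;> by_cases hu : u ∈ Φ <;> simp [ht, hu, htu, Ne.symm htu]
  rw [sg_erase ht, sg_erase hu, Finset.erase_right_comm, smul_smul, smul_smul, ← neg_smul]
  congr 1
  rcases lt_or_gt_of_ne htu with h | h <;> simp [h, h.not_gt] <;> ring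

theorem ann_ann (t u : τ) :
    (ann t * ann u : Module.End ℚ (Finset τ → Y)) = - (ann u * ann t) := by
  ext c Φ
  simp only [Module.End.mul_apply, LinearMap.neg_apply, Pi.neg_apply, ann_apply, Finset.mem_insert]
  by_cases htu : t = u
  · subst htu; simp
  by_cases ht : t ∈ Φ <;> by_cases hu : u ∈ Φ <;> simp [ht, hu, htu, Ne.symm htu]
  rw [sg_insert ht, sg_insert hu, Finset.insert_comm, smul_smul, smul_smul, ← neg_smul]
  congr 1
  rcases lt_or_gt_of_ne htu with h | h <;> simp [h, h.not_gt] <;> ring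

theorem ann_cre (t u : τ) :
    (ann t * cre u : Module.End ℚ (Finset τ → Y)) =
      (if t = u then 1 else 0) - cre u * ann t := by
  ext c Φ
  by_cases htu : t = u
  · subst htu
    simp only [if_true, Module.End.mul_apply, LinearMap.sub_apply, Pi.sub_apply, ann_apply,
      cre_apply, Module.End.one_apply]
    by_cases ht : t ∈ Φ
    · simp only [ht, if_true, Finset.mem_erase, ne_eq, not_true, false_and, if_false,
        Finset.insert_erase ht, smul_smul]
      rw [sg_erase ht]; simp [sg_mul_self]
    · simp only [ht, if_false, Finset.mem_insert, true_or, if_true, Finset.erase_insert ht,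
        smul_smul]
      rw [sg_insert ht]; simp [sg_mul_self]
  · simp only [if_neg htu, Module.End.mul_apply, LinearMap.sub_apply, Pi.sub_apply, ann_apply,
      cre_apply, LinearMap.zero_apply, Pi.zero_apply, Finset.mem_insert, Finset.mem_erase]
    by_cases ht : t ∈ Φ <;> by_cases hu : u ∈ Φ <;> simp [ht, hu, htu, Ne.symm htu]
    rw [sg_insert ht, sg_erase hu, smul_smul, smul_smul, ← neg_smul,
      Finset.erase_insert_of_ne htu]
    congr 1
    rcases lt_or_gt_of_ne htu with h | h <;> simp [h, h.not_gt] <;> ring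

/-- pointwise operators -/
def pw (x : Module.End ℚ Y) : Module.End ℚ (Finset τ → Y) := x.compLeft (Finset τ)

@[simp] theorem pw_apply (x : Module.End ℚ Y) (c : Finset τ → Y) (Φ : Finset τ) :
    pw x c Φ = x (c Φ) := rfl

theorem pw_mul (x y : Module.End ℚ Y) : (pw (x * y) : Module.End ℚ (Finset τ → Y)) = pw x * pw y :=
  rfl
theorem pw_sub (x y : Module.End ℚ Y) : (pw (x - y) : Module.End ℚ (Finset τ → Y)) = pw x - pw y :=
  rfl
theorem pw_zero : (pw (0 : Module.End ℚ Y) : Module.End ℚ (Finset τ → Y)) = 0 := rfl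

theorem pw_cre (x : Module.End ℚ Y) (t : τ) :
    (pw x * cre t : Module.End ℚ (Finset τ → Y)) = cre t * pw x := by
  ext c Φ
  simp only [Module.End.mul_apply, pw_apply, cre_apply]
  split_ifs <;> simp

theorem pw_ann (x : Module.End ℚ Y) (t : τ) :
    (pw x * ann t : Module.End ℚ (Finset τ → Y)) = ann t * pw x := by
  ext c Φ
  simp only [Module.End.mul_apply, pw_apply, ann_apply]
  split_ifs <;> simp

/-- number operator -/
theorem num_apply (t : τ) (c : Finset τ → Y) (Φ : Finset τ) :
    (cre t * ann t : Module.End ℚ (Finset τ → Y)) c Φ = if t ∈ Φ then c Φ else 0 := by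
  simp only [Module.End.mul_apply, ann_apply, cre_apply]
  split_ifs with h h1
  · simp at h1
  · rw [Finset.insert_erase h, smul_smul, sg_erase h]; simp [sg_mul_self]
  · rfl

theorem bil_comm (u v u' v' : τ) :
    (cre u * ann v * (cre u' * ann v') - cre u' * ann v' * (cre u * ann v) :
      Module.End ℚ (Finset τ → Y)) =
    (if v = u' then cre u * ann v' else 0) - (if v' = u then cre u' * ann v else 0) := by
  have h1 : (cre u * ann v * (cre u' * ann v') : Module.End ℚ (Finset τ → Y)) =
      cre u * (ann v * cre u') * ann v' := by noncomm_ring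
  have h2 : (cre u' * ann v' * (cre u * ann v) : Module.End ℚ (Finset τ → Y)) =
      cre u' * (ann v' * cre u) * ann v := by noncomm_ring
  have h3 : (cre u * (cre u' * ann v) * ann v' : Module.End ℚ (Finset τ → Y)) =
      cre u' * (cre u * ann v') * ann v := by
    have e1 : (cre u * (cre u' * ann v) * ann v' : Module.End ℚ (Finset τ → Y)) =
      (cre u * cre u') * (ann v * ann v') := by noncomm_ring
    rw [e1, cre_cre, ann_ann]
    refine (neg_mul_neg (cre u' * cre u : Module.End ℚ (Finset τ → Y)) (ann v' * ann v)).trans ?_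
    noncomm_ring
  rw [h1, h2, ann_cre, ann_cre, mul_sub, sub_mul, h3, mul_sub, sub_mul]
  split_ifs <;> simp <;> noncomm_ring

end Fock
end KS

namespace KS
set_option linter.unusedSectionVars false
set_option linter.unusedSimpArgs false
section RingCE
variable {A : Type*} [Ring A] [Algebra ℚ A] {I : Type*} [Fintype I] [DecidableEq I]

theorem two_cancel {a b : A} (h : a + a = b + b) : a = b := by
  have h2 : (2 : ℚ) • a = (2 : ℚ) • b := by rw [two_smul, two_smul, h]
  have := congrArg (fun z => (2⁻¹ : ℚ) • z) h2
  simpa [smul_smul] using this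

theorem swap4 (F : I → I → I → I → A) : ∑ a, ∑ b, ∑ c, ∑ d, F a b c d =
        ∑ a, ∑ b, ∑ c, ∑ d, F c d a b := by
  have := Finset.sum_comm (s := (Finset.univ : Finset (I × I))) (t := (Finset.univ : Finset (I × I)))
    (f := fun x y => F x.1 x.2 y.1 y.2)
  simpa only [Fintype.sum_prod_type] using this

structure CEr (P : I → I → Prop) [DecidableRel P] (eps iot X : I → I → A) : Prop where
  tr : ∀ a b c, P a b → P b c → P a c
  e0 : ∀ a b, ¬ P a b → eps a b = 0
  i0 : ∀ a b, ¬ P a b → iot a b = 0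
  ee : ∀ a b c d, eps a b * eps c d = - (eps c d * eps a b)
  ii : ∀ a b c d, iot a b * iot c d = - (iot c d * iot a b)
  ie : ∀ a b c d, iot a b * eps c d =
    (if a = c ∧ b = d ∧ P a b then 1 else 0) - eps c d * iot a b
  Xe : ∀ a b c d, X a b * eps c d = eps c d * X a b
  Xi : ∀ a b c d, X a b * iot c d = iot c d * X a b
  XX : ∀ a b c d, P a b → P c d → X a b * X c d - X c d * X a b =
    (if a = d then X c b else 0) - (if b = c then X a d else 0)

variable {P : I → I → Prop} [DecidableRel P] {eps iot X : I → I → A}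

def cA (eps X : I → I → A) : A := ∑ a, ∑ b, eps a b * X a b
def cO (eps : I → I → A) (a c : I) : A := ∑ b, eps b c * eps a b
def cB (eps iot : I → I → A) : A := ∑ a, ∑ c, cO eps a c * iot a c
def cd (eps iot X : I → I → A) : A := cA eps X - cB eps iot

namespace CEr
variable (h : CEr P eps iot X)
include h

theorem AA : cA eps X * cA eps X = ∑ a, ∑ c, cO eps a c * X a c := by
  apply two_cancel
  have h1 : cA eps X * cA eps X =
      ∑ a, ∑ b, ∑ c, ∑ d, eps a b * eps c d * (X a b * X c d) := by
    unfold cA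
    simp only [Finset.sum_mul, Finset.mul_sum]
    rw [swap4]
    refine Finset.sum_congr rfl fun a _ => Finset.sum_congr rfl fun b _ =>
      Finset.sum_congr rfl fun c _ => Finset.sum_congr rfl fun d _ => ?_
    rw [mul_assoc, ← mul_assoc (X a b), h.Xe]; noncomm_ring
  have h2 : cA eps X * cA eps X =
      ∑ a, ∑ b, ∑ c, ∑ d, -(eps a b * eps c d * (X c d * X a b)) := by
    rw [h1]
    rw [swap4]
    refine Finset.sum_congr rfl fun a _ => Finset.sum_congr rfl fun b _ =>
      Finset.sum_congr rfl fun c _ => Finset.sum_congr rfl fun d _ => ?_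
    rw [h.ee c d a b]; noncomm_ring
  nth_rewrite 1 [h1]
  rw [h2]
  simp only [← Finset.sum_add_distrib]
  have h3 : ∀ a b c d, eps a b * eps c d * (X a b * X c d) + -(eps a b * eps c d * (X c d * X a b))
      = (if a = d then eps a b * eps c a * X c b else 0)
        + (if b = c then eps b d * eps a b * X a d else 0) := by
    intro a b c d
    rw [← sub_eq_add_neg, ← mul_sub]
    by_cases hab : P a b
    · by_cases hcd : P c d
      · rw [h.XX a b c d hab hcd]
        split_ifs with h1 h2 h2
        · subst h1 h2; rw [mul_sub, h.ee b a a b]; noncomm_ring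
        · subst h1; simp
        · subst h2; rw [h.ee a b b d]; noncomm_ring
        · simp
      · rw [h.e0 c d hcd]
        split_ifs with h1 h2 h2
        · subst h1 h2; simp [h.e0 _ _ hcd]
        · subst h1; simp [h.e0 _ _ hcd]
        · subst h2; simp [h.e0 _ _ hcd]
        · simp
    · rw [h.e0 a b hab]; simp
  simp only [h3, Finset.sum_add_distrib]
  congr 1
  · unfold cO
    simp only [Finset.sum_mul]
    simp only [Finset.sum_ite_eq, Finset.mem_univ, if_true]
    rw [Finset.sum_comm]
    rw [Finset.sum_congr rfl fun b _ => Finset.sum_comm]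
    rw [Finset.sum_comm]
  · unfold cO
    simp only [Finset.sum_mul]
    rw [Finset.sum_congr rfl fun a _ => Finset.sum_congr rfl fun b _ => Finset.sum_comm]
    simp only [Finset.sum_ite_eq, Finset.mem_univ, if_true]
    rw [Finset.sum_congr rfl fun b _ => Finset.sum_comm]

theorem O_eps (a c u v : I) : cO eps a c * eps u v = eps u v * cO eps a c := by
  unfold cO
  rw [Finset.sum_mul, Finset.mul_sum]
  refine Finset.sum_congr rfl fun b _ => ?_
  rw [mul_assoc, h.ee a b u v, ← mul_assoc, h.ee u v b c]; noncomm_ring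

theorem O_X (a c u v : I) : X u v * cO eps a c = cO eps a c * X u v := by
  unfold cO
  rw [Finset.sum_mul, Finset.mul_sum]
  refine Finset.sum_congr rfl fun b _ => ?_
  rw [← mul_assoc, h.Xe, mul_assoc, h.Xe, mul_assoc]

theorem O_O (a c u v : I) : cO eps a c * cO eps u v = cO eps u v * cO eps a c := by
  conv_lhs => rw [cO, Finset.sum_mul]
  conv_rhs => rw [cO.eq_def eps a c, Finset.mul_sum]
  refine Finset.sum_congr rfl fun b _ => ?_
  rw [mul_assoc, ← h.O_eps, ← mul_assoc, ← h.O_eps, mul_assoc]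

theorem O_zero (a c : I) (hh : ¬ P a c) : cO eps a c = 0 := by
  unfold cO
  refine Finset.sum_eq_zero fun b _ => ?_
  by_cases h1 : P a b
  · by_cases h2 : P b c
    · exact absurd (h.tr _ _ _ h1 h2) hh
    · simp [h.e0 _ _ h2]
  · simp [h.e0 _ _ h1]

theorem AB : cA eps X * cB eps iot + cB eps iot * cA eps X = ∑ a, ∑ c, cO eps a c * X a c := by
  unfold cB
  simp only [Finset.sum_mul, Finset.mul_sum, ← Finset.sum_add_distrib]
  refine Finset.sum_congr rfl fun a _ => Finset.sum_congr rfl fun c _ => ?_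
  unfold cA
  simp only [Finset.sum_mul, Finset.mul_sum, ← Finset.sum_add_distrib]
  have h1 : ∀ u v, eps u v * X u v * (cO eps a c * iot a c) + cO eps a c * iot a c * (eps u v * X u v)
      = if a = u then (if c = v then cO eps a c * X a c else 0) else 0 := by
    intro u v
    have e1 : eps u v * X u v * (cO eps a c * iot a c) = cO eps a c * (eps u v * iot a c) * X u v := by
      rw [mul_assoc, ← mul_assoc (X u v), h.O_X, mul_assoc (cO eps a c), h.Xi, ← mul_assoc,
        ← h.O_eps]; noncomm_ring
    have e2 : cO eps a c * iot a c * (eps u v * X u v) = cO eps a c * (iot a c * eps u v) * X u v := by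
      noncomm_ring
    rw [e1, e2, h.ie]
    by_cases hac : P a c
    · by_cases ha : a = u
      · by_cases hc : c = v
        · subst ha hc; simp [hac]; noncomm_ring
        · simp [hc]
      · simp [ha]
    · simp [hac, h.O_zero a c hac]
  simp only [h1]
  simp

theorem i_O (a c x z : I) : iot a c * cO eps x z = cO eps x z * iot a c
    + (if c = z then eps x a else 0) * (if P a c then 1 else 0)
    - (if a = x then eps c z else 0) * (if P a c then 1 else 0) := by
  have h1 : ∀ y, iot a c * (eps y z * eps x y) = eps y z * eps x y * iot a c
     + (if a = y then (if c = z then eps x a else 0) * (if P a c then 1 else 0) else 0)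
     - (if c = y then (if a = x then eps c z else 0) * (if P a c then 1 else 0) else 0) := by
    intro y
    rw [← mul_assoc, h.ie, sub_mul, mul_assoc, h.ie, mul_sub]
    by_cases hac : P a c
    · by_cases hay : a = y
      · subst hay
        by_cases hcz : c = z
        · subst hcz
          by_cases hca : c = a
          · subst hca
            by_cases hcx : c = x
            · subst hcx; simp [hac]; noncomm_ring
            · simp [hac, hcx, Ne.symm hcx]; noncomm_ring
          · simp [hac, hca]; noncomm_ring
        · by_cases hca : c = a
          · subst hca
            by_cases hcx : c = x
            · subst hcx; simp [hac, hcz]; noncomm_ring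
            · simp [hac, hcx, hcz]; noncomm_ring
          · simp [hac, hca, hcz]; noncomm_ring
      · by_cases hcy : c = y
        · subst hcy
          by_cases hax : a = x
          · subst hax; simp [hac, hay]; noncomm_ring
          · simp [hac, hax, hay]; noncomm_ring
        · simp [hay, hcy]; noncomm_ring
    · simp [hac]; noncomm_ring
  conv_lhs => rw [cO, Finset.mul_sum]
  simp only [h1, Finset.sum_add_distrib, Finset.sum_sub_distrib, Finset.sum_ite_eq,
    Finset.mem_univ, if_true]
  rw [cO, Finset.sum_mul]

theorem BB : cB eps iot * cB eps iot = 0 := by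
  have h1 : cB eps iot * cB eps iot =
      ∑ a, ∑ c, ∑ x, ∑ z, (cO eps a c * cO eps x z * (iot a c * iot x z)
        + (if c = z then cO eps a c * eps x a * iot x c else 0)
        - (if a = x then cO eps a c * eps c z * iot a z else 0)) := by
    unfold cB
    simp only [Finset.sum_mul, Finset.mul_sum]
    rw [swap4]
    refine Finset.sum_congr rfl fun a _ => Finset.sum_congr rfl fun c _ =>
      Finset.sum_congr rfl fun x _ => Finset.sum_congr rfl fun z _ => ?_
    rw [mul_assoc, ← mul_assoc (iot a c), h.i_O]
    by_cases hac : P a c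
    · simp only [hac, if_true, mul_one]
      split_ifs with h1 h2 h2
      · subst h1 h2; noncomm_ring
      · subst h1; noncomm_ring
      · subst h2; noncomm_ring
      · noncomm_ring
    · simp [h.O_zero a c hac]
  have h2 : ∑ a, ∑ c, ∑ x, ∑ z, (cO eps a c * cO eps x z * (iot a c * iot x z)) = 0 := by
    apply two_cancel
    rw [add_zero]
    nth_rewrite 1 [swap4]
    simp only [← Finset.sum_add_distrib]
    refine Finset.sum_eq_zero fun x _ => Finset.sum_eq_zero fun y _ => Finset.sum_eq_zero fun u _ =>
      Finset.sum_eq_zero fun v _ => ?_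
    rw [h.ii u v x y, h.O_O u v x y]; noncomm_ring
  rw [h1]
  simp only [Finset.sum_add_distrib, Finset.sum_sub_distrib]
  rw [h2, zero_add, sub_eq_zero]
  unfold cO
  have e1 : ∀ a c x, (∑ b, eps b c * eps a b) * eps x a * iot x c
     = ∑ b, eps b c * eps a b * eps x a * iot x c := by
    intros; simp only [Finset.sum_mul]
  have e2 : ∀ a c z, (∑ b, eps b c * eps a b) * eps c z * iot a z
     = ∑ b, eps c z * eps b c * eps a b * iot a z := by
    intro a c z
    have := h.O_eps a c c z
    unfold cO at this
    rw [this]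
    simp only [Finset.sum_mul, Finset.mul_sum, mul_assoc]
  simp only [Finset.sum_ite_eq, Finset.mem_univ, if_true]
  -- LHS: sum a c x ; RHS : sum a c z
  have e3 : ∀ a c, (∑ x, ∑ z, if a = x then (∑ b, eps b c * eps a b) * eps c z * iot a z else 0)
      = ∑ z, ∑ b, eps c z * eps b c * eps a b * iot a z := by
    intro a c
    rw [Finset.sum_comm]
    simp only [Finset.sum_ite_eq, Finset.mem_univ, if_true, e2]
  simp only [e3, e1]
  -- LHS sum a c x b F(x,a,b,c); RHS sum a c z b F(a,b,c,z)
  have key : ∀ F : I → I → I → I → A, (∑ a, ∑ c, ∑ x, ∑ b, F x a b c) =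
      ∑ a, ∑ c, ∑ z, ∑ b, F a b c z := by
    intro F
    have l : (∑ a, ∑ c, ∑ x, ∑ b, F x a b c) = ∑ x, ∑ a, ∑ b, ∑ c, F x a b c := by
      rw [Finset.sum_congr rfl fun a _ => Finset.sum_comm, Finset.sum_comm]
      refine Finset.sum_congr rfl fun x _ => Finset.sum_congr rfl fun a _ => ?_
      rw [Finset.sum_comm]
    have r : (∑ a, ∑ c, ∑ z, ∑ b, F a b c z) = ∑ x, ∑ a, ∑ b, ∑ c, F x a b c := by
      refine Finset.sum_congr rfl fun x _ => ?_
      rw [Finset.sum_congr rfl fun a _ => Finset.sum_comm, Finset.sum_comm]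
    rw [l, r]
  exact key fun x a b c => eps b c * eps a b * eps x a * iot x c

theorem dd : cd eps iot X * cd eps iot X = 0 := by
  have h1 := h.AA; have h2 := h.AB; have h3 := h.BB
  have : cd eps iot X * cd eps iot X = cA eps X * cA eps X
    - (cA eps X * cB eps iot + cB eps iot * cA eps X) + cB eps iot * cB eps iot := by
    unfold cd; noncomm_ring
  rw [this, h1, h2, h3]; simp

end CEr
end RingCE
end KS

namespace KS
set_option linter.unusedSectionVars false
set_option linter.unusedSimpArgs false
section RingCE2
variable {A : Type*} [Ring A] [Algebra ℚ A] {I : Type*} [Fintype I] [DecidableEq I]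
variable {P : I → I → Prop} [DecidableRel P] {eps iot X : I → I → A}

structure Adjt (P : I → I → Prop) (p q : I) : Prop where
  pq : P p q
  irr : ∀ a b, P a b → ¬ P b a
  no : ∀ b, P p b → ¬ P b q
  up : ∀ c, P p c ↔ c = q ∨ P q c
  lo : ∀ a, P a q ↔ a = p ∨ P a p

def ce (eps iot X : I → I → A) (p q : I) : A :=
  X p q - ∑ a, eps a p * iot a q + ∑ c, eps q c * iot p c
def cf (eps iot : I → I → A) (y : A) (p q : I) : A :=
  y - ∑ a, eps a q * iot a p + ∑ c, eps p c * iot q c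

namespace CEr
variable (h : CEr P eps iot X)
include h

theorem iA (p q : I) (hp : P p q) : iot p q * cA eps X + cA eps X * iot p q = X p q := by
  unfold cA
  simp only [Finset.mul_sum, Finset.sum_mul, ← Finset.sum_add_distrib]
  have h1 : ∀ a b, iot p q * (eps a b * X a b) + eps a b * X a b * iot p q =
      if p = a then (if q = b then X p q else 0) else 0 := by
    intro a b
    rw [← mul_assoc, h.ie, mul_assoc, h.Xi]
    by_cases ha : p = a
    · by_cases hb : q = b
      · subst ha hb; simp [hp]; noncomm_ring
      · simp [hb]; noncomm_ring
    · simp [ha]; noncomm_ring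
  simp [h1]

theorem iB (p q : I) (hp : P p q) : iot p q * cB eps iot + cB eps iot * iot p q =
    ∑ a, eps a p * iot a q - ∑ c, eps q c * iot p c := by
  unfold cB
  simp only [Finset.mul_sum, Finset.sum_mul, ← Finset.sum_add_distrib]
  have h1 : ∀ a c, iot p q * (cO eps a c * iot a c) + cO eps a c * iot a c * iot p q =
      (if q = c then eps a p * iot a q else 0) - (if p = a then eps q c * iot p c else 0) := by
    intro a c
    rw [← mul_assoc, h.i_O, mul_assoc (cO eps a c), h.ii a c]
    simp only [hp, if_true, mul_one]
    split_ifs with h1 h2 h2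
    · subst h1 h2; noncomm_ring
    · subst h1; noncomm_ring
    · subst h2; noncomm_ring
    · noncomm_ring
  simp only [h1, Finset.sum_sub_distrib]
  congr 1
  · simp
  · rw [Finset.sum_comm]; simp

theorem e_eq (p q : I) (hp : P p q) :
    cd eps iot X * iot p q + iot p q * cd eps iot X = ce eps iot X p q := by
  have h1 := h.iA p q hp
  have h2 := h.iB p q hp
  have : cd eps iot X * iot p q + iot p q * cd eps iot X =
    (iot p q * cA eps X + cA eps X * iot p q) - (iot p q * cB eps iot + cB eps iot * iot p q) := by
    unfold cd; noncomm_ring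
  rw [this, h1, h2]; unfold ce; noncomm_ring

theorem eps_d (p q : I) (hp : Adjt P p q) :
    cd eps iot X * eps p q = - (eps p q * cd eps iot X) := by
  have h0 : cO eps p q = 0 := by
    unfold cO
    refine Finset.sum_eq_zero fun b _ => ?_
    by_cases h1 : P p b
    · rw [h.e0 b q (hp.no b h1)]; simp
    · rw [h.e0 p b h1]; simp
  have hA : cA eps X * eps p q = - (eps p q * cA eps X) := by
    unfold cA
    simp only [Finset.mul_sum, Finset.sum_mul, ← Finset.sum_neg_distrib]
    refine Finset.sum_congr rfl fun a _ => Finset.sum_congr rfl fun b _ => ?_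
    rw [mul_assoc, h.Xe, ← mul_assoc, h.ee]; noncomm_ring
  have hB : cB eps iot * eps p q = - (eps p q * cB eps iot) := by
    unfold cB
    simp only [Finset.mul_sum, Finset.sum_mul, ← Finset.sum_neg_distrib]
    refine Finset.sum_congr rfl fun a _ => Finset.sum_congr rfl fun b _ => ?_
    rw [mul_assoc, h.ie, mul_sub]
    have : cO eps a b * (if a = p ∧ b = q ∧ P a b then (1:A) else 0) = 0 := by
      split_ifs with h1
      · rw [h1.1, h1.2.1, h0]; simp
      · simp
    rw [this, ← mul_assoc, h.O_eps]; noncomm_ring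
  unfold cd
  rw [sub_mul, hA, hB]; noncomm_ring

theorem ee0 (p q : I) : eps p q * eps p q = 0 := by
  apply two_cancel; rw [add_zero]; nth_rewrite 1 [h.ee]; simp
theorem ii0 (p q : I) : iot p q * iot p q = 0 := by
  apply two_cancel; rw [add_zero]; nth_rewrite 1 [h.ii]; simp

theorem ie1 (p q : I) (hp : P p q) : iot p q * eps p q = 1 - eps p q * iot p q := by
  rw [h.ie]; simp [hp]

theorem e_d (p q : I) (hp : P p q) :
    ce eps iot X p q * cd eps iot X = cd eps iot X * ce eps iot X p q := by
  rw [← h.e_eq p q hp]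
  have := h.dd
  rw [add_mul, mul_add, mul_assoc (iot p q), this, ← mul_assoc (cd eps iot X) (cd eps iot X), this]
  noncomm_ring

theorem e_i (p q : I) (hp : P p q) :
    ce eps iot X p q * iot p q = iot p q * ce eps iot X p q := by
  rw [← h.e_eq p q hp]
  have := h.ii0 p q
  rw [add_mul, mul_add, mul_assoc (cd eps iot X), this, ← mul_assoc (iot p q) (iot p q), this]
  noncomm_ring

theorem e_e (p q : I) (hp : Adjt P p q) :
    ce eps iot X p q * eps p q = eps p q * ce eps iot X p q := by
  rw [← h.e_eq p q hp.pq]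
  have h1 := h.ie1 p q hp.pq
  have h2 := h.eps_d p q hp
  rw [add_mul, mul_assoc, h1, mul_assoc, h2, mul_sub, ← mul_assoc _ (eps p q), h2]
  rw [mul_neg, ← mul_assoc (iot p q), h1]; noncomm_ring

variable {y : A}

theorem f_i (p q : I) (hp : Adjt P p q) (yi : ∀ a b, y * iot a b = iot a b * y) :
    cf eps iot y p q * iot p q = iot p q * cf eps iot y p q := by
  unfold cf
  rw [add_mul, sub_mul, mul_add, mul_sub, yi, Finset.sum_mul, Finset.mul_sum, Finset.sum_mul,
    Finset.mul_sum]
  congr 1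
  · congr 1
    refine Finset.sum_congr rfl fun a _ => ?_
    rw [mul_assoc, h.ii a p, ← mul_assoc, h.ie]
    by_cases h1 : p = a
    · subst h1; rw [h.i0 p p (fun hh => hp.irr _ _ hh hh)]; simp
    · simp [h1]; noncomm_ring
  · refine Finset.sum_congr rfl fun a _ => ?_
    rw [mul_assoc, h.ii q a, ← mul_assoc, h.ie]
    by_cases h1 : q = a
    · subst h1; rw [h.i0 q q (fun hh => hp.irr _ _ hh hh)]; simp
    · simp [h1]; noncomm_ring

theorem bil (a b c d a' b' c' d' : I) :
    eps a b * iot c d * (eps a' b' * iot c' d') - eps a' b' * iot c' d' * (eps a b * iot c d) =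
    (if c = a' ∧ d = b' ∧ P c d then eps a b * iot c' d' else 0)
    - (if c' = a ∧ d' = b ∧ P c' d' then eps a' b' * iot c d else 0) := by
  have h1 : eps a b * iot c d * (eps a' b' * iot c' d') =
    eps a b * (iot c d * eps a' b') * iot c' d' := by noncomm_ring
  have h2 : eps a' b' * iot c' d' * (eps a b * iot c d) =
    eps a' b' * (iot c' d' * eps a b) * iot c d := by noncomm_ring
  have h3 : eps a b * (eps a' b' * iot c d) * iot c' d' =
     eps a' b' * (eps a b * iot c' d') * iot c d := by
    have : eps a b * (eps a' b' * iot c d) * iot c' d' =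
      (eps a b * eps a' b') * (iot c d * iot c' d') := by noncomm_ring
    rw [this, h.ee, h.ii]; noncomm_ring
  rw [h1, h2, h.ie, h.ie, mul_sub, sub_mul, h3, mul_sub, sub_mul]
  split_ifs <;> noncomm_ring

theorem ef (p q : I) (hp : Adjt P p q) (yi : ∀ a b, y * iot a b = iot a b * y)
    (ye : ∀ a b, y * eps a b = eps a b * y) :
    ce eps iot X p q * cf eps iot y p q - cf eps iot y p q * ce eps iot X p q =
    (X p q * y - y * X p q)
    + ∑ a, (if P a p then eps a p * iot a p - eps a q * iot a q else 0)
    + ∑ c, (if P q c then eps q c * iot q c - eps p c * iot p c else 0) := by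
  have irr : ∀ a, ¬ P a a := fun a hh => hp.irr _ _ hh hh
  have hqp : ¬ P q p := hp.irr _ _ hp.pq
  have hpq : p ≠ q := fun hh => irr p (by have := hp.pq; rwa [← hh] at this)
  have comX : ∀ (z : A) (u v : I → I × I), (∀ a b, z * eps a b = eps a b * z) →
      (∀ a b, z * iot a b = iot a b * z) →
      z * ∑ a, eps (u a).1 (u a).2 * iot (v a).1 (v a).2 =
        (∑ a, eps (u a).1 (u a).2 * iot (v a).1 (v a).2) * z := by
    intro z u v h1 h2
    rw [Finset.mul_sum, Finset.sum_mul]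
    refine Finset.sum_congr rfl fun a _ => ?_
    rw [← mul_assoc, h1, mul_assoc, h2, mul_assoc]
  have x1 := comX (X p q) (fun a => (a, q)) (fun a => (a, p)) (h.Xe p q) (h.Xi p q)
  have x2 := comX (X p q) (fun c => (p, c)) (fun c => (q, c)) (h.Xe p q) (h.Xi p q)
  have y1 := comX y (fun a => (a, p)) (fun a => (a, q)) ye yi
  have y2 := comX y (fun c => (q, c)) (fun c => (p, c)) ye yi
  try dsimp only at x1 x2 y1 y2
  have com2 : ∀ (F G : I → A), (∑ a, F a) * (∑ a, G a) - (∑ a, G a) * (∑ a, F a) =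
      ∑ a, ∑ b, (F a * G b - G b * F a) := by
    intro F G
    simp only [Finset.sum_sub_distrib, Finset.mul_sum, Finset.sum_mul]
    congr 1
    rw [Finset.sum_comm]
  have st1 := com2 (fun a => eps a p * iot a q) (fun a => eps a q * iot a p)
  have st2 := com2 (fun a => eps a p * iot a q) (fun c => eps p c * iot q c)
  have st3 := com2 (fun c => eps q c * iot p c) (fun a => eps a q * iot a p)
  have st4 := com2 (fun c => eps q c * iot p c) (fun c => eps p c * iot q c)
  try dsimp only at st1 st2 st3 st4
  simp only [h.bil] at st1 st2 st3 st4
  have r2 : ∀ a b, ((if a = p ∧ q = b ∧ P a q then eps a p * iot q b else 0) -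
      (if q = a ∧ b = p ∧ P q b then eps p b * iot a q else 0)) = (0 : A) := by
    intro a b
    rw [if_neg (c := q = a ∧ b = p ∧ P q b) (by rintro ⟨_, h2, h3⟩; rw [h2] at h3; exact hqp h3)]
    split_ifs with h1
    · rw [h1.1, h.e0 p p (irr p)]; simp
    · simp
  have r3 : ∀ a b, ((if p = b ∧ a = q ∧ P p a then eps q a * iot b p else 0) -
      (if b = q ∧ p = a ∧ P b p then eps b q * iot p a else 0)) = (0 : A) := by
    intro a b
    rw [if_neg (c := b = q ∧ p = a ∧ P b p) (by rintro ⟨h2, _, h3⟩; rw [h2] at h3; exact hqp h3)]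
    split_ifs with h1
    · rw [h1.2.1, h.e0 q q (irr q)]; simp
    · simp
  have r1 : ∀ a b, ((if a = b ∧ True ∧ P a q then eps a p * iot b p else 0) -
      (if b = a ∧ True ∧ P b p then eps b q * iot a q else 0)) =
      if a = b then (if P a p then eps a p * iot a p - eps a q * iot a q else 0) else 0 := by
    intro a b
    by_cases hab : a = b
    · subst hab
      by_cases hap : P a p
      · have : P a q := (hp.lo a).2 (Or.inr hap)
        simp [hap, this]
      · simp [hap, h.e0 a p hap]
    · simp [hab, Ne.symm hab]
  have r4 : ∀ a b, ((if True ∧ a = b ∧ P p a then eps q a * iot q b else 0) -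
      (if True ∧ b = a ∧ P q b then eps p b * iot p a else 0)) =
      if a = b then (if P q a then eps q a * iot q a - eps p a * iot p a else 0) else 0 := by
    intro a b
    by_cases hab : a = b
    · subst hab
      by_cases hap : P q a
      · have : P p a := (hp.up a).2 (Or.inr hap)
        simp [hap, this]
      · simp [hap, h.e0 q a hap]
    · simp [hab, Ne.symm hab]
  simp only [r1, r2, r3, r4, Finset.sum_ite_eq, Finset.mem_univ, if_true,
    Finset.sum_const_zero] at st1 st2 st3 st4
  rw [← st1, ← st4]
  unfold ce cf
  generalize (∑ a, eps a p * iot a q) = S1 at *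
  generalize (∑ c, eps q c * iot p c) = S2 at *
  generalize (∑ a, eps a q * iot a p) = T1 at *
  generalize (∑ c, eps p c * iot q c) = T2 at *
  have e0 : ∀ x y : A, (x - S1 + S2) * (y - T1 + T2) - (y - T1 + T2) * (x - S1 + S2) =
     (x * y - y * x) - (x * T1 - T1 * x) + (x * T2 - T2 * x) + (y * S1 - S1 * y) - (y * S2 - S2 * y)
     + (S1 * T1 - T1 * S1) - (S1 * T2 - T2 * S1) - (S2 * T1 - T1 * S2) + (S2 * T2 - T2 * S2) := by
    intro x y; noncomm_ring
  rw [e0, st2, st3, x1, x2, y1, y2]; noncomm_ring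

end CEr
end RingCE2
end KS

namespace KS
set_option linter.unusedSectionVars false
set_option linter.unusedSimpArgs false
section Lefschetz
variable {C : Type*} [AddCommGroup C] [Module ℚ C]

structure Lef (e f : Module.End ℚ C) (G : ℤ → Submodule ℚ C) (j0 : ℤ) : Prop where
  he : ∀ k, ∀ v ∈ G k, e v ∈ G (k + 1)
  hf : ∀ k, ∀ v ∈ G k, f v ∈ G (k - 1)
  hef : ∀ k, ∀ v ∈ G k, e (f v) - f (e v) = ((j0 + 2 * k : ℤ) : ℚ) • v
  bd : ∃ B : ℤ, ∀ k, (B < k ∨ k < -B) → G k = ⊥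
  fd : ∀ k, FiniteDimensional ℚ (G k)

namespace Lef
variable {e f : Module.End ℚ C} {G : ℤ → Submodule ℚ C} {j0 : ℤ}

theorem symm (h : Lef e f G j0) : Lef f e (fun k => G (-k)) (-j0) where
  he k v hv := by have := h.hf _ v hv; rwa [show -k - 1 = -(k+1) by ring] at this
  hf k v hv := by have := h.he _ v hv; rwa [show -k + 1 = -(k-1) by ring] at this
  hef k v hv := by
    have := h.hef _ v hv
    rw [← neg_sub, this, ← neg_smul]; congr 1; push_cast; ring
  bd := by
    obtain ⟨B, hB⟩ := h.bd
    exact ⟨B, fun k hk => hB _ (by omega)⟩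
  fd k := h.fd _

theorem noneg (h : Lef e f G j0) {B : ℤ} (hB : ∀ k, B < k → G k = ⊥) (n : ℕ) :
    ∀ k, B < k + n → 0 ≤ j0 + 2 * k → ∀ c : ℚ, 0 < c → ∀ v ∈ G k, f (e v) = -c • v → v = 0 := by
  induction n with
  | zero =>
    intro k hk _ c _ v hv _
    rw [hB k (by simpa using hk)] at hv
    simpa using hv
  | succ n ih =>
    intro k hk hj c hc v hv hfe
    have h1 := h.he k v hv
    have h2 := h.hef _ _ h1
    have h3 : f (e (e v)) = -(c + (j0 + 2 * (k + 1) : ℤ)) • e v := by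
      rw [hfe, map_smul] at h2
      have : f (e (e v)) = -c • e v - ((j0 + 2 * (k + 1) : ℤ) : ℚ) • e v := by
        rw [← h2]; abel
      rw [this, ← sub_smul]; congr 1; ring
    have h4 := ih (k + 1) (by push_cast at hk; linarith) (by linarith) _
      (by have : (0:ℚ) ≤ ((j0 + 2 * (k + 1) : ℤ) : ℚ) := by exact_mod_cast (by linarith)
          linarith) _ h1 h3
    rw [h4, map_zero] at hfe
    have := hfe.symm
    rw [smul_eq_zero] at this
    rcases this with h5 | h5
    · linarith
    · exact h5

theorem comm (h : Lef e f G j0) (i : ℕ) : ∀ k, ∀ v ∈ G k,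
    e ((f ^ (i + 1)) v) =
      (f ^ i) (f (e v) + (((i : ℚ) + 1) * ((j0 + 2 * k : ℤ) - i)) • v) := by
  induction i with
  | zero =>
    intro k v hv
    have := h.hef k v hv
    simp only [zero_add, pow_one, pow_zero, Module.End.one_apply, Nat.cast_zero, one_mul, sub_zero]
    rw [← this]; abel
  | succ i ih =>
    intro k v hv
    have h1 := ih (k - 1) (f v) (h.hf k v hv)
    have h2 := h.hef k v hv
    rw [pow_succ f (i + 1), Module.End.mul_apply, h1, pow_succ f i, Module.End.mul_apply]
    congr 1
    rw [map_add, map_smul]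
    have h3 : e (f v) = f (e v) + ((j0 + 2 * k : ℤ) : ℚ) • v := by rw [← h2]; abel
    rw [h3, map_add, map_smul, add_assoc, ← add_smul]
    congr 2
    push_cast; ring

theorem f_inj (h : Lef e f G j0) (m : ℕ) (k : ℤ) (hk : j0 + 2 * k = m) (i : ℕ) (hi : i ≤ m) :
    ∀ v ∈ G k, (f ^ i) v = 0 → v = 0 := by
  obtain ⟨B, hB⟩ := h.bd
  induction i with
  | zero => intro v _ hv; simpa using hv
  | succ i ih =>
    intro v hv h0
    have h1 := h.comm i k v hv
    rw [h0, map_zero] at h1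
    have h2 := ih (by omega) _ ((G k).add_mem
      (by have := h.hf _ _ (h.he k v hv); rwa [add_sub_cancel_right] at this)
      ((G k).smul_mem _ hv)) h1.symm
    have hc : (0:ℚ) < ((i : ℚ) + 1) * ((j0 + 2 * k : ℤ) - i) := by
      rw [hk]
      have : ((i + 1 : ℕ) : ℚ) ≤ m := by exact_mod_cast hi
      push_cast at this ⊢
      apply mul_pos <;> linarith [(Nat.cast_nonneg i : (0:ℚ) ≤ i)]
    refine h.noneg (B := B) (fun k hk => hB k (Or.inl hk)) (B + 1 - k).toNat k (by omega) (by omega) _ hc v hv ?_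
    rw [neg_smul]; exact eq_neg_of_add_eq_zero_left h2

theorem e_pow_mem (h : Lef e f G j0) (m : ℕ) : ∀ k, ∀ v ∈ G k, (e ^ m) v ∈ G (k + m) := by
  induction m with
  | zero => intro k v hv; simpa using hv
  | succ m ih =>
    intro k v hv
    rw [pow_succ', Module.End.mul_apply]
    have := h.he _ _ (ih k v hv)
    rwa [add_assoc] at this

theorem e_inj (h : Lef e f G j0) (m : ℕ) (k : ℤ) (hk : j0 + 2 * k = -m) :
    ∀ v ∈ G k, (e ^ m) v = 0 → v = 0 := by
  intro v hv h0
  exact h.symm.f_inj m (-k) (by linarith) m le_rfl v (by simpa using hv) h0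

theorem finrank_le (h : Lef e f G j0) (m : ℕ) (k : ℤ) (hk : j0 + 2 * k = -m) :
    Module.finrank ℚ (G k) ≤ Module.finrank ℚ (G (k + m)) := by
  have := h.fd (k + m)
  refine LinearMap.finrank_le_finrank_of_injective (f := (e ^ m).restrict (h.e_pow_mem m k)) ?_
  rw [injective_iff_map_eq_zero]
  intro v hv
  have := congrArg Subtype.val hv
  exact Subtype.ext (h.e_inj m k hk v v.2 this)

theorem finrank_eq (h : Lef e f G j0) (m : ℕ) (k : ℤ) (hk : j0 + 2 * k = -m) :
    Module.finrank ℚ (G k) = Module.finrank ℚ (G (k + m)) := by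
  refine le_antisymm (h.finrank_le m k hk) ?_
  have := h.symm.finrank_le m (-(k + m)) (by linarith)
  rwa [show - -(k + (m:ℤ)) = k + m by ring, show -(-(k + (m:ℤ)) + m) = k by ring] at this

theorem e_surj (h : Lef e f G j0) (m : ℕ) (k : ℤ) (hk : j0 + 2 * k = -m) :
    ∀ w ∈ G (k + m), ∃ v ∈ G k, (e ^ m) v = w := by
  intro w hw
  have := h.fd (k + m)
  have := h.fd k
  have inj : Function.Injective ((e ^ m).restrict (h.e_pow_mem m k)) := by
    rw [injective_iff_map_eq_zero]
    intro v hv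
    have := congrArg Subtype.val hv
    exact Subtype.ext (h.e_inj m k hk v v.2 this)
  have surj := (LinearMap.injective_iff_surjective_of_finrank_eq_finrank (h.finrank_eq m k hk)).1 inj
  obtain ⟨v, hv⟩ := surj ⟨w, hw⟩
  exact ⟨v, v.2, congrArg Subtype.val hv⟩

end Lef

/-- Cone vanishing. -/
def CVan (de e : Module.End ℚ C) (Z : ℤ → ℤ → Submodule ℚ C) (k i : ℤ) : Prop :=
  ∀ a ∈ Z k i, ∀ a' ∈ Z (k + 1) (i - 1), de a = 0 → e a = de a' →
    ∃ b ∈ Z k (i - 1), ∃ b' ∈ Z (k + 1) (i - 2), de b = a ∧ e b - de b' = a'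

structure Chase (de e f : Module.End ℚ C) (Z : ℤ → ℤ → Submodule ℚ C) (j0 : ℤ) : Prop where
  lef : ∀ i, Lef e f (fun k => Z k i) j0
  hd : ∀ k i, ∀ v ∈ Z k i, de v ∈ Z k (i + 1)
  hde : ∀ v, de (e v) = e (de v)
  d2 : ∀ k i, ∀ v ∈ Z k i, de (de v) = 0

namespace Chase
variable {de e f : Module.End ℚ C} {Z : ℤ → ℤ → Submodule ℚ C} {j0 : ℤ}

theorem pow_d (h : Chase de e f Z j0) (m : ℕ) (v : C) : de ((e ^ m) v) = (e ^ m) (de v) := by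
  induction m with
  | zero => simp
  | succ m ih => rw [pow_succ', Module.End.mul_apply, h.hde, ih, Module.End.mul_apply]

theorem hd' (h : Chase de e f Z j0) (k i : ℤ) (v : C) (hv : v ∈ Z k (i - 1)) : de v ∈ Z k i := by
  have := h.hd k (i-1) v hv
  rwa [sub_add_cancel] at this

theorem L0 (h : Chase de e f Z j0) (k i : ℤ) (hk : j0 + 2 * k = -1) : CVan de e Z k i := by
  intro a ha a' ha' h1 h2
  obtain ⟨b, hb, hb1⟩ := (h.lef (i - 1)).e_surj 1 k (by simpa using hk) a' (by simpa using ha')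
  rw [pow_one] at hb1
  refine ⟨b, hb, 0, Submodule.zero_mem _, ?_, by simp [hb1]⟩
  rw [← sub_eq_zero]
  refine (h.lef i).e_inj 1 k (by simpa using hk) _ ((Z k i).sub_mem (h.hd' _ _ _ hb) ha) ?_
  rw [pow_one, map_sub, ← h.hde, hb1, h2, sub_self]

theorem L2 (h : Chase de e f Z j0) (k i : ℤ) (j : ℕ) (hk : j0 + 2 * k = j)
    (hv : CVan de e Z (k - (j + 1)) (i + 1)) : CVan de e Z k i := by
  have hk' : j0 + 2 * (k - (j + 1)) = -((j + 2 : ℕ) : ℤ) := by push_cast; linarith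
  have ek : k - (j + 1) + ((j + 2 : ℕ) : ℤ) = k + 1 := by push_cast; ring
  have ek1 : k - (j + 1) + 1 = k - j := by ring
  have hkj : j0 + 2 * (k - j) = -(j : ℤ) := by linarith
  intro a ha a' ha' h1 h2
  obtain ⟨v0, hv0, hb0'⟩ := (h.lef (i - 1)).e_surj (j + 2) (k - (j + 1)) hk' a' (by rwa [ek])
  obtain ⟨b0, hb0, hb01⟩ : ∃ b0 ∈ Z k (i - 1), e b0 = a' := by
    refine ⟨(e ^ (j + 1)) v0, ?_, ?_⟩
    · have := (h.lef (i - 1)).e_pow_mem (j + 1) _ _ hv0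
      simpa using this
    · rw [← hb0', pow_succ' e (j + 1), Module.End.mul_apply]
  set a1 := a - de b0 with ha1
  have ha1m : a1 ∈ Z k i := (Z k i).sub_mem ha (h.hd' _ _ _ hb0)
  have ea1 : e a1 = 0 := by rw [ha1, map_sub, ← h.hde, hb01, h2, sub_self]
  have hdd : de a1 = 0 := by rw [ha1, map_sub, h1, h.d2 _ _ _ hb0, sub_self]
  obtain ⟨u, hu, hu1⟩ := (h.lef i).e_surj j (k - j) hkj a1 (by simpa using ha1m)
  have hdu : de u = 0 := by
    refine (h.lef (i + 1)).e_inj j (k - j) hkj _ (h.hd _ _ _ hu) ?_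
    rw [← h.pow_d, hu1, hdd]
  obtain ⟨b, hb, b', hb', e1, e2⟩ := hv 0 (Submodule.zero_mem _) u
    (by rw [ek1, add_sub_cancel_right]; exact hu) (map_zero _) (by rw [hdu, map_zero])
  rw [add_sub_cancel_right] at hb
  rw [ek1, show i + 1 - 2 = i - 1 by ring] at hb'
  have pw1 : ∀ v, (e ^ (j + 2)) v = e (e ((e ^ j) v)) := by
    intro v; rw [pow_succ', pow_succ']; rfl
  have pw2 : ∀ v, (e ^ (j + 1)) v = e ((e ^ j) v) := by
    intro v; rw [pow_succ']; rfl
  have pw3 : ∀ v, (e ^ j) (e v) = e ((e ^ j) v) := by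
    intro v; rw [← pw2, pow_succ]; rfl
  have hbm : (e ^ j) b' ∈ Z k (i - 1) := by
    have := (h.lef (i - 1)).e_pow_mem j _ _ hb'; simpa using this
  obtain ⟨q, hq, hq1⟩ := (h.lef (i - 1)).e_surj (j + 2) (k - (j + 1)) hk' (e ((e ^ j) b'))
    (by rw [ek]; exact (h.lef (i - 1)).he _ _ hbm)
  have hbq : b = de q := by
    rw [← sub_eq_zero]
    refine (h.lef i).e_inj (j + 2) (k - (j + 1)) hk' _
      (Submodule.sub_mem _ hb (h.hd' _ _ _ hq)) ?_
    rw [map_sub, ← h.pow_d (j + 2) q, hq1, h.hde, h.pow_d, pw1, ← map_sub, ← pw3, ← map_sub, e2, hu1,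
      ea1]
  refine ⟨b0 + ((e ^ (j + 1)) q - (e ^ j) b'), ?_, 0, Submodule.zero_mem _, ?_, ?_⟩
  · refine Submodule.add_mem _ hb0 (Submodule.sub_mem _ ?_ hbm)
    have := (h.lef (i - 1)).e_pow_mem (j + 1) _ _ hq
    simpa using this
  · rw [map_add, map_sub, h.pow_d, h.pow_d, ← hbq, pw2, ← pw3, ← map_sub, e2, hu1, ha1]; abel
  · rw [map_add, map_sub, hb01, map_zero, ← hq1, pw1, pw2]; abel

theorem L1 (h : Chase de e f Z j0) (k i : ℤ) (j : ℕ) (hk : j0 + 2 * k = j)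
    (hv : CVan de e Z k i) : CVan de e Z (k - (j + 1)) (i + 1) := by
  have hk' : j0 + 2 * (k - (j + 1)) = -((j + 2 : ℕ) : ℤ) := by push_cast; linarith
  have ek : k - (j + 1) + ((j + 2 : ℕ) : ℤ) = k + 1 := by push_cast; ring
  have ek1 : k - (j + 1) + 1 = k - j := by ring
  have hkj : j0 + 2 * (k - j) = -(j : ℤ) := by linarith
  have pw1 : ∀ v, (e ^ (j + 2)) v = e (e ((e ^ j) v)) := by
    intro v; rw [pow_succ', pow_succ']; rfl
  have pw2 : ∀ v, (e ^ (j + 1)) v = e ((e ^ j) v) := by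
    intro v; rw [pow_succ']; rfl
  have pw3 : ∀ v, (e ^ j) (e v) = e ((e ^ j) v) := by
    intro v; rw [← pw2, pow_succ]; rfl
  intro b hb a' ha' h1 h2
  rw [ek1, add_sub_cancel_right] at ha'
  have ham : (e ^ j) a' ∈ Z k i := by
    have := (h.lef i).e_pow_mem j _ _ ha'; simpa using this
  obtain ⟨q, hq, hq1⟩ := (h.lef i).e_surj (j + 2) (k - (j + 1)) hk' (e ((e ^ j) a'))
    (by rw [ek]; exact (h.lef i).he _ _ ham)
  set g := (e ^ j) a' - (e ^ (j + 1)) q with hg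
  have hgm : g ∈ Z k i := by
    refine Submodule.sub_mem _ ham ?_
    have := (h.lef i).e_pow_mem (j + 1) _ _ hq
    simpa using this
  have eg : e g = 0 := by rw [hg, map_sub, ← hq1, pw1, pw2, sub_self]
  have hbq : b = de q := by
    rw [← sub_eq_zero]
    refine (h.lef (i + 1)).e_inj (j + 2) (k - (j + 1)) hk' _
      (Submodule.sub_mem _ hb (h.hd _ _ _ hq)) ?_
    rw [map_sub, ← h.pow_d, hq1, h.hde, h.pow_d, ← h2, pw3, pw1, sub_self]
  have dg : de g = 0 := by
    rw [hg, map_sub, h.pow_d, h.pow_d, ← hbq, ← h2, pw3, pw2, sub_self]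
  obtain ⟨c, hc, c', hc', e1, e2⟩ := hv g hgm 0 (Submodule.zero_mem _) dg (by rw [eg, map_zero])
  obtain ⟨w, hw, hw1⟩ := (h.lef (i - 1)).e_surj j (k - j) hkj c (by simpa using hc)
  refine ⟨q, by rwa [add_sub_cancel_right], -w, ?_, hbq.symm, ?_⟩
  · rw [ek1, show i + 1 - 2 = i - 1 by ring]; exact Submodule.neg_mem _ hw
  · rw [map_neg, sub_neg_eq_add, ← sub_eq_zero]
    refine (h.lef i).e_inj j (k - j) hkj _ ?_ ?_
    · refine Submodule.sub_mem _ (Submodule.add_mem _ ?_ (h.hd' _ _ _ hw)) ha'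
      have := (h.lef i).he _ _ hq
      rwa [ek1] at this
    · rw [map_sub, map_add, ← h.pow_d, hw1, e1, hg, pw2, pw3]; abel

end Chase
end Lefschetz
end KS

namespace KS
set_option linter.unusedSectionVars false
set_option linter.unusedSimpArgs false

/-- the relation: same class mod r, and a < b -/
def Rr (r : ℕ) {n : ℕ} (a b : Fin n) : Prop := a < b ∧ a.val % r = b.val % r

instance (r n : ℕ) : DecidableRel (Rr r (n := n)) := fun a b => by unfold Rr; infer_instance

theorem Rr_iff {r n : ℕ} (hr : 1 ≤ r) (a b : Fin n) :
    Rr r a b ↔ ∃ t : ℕ, 1 ≤ t ∧ b.val = a.val + r * t := by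
  constructor
  · rintro ⟨h1, h2⟩
    have h3 := Nat.div_add_mod a.val r
    have h4 := Nat.div_add_mod b.val r
    have h5 : a.val < b.val := h1
    have h6 : a.val / r < b.val / r := by
      by_contra hh
      push Not at hh
      have := Nat.mul_le_mul_left r hh
      omega
    refine ⟨b.val / r - a.val / r, by omega, ?_⟩
    rw [Nat.mul_sub]
    have := Nat.mul_le_mul_left r h6.le
    omega
  · rintro ⟨t, h1, h2⟩
    refine ⟨?_, ?_⟩
    · show a.val < b.val
      have := Nat.mul_le_mul_left r h1
      omega
    · rw [h2]; simp

theorem adjt_of {r n : ℕ} (hr : 1 ≤ r) {p q : Fin n} (hpq : q.val = p.val + r) :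
    Adjt (Rr r) p q where
  pq := (Rr_iff hr p q).2 ⟨1, le_rfl, by simpa using hpq⟩
  irr a b h1 h2 := absurd h1.1 (not_lt.2 h2.1.le)
  no b h1 h2 := by
    obtain ⟨t, ht, h3⟩ := (Rr_iff hr _ _).1 h1
    obtain ⟨u, hu, h4⟩ := (Rr_iff hr _ _).1 h2
    have := Nat.mul_le_mul_left r ht
    have := Nat.mul_le_mul_left r hu
    omega
  up c := by
    rw [Rr_iff hr, Rr_iff hr]
    constructor
    · rintro ⟨t, ht, h3⟩
      obtain ⟨t, rfl⟩ : ∃ s, t = s + 1 := ⟨t - 1, by omega⟩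
      rcases Nat.eq_zero_or_pos t with h4 | h4
      · left; subst h4; apply Fin.ext; simp at h3; omega
      · right; exact ⟨t, h4, by rw [h3, hpq]; ring⟩
    · rintro (rfl | ⟨t, ht, h3⟩)
      · exact ⟨1, le_rfl, by simpa using hpq⟩
      · exact ⟨t + 1, by omega, by rw [h3, hpq]; ring⟩
  lo a := by
    rw [Rr_iff hr, Rr_iff hr]
    constructor
    · rintro ⟨t, ht, h3⟩
      obtain ⟨t, rfl⟩ : ∃ s, t = s + 1 := ⟨t - 1, by omega⟩
      rcases Nat.eq_zero_or_pos t with h4 | h4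
      · left; subst h4; apply Fin.ext; simp at h3; omega
      · right; refine ⟨t, h4, ?_⟩; rw [Nat.mul_add] at h3; omega
    · rintro (rfl | ⟨t, ht, h3⟩)
      · exact ⟨1, le_rfl, by simpa using hpq⟩
      · exact ⟨t + 1, by omega, by rw [hpq, h3]; ring⟩

abbrev Tt (n : ℕ) := Fin n ×ₗ Fin n

/-- simple-type weight -/
def al {n : ℕ} (a b : Fin n) : Fin n → ℤ := Pi.single a 1 - Pi.single b 1

def wv {n : ℕ} (t : Tt n) : Fin n → ℤ := al (ofLex t).1 (ofLex t).2

def Valid (r : ℕ) {n : ℕ} (Φ : Finset (Tt n)) : Prop := ∀ t ∈ Φ, Rr r (ofLex t).1 (ofLex t).2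

variable {Y : Type*} [AddCommGroup Y] [Module ℚ Y]

structure Dat (r n : ℕ) (Y : Type*) [AddCommGroup Y] [Module ℚ Y] where
  x : Fin n → Fin n → Module.End ℚ Y
  W : (Fin n → ℤ) → Submodule ℚ Y
  comm : ∀ a b c d, Rr r a b → Rr r c d → x a b * x c d - x c d * x a b =
    (if a = d then x c b else 0) - (if b = c then x a d else 0)
  map : ∀ a b, Rr r a b → ∀ κ, ∀ w ∈ W κ, x a b w ∈ W (κ - al a b)
  fin : ∀ κ, FiniteDimensional ℚ (W κ)
  bd : ∃ B : ℤ, ∀ κ a, B < |κ a| → W κ = ⊥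

section
variable {r n : ℕ}

def eps (r : ℕ) (Y : Type*) [AddCommGroup Y] [Module ℚ Y] (a b : Fin n) :
    Module.End ℚ (Finset (Tt n) → Y) := if Rr r a b then cre (toLex (a, b)) else 0
def iot (r : ℕ) (Y : Type*) [AddCommGroup Y] [Module ℚ Y] (a b : Fin n) :
    Module.End ℚ (Finset (Tt n) → Y) := if Rr r a b then ann (toLex (a, b)) else 0

def Dat.px (D : Dat r n Y) (a b : Fin n) : Module.End ℚ (Finset (Tt n) → Y) := pw (D.x a b)

theorem Dat.cer (D : Dat r n Y) : CEr (Rr r) (eps r Y) (iot r Y) D.px where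
  tr a b c h1 h2 := ⟨h1.1.trans h2.1, h1.2.trans h2.2⟩
  e0 a b h := if_neg h
  i0 a b h := if_neg h
  ee a b c d := by
    unfold eps
    split_ifs
    · exact cre_cre _ _
    all_goals simp
  ii a b c d := by
    unfold iot
    split_ifs
    · exact ann_ann _ _
    all_goals simp
  ie a b c d := by
    unfold iot eps
    by_cases h1 : Rr r a b
    · by_cases h2 : Rr r c d
      · simp only [h1, h2, if_true, and_true]
        refine (ann_cre _ _).trans ?_
        congr 2
        simp
      · have : ¬ (a = c ∧ b = d ∧ Rr r a b) := by rintro ⟨rfl, rfl, _⟩; exact h2 h1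
        simp [h2, this]
    · simp [h1]
  Xe a b c d := by
    unfold eps Dat.px
    split_ifs
    · exact pw_cre _ _
    · simp
  Xi a b c d := by
    unfold iot Dat.px
    split_ifs
    · exact pw_ann _ _
    · simp
  XX a b c d h1 h2 := by
    unfold Dat.px
    refine (congrArg pw (D.comm a b c d h1 h2)).trans ?_
    rw [pw_sub]
    split_ifs <;> simp [pw_zero]

def Dat.d (D : Dat r n Y) : Module.End ℚ (Finset (Tt n) → Y) := cd (eps r Y) (iot r Y) D.px

theorem Dat.dd (D : Dat r n Y) : D.d * D.d = 0 := D.cer.dd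

def Dat.Cw (D : Dat r n Y) (ν : Fin n → ℤ) (i : ℤ) : Submodule ℚ (Finset (Tt n) → Y) where
  carrier := {c | ∀ Φ, c Φ ∈ D.W (-ν - ∑ t ∈ Φ, wv t) ∧ (c Φ ≠ 0 → Valid r Φ ∧ (Φ.card : ℤ) = i)}
  add_mem' := by
    intro c c' h h' Φ
    refine ⟨Submodule.add_mem _ (h Φ).1 (h' Φ).1, fun h0 => ?_⟩
    by_cases h1 : c Φ = 0
    · apply (h' Φ).2; intro h2; apply h0; simp [h1, h2]
    · exact (h Φ).2 h1
  zero_mem' := by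
    intro Φ
    exact ⟨Submodule.zero_mem _, fun h => absurd rfl h⟩
  smul_mem' := by
    intro a c h Φ
    refine ⟨Submodule.smul_mem _ _ (h Φ).1, fun h0 => (h Φ).2 ?_⟩
    intro h1; apply h0; simp [h1]

def IsGr (D : Dat r n Y) (T : Module.End ℚ (Finset (Tt n) → Y)) (w : Fin n → ℤ) (j : ℤ) : Prop :=
  ∀ ν i, ∀ c ∈ D.Cw ν i, T c ∈ D.Cw (ν + w) (i + j)

namespace IsGr
variable {D : Dat r n Y} {T S : Module.End ℚ (Finset (Tt n) → Y)} {w w' : Fin n → ℤ} {j j' : ℤ}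

theorem zero : IsGr D 0 w j := fun _ _ _ _ => Submodule.zero_mem _
theorem add (h : IsGr D T w j) (h' : IsGr D S w j) : IsGr D (T + S) w j :=
  fun ν i c hc => Submodule.add_mem _ (h ν i c hc) (h' ν i c hc)
theorem sub (h : IsGr D T w j) (h' : IsGr D S w j) : IsGr D (T - S) w j :=
  fun ν i c hc => Submodule.sub_mem _ (h ν i c hc) (h' ν i c hc)
theorem mul (h : IsGr D T w j) (h' : IsGr D S w' j') {w'' : Fin n → ℤ} {j'' : ℤ}
    (hw : w'' = w + w') (hj : j'' = j + j') : IsGr D (T * S) w'' j'' := by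
  intro ν i c hc
  have := h _ _ _ (h' ν i c hc)
  rw [hw, hj, show ν + (w + w') = ν + w' + w by abel, show i + (j + j') = i + j' + j by ring]
  exact this
theorem sum {ι : Type*} {s : Finset ι} {F : ι → Module.End ℚ (Finset (Tt n) → Y)}
    (h : ∀ a ∈ s, IsGr D (F a) w j) : IsGr D (∑ a ∈ s, F a) w j := by
  intro ν i c hc
  rw [LinearMap.sum_apply]
  exact Submodule.sum_mem _ fun a ha => h a ha ν i c hc

theorem eps (a b : Fin n) : IsGr D (eps r Y a b) (-al a b) 1 := by
  unfold KS.eps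
  split_ifs with h
  · intro ν i c hc Φ
    rw [cre_apply]
    split_ifs with h1
    · have h2 := hc (Φ.erase (toLex (a, b)))
      have h3 := Finset.sum_erase_add Φ wv h1
      have h4 := Finset.card_erase_add_one h1
      refine ⟨Submodule.smul_mem _ _ ?_, fun h0 => ?_⟩
      · convert h2.1 using 2
        rw [← h3]; simp only [wv, ofLex_toLex]; abel
      · have h5 := h2.2 (by intro h6; apply h0; rw [h6, smul_zero])
        refine ⟨?_, by rw [← h5.2, ← h4]; push_cast; ring⟩
        intro t ht
        by_cases h6 : t = toLex (a, b)
        · subst h6; exact h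
        · exact h5.1 t (Finset.mem_erase.2 ⟨h6, ht⟩)
    · exact ⟨Submodule.zero_mem _, fun h => absurd rfl h⟩
  · exact zero

theorem iot (a b : Fin n) : IsGr D (iot r Y a b) (al a b) (-1) := by
  unfold KS.iot
  split_ifs with h
  · intro ν i c hc Φ
    rw [ann_apply]
    split_ifs with h1
    · exact ⟨Submodule.zero_mem _, fun h => absurd rfl h⟩
    · have h2 := hc (insert (toLex (a, b)) Φ)
      have h3 := Finset.sum_insert (f := wv) h1
      have h4 := Finset.card_insert_of_notMem h1
      refine ⟨Submodule.smul_mem _ _ ?_, fun h0 => ?_⟩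
      · convert h2.1 using 2
        rw [h3]; simp only [wv, ofLex_toLex]; abel
      · have h5 := h2.2 (by intro h6; apply h0; rw [h6, smul_zero])
        refine ⟨?_, by rw [← h5.2, h4]; push_cast; ring⟩
        intro t ht
        exact h5.1 t (Finset.mem_insert_of_mem ht)
  · exact zero

theorem pw' {y : Module.End ℚ Y} {w : Fin n → ℤ} (hy : ∀ κ, ∀ v ∈ D.W κ, y v ∈ D.W (κ - w)) :
    IsGr D (pw y) w 0 := by
  intro ν i c hc Φ
  rw [pw_apply]
  refine ⟨?_, fun h0 => ?_⟩
  · convert hy _ _ (hc Φ).1 using 2; abel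
  · rw [add_zero]; apply (hc Φ).2; intro h; apply h0; rw [h, map_zero]

theorem px (a b : Fin n) (h : Rr r a b) : IsGr D (D.px a b) (al a b) 0 := pw' (D.map a b h)

theorem al_add (a b c : Fin n) : al a b + al b c = al a c := by unfold al; abel

theorem d : IsGr D D.d 0 1 := by
  unfold Dat.d cd cA cB
  refine sub (sum fun a _ => sum fun b _ => ?_) (sum fun a _ => sum fun b _ => ?_)
  · by_cases h : Rr r a b
    · exact (eps a b).mul (px a b h) (by abel) rfl
    · rw [D.cer.e0 a b h, zero_mul]; exact zero
  · unfold cO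
    rw [Finset.sum_mul]
    refine sum fun c _ => ?_
    refine ((eps c b).mul (eps a c) rfl rfl).mul (iot a b) ?_ (by ring)
    rw [← al_add a c b]; abel

end IsGr

def Dat.Van (D : Dat r n Y) (ν : Fin n → ℤ) (i : ℤ) : Prop :=
  ∀ c ∈ D.Cw ν i, D.d c = 0 → ∃ b ∈ D.Cw ν (i - 1), D.d b = c

def PSt (D : Dat r n Y) (p q : Fin n) : Prop :=
  ∃ y : Module.End ℚ Y, (∀ κ, ∀ w ∈ D.W κ, y w ∈ D.W (κ + al p q)) ∧
    ∀ κ, ∀ w ∈ D.W κ, D.x p q (y w) - y (D.x p q w) = ((κ q - κ p : ℤ) : ℚ) • w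

end
end KS

namespace KS
set_option linter.unusedSectionVars false
set_option linter.unusedSimpArgs false
section
variable {Y : Type*} [AddCommGroup Y] [Module ℚ Y] {r n : ℕ}

theorem ring_de_de {A : Type*} [Ring A] {d e ε : A} (h1 : d * d = 0) (h2 : d * ε = -(ε * d))
    (h3 : e * d = d * e) (h4 : e * ε = ε * e) (h5 : ε * ε = 0) : (d - ε * e) * (d - ε * e) = 0 := by
  have : (d - ε * e) * (d - ε * e) = d * d - (d * ε) * e - ε * (e * d) + ε * (e * ε) * e := by
    noncomm_ring
  rw [this, h1, h2, h3, h4, ← mul_assoc ε ε, h5]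
  noncomm_ring

theorem ring_i_de {A : Type*} [Ring A] {d e ε ι : A} (h1 : ι * ε = 1 - ε * ι)
    (h2 : d * ι + ι * d = e) (h3 : e * ι = ι * e) : ι * (d - ε * e) = -((d - ε * e) * ι) := by
  have a : ι * (d - ε * e) = ι * d - (ι * ε) * e := by noncomm_ring
  have b : ι * d = e - d * ι := by rw [← h2]; noncomm_ring
  rw [a, b, h1, sub_mul, mul_assoc, ← h3]
  noncomm_ring

theorem sum_wv (Φ : Finset (Tt n)) (p : Fin n) : (∑ t ∈ Φ, wv t) p =
    ∑ c, (if toLex (p, c) ∈ Φ then (1:ℤ) else 0) - ∑ a, (if toLex (a, p) ∈ Φ then (1:ℤ) else 0) := by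
  rw [Finset.sum_apply]
  have h1 : ∑ t ∈ Φ, wv t p = ∑ t : Tt n, if t ∈ Φ then wv t p else 0 := by
    rw [← Finset.sum_filter]; congr 1; ext; simp
  rw [h1]
  have h2 : ∑ t : Tt n, (if t ∈ Φ then wv t p else 0) =
      ∑ x : Fin n × Fin n, if toLex x ∈ Φ then wv (toLex x) p else 0 :=
    (Fintype.sum_equiv toLex _ _ (fun x => rfl)).symm
  rw [h2, Fintype.sum_prod_type]
  have h3 : ∀ a b, (if toLex (a, b) ∈ Φ then wv (toLex (a, b)) p else 0) =
      (if p = a then (if toLex (a, b) ∈ Φ then (1:ℤ) else 0) else 0)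
      - (if p = b then (if toLex (a, b) ∈ Φ then (1:ℤ) else 0) else 0) := by
    intro a b
    simp only [wv, al, ofLex_toLex, Pi.sub_apply, Pi.single_apply]
    split_ifs <;> simp
  simp only [h3, Finset.sum_sub_distrib]
  congr 1
  · rw [Finset.sum_comm]; simp
  · simp

theorem abs_wv (t : Tt n) (p : Fin n) : |wv t p| ≤ 1 := by
  simp only [wv, al, Pi.sub_apply, Pi.single_apply]
  split_ifs <;> simp

theorem abs_sum_wv (Φ : Finset (Tt n)) (p : Fin n) :
    |(∑ t ∈ Φ, wv t) p| ≤ (Fintype.card (Tt n) : ℤ) := by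
  rw [Finset.sum_apply]
  refine (Finset.abs_sum_le_sum_abs _ _).trans ?_
  refine (Finset.sum_le_sum fun t _ => abs_wv t p).trans ?_
  simp only [Finset.sum_const, nsmul_eq_mul, mul_one]
  exact_mod_cast Finset.card_le_univ Φ

theorem Dat.Cw_fd (D : Dat r n Y) (ν : Fin n → ℤ) (i : ℤ) : FiniteDimensional ℚ (D.Cw ν i) := by
  have := fun κ => D.fin κ
  let g : D.Cw ν i →ₗ[ℚ] ((Φ : Finset (Tt n)) → D.W (-ν - ∑ t ∈ Φ, wv t)) :=
    { toFun := fun c Φ => ⟨c.1 Φ, (c.2 Φ).1⟩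
      map_add' := fun _ _ => rfl
      map_smul' := fun _ _ => rfl }
  refine FiniteDimensional.of_injective g ?_
  intro c c' h
  apply Subtype.ext
  ext Φ
  exact congrArg Subtype.val (congrFun h Φ)

theorem Dat.Cw_bd (D : Dat r n Y) : ∃ B : ℤ, ∀ ν a, B < |ν a| → ∀ i, D.Cw ν i = ⊥ := by
  obtain ⟨B, hB⟩ := D.bd
  refine ⟨B + Fintype.card (Tt n), fun ν a h i => ?_⟩
  rw [Submodule.eq_bot_iff]
  intro c hc
  ext Φ
  have h1 := (hc Φ).1
  rw [hB _ a] at h1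
  · simpa using h1
  · have h2 := abs_sum_wv Φ a
    simp only [Pi.sub_apply, Pi.neg_apply]
    have h3 := abs_sub_abs_le_abs_sub (-ν a) ((∑ t ∈ Φ, wv t) a)
    rw [abs_neg] at h3
    linarith

def Dat.Zz (D : Dat r n Y) (p q : Fin n) (ν : Fin n → ℤ) (i : ℤ) : Submodule ℚ (Finset (Tt n) → Y) :=
  D.Cw ν i ⊓ LinearMap.ker (iot r Y p q)

def Dat.e (D : Dat r n Y) (p q : Fin n) : Module.End ℚ (Finset (Tt n) → Y) :=
  ce (eps r Y) (iot r Y) D.px p q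
def Dat.de (D : Dat r n Y) (p q : Fin n) : Module.End ℚ (Finset (Tt n) → Y) :=
  D.d - eps r Y p q * D.e p q

namespace Dat
variable (D : Dat r n Y) {p q : Fin n} (hp : Adjt (Rr r) p q)
include D hp

theorem e_gr : IsGr D (D.e p q) (al p q) 0 := by
  unfold Dat.e ce
  refine IsGr.add (IsGr.sub (IsGr.px p q hp.pq) (IsGr.sum fun a _ => ?_)) (IsGr.sum fun c _ => ?_)
  · refine (IsGr.eps a p).mul (IsGr.iot a q) ?_ (by ring)
    rw [← IsGr.al_add a p q]; abel
  · refine (IsGr.eps q c).mul (IsGr.iot p c) ?_ (by ring)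
    rw [← IsGr.al_add p q c]; abel

theorem f_gr {y : Module.End ℚ Y} (hy : ∀ κ, ∀ w ∈ D.W κ, y w ∈ D.W (κ + al p q)) :
    IsGr D (cf (eps r Y) (iot r Y) (pw y) p q) (-al p q) 0 := by
  unfold cf
  refine IsGr.add (IsGr.sub (IsGr.pw' ?_) (IsGr.sum fun a _ => ?_)) (IsGr.sum fun c _ => ?_)
  · intro κ v hv; rw [sub_neg_eq_add]; exact hy κ v hv
  · refine (IsGr.eps a q).mul (IsGr.iot a p) ?_ (by ring)
    rw [← IsGr.al_add a p q]; abel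
  · refine (IsGr.eps p c).mul (IsGr.iot q c) ?_ (by ring)
    rw [← IsGr.al_add p q c]; abel

theorem e_d : D.e p q * D.d = D.d * D.e p q := D.cer.e_d p q hp.pq
theorem e_eps : D.e p q * eps r Y p q = eps r Y p q * D.e p q := D.cer.e_e p q hp
theorem e_iot : D.e p q * iot r Y p q = iot r Y p q * D.e p q := D.cer.e_i p q hp.pq
theorem d_eps : D.d * eps r Y p q = -(eps r Y p q * D.d) := D.cer.eps_d p q hp
theorem e_def : D.d * iot r Y p q + iot r Y p q * D.d = D.e p q := D.cer.e_eq p q hp.pq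
theorem i_eps : iot r Y p q * eps r Y p q = 1 - eps r Y p q * iot r Y p q :=
  D.cer.ie1 p q hp.pq
theorem eps2 : eps r Y p q * eps r Y p q = 0 := D.cer.ee0 p q
theorem iot2 : iot r Y p q * iot r Y p q = 0 := D.cer.ii0 p q

theorem de_e : D.de p q * D.e p q = D.e p q * D.de p q := by
  unfold Dat.de
  rw [sub_mul, mul_sub, D.e_d hp, ← mul_assoc (D.e p q) (eps r Y p q), D.e_eps hp]

theorem de_de : D.de p q * D.de p q = 0 :=
  ring_de_de D.dd (D.d_eps hp) (D.e_d hp) (D.e_eps hp) (D.eps2 hp)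

theorem i_de : iot r Y p q * D.de p q = -(D.de p q * iot r Y p q) :=
  ring_i_de (D.i_eps hp) (D.e_def hp) (D.e_iot hp)

theorem de_gr : IsGr D (D.de p q) 0 1 := by
  unfold Dat.de
  exact IsGr.d.sub ((IsGr.eps p q).mul (D.e_gr hp) (by abel) (by ring))

theorem lefsch {y : Module.End ℚ Y} (hy : ∀ κ, ∀ w ∈ D.W κ, y w ∈ D.W (κ + al p q))
    (hxy : ∀ κ, ∀ w ∈ D.W κ, D.x p q (y w) - y (D.x p q w) = ((κ q - κ p : ℤ) : ℚ) • w)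
    (ν : Fin n → ℤ) (i : ℤ) :
    Lef (D.e p q) (cf (eps r Y) (iot r Y) (pw y) p q) (fun k => D.Zz p q (ν + k • al p q) i)
      (ν p - ν q) := by
  have hpq : p ≠ q := fun h => by have := hp.pq.1; rw [h] at this; exact lt_irrefl _ this
  have ye : ∀ a b : Fin n, (pw y * eps r Y a b : Module.End ℚ (Finset (Tt n) → Y)) = eps r Y a b * pw y := by
    intro a b; unfold eps; split_ifs
    · exact pw_cre _ _
    · simp
  have yi : ∀ a b : Fin n, (pw y * iot r Y a b : Module.End ℚ (Finset (Tt n) → Y)) = iot r Y a b * pw y := by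
    intro a b; unfold iot; split_ifs
    · exact pw_ann _ _
    · simp
  refine ⟨?_, ?_, ?_, ?_, ?_⟩
  · rintro k v ⟨h1, h2⟩
    refine ⟨?_, ?_⟩
    · have := D.e_gr hp _ _ _ h1
      rwa [add_zero, add_assoc, ← add_one_zsmul] at this
    · have := LinearMap.congr_fun (D.e_iot hp) v
      simp only [Module.End.mul_apply] at this
      simp only [SetLike.mem_coe, LinearMap.mem_ker] at h2 ⊢
      rw [← this, h2, map_zero]
  · rintro k v ⟨h1, h2⟩
    refine ⟨?_, ?_⟩
    · have := D.f_gr hp hy _ _ _ h1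
      rwa [add_zero, add_assoc, ← sub_one_zsmul] at this
    · have := LinearMap.congr_fun (D.cer.f_i p q hp yi) v
      simp only [Module.End.mul_apply] at this
      simp only [SetLike.mem_coe, LinearMap.mem_ker] at h2 ⊢
      rw [← this, h2, map_zero]
  · rintro k c ⟨h1, h2⟩
    have h3 := LinearMap.congr_fun (D.cer.ef p q hp yi ye) c
    simp only [LinearMap.sub_apply, Module.End.mul_apply, LinearMap.add_apply,
      LinearMap.sum_apply] at h3
    refine h3.trans ?_
    ext Φ
    simp only [Pi.add_apply, Pi.sub_apply, Finset.sum_apply, Pi.smul_apply]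
    have num : ∀ a b, (eps r Y a b) ((iot r Y a b) c) Φ =
        if Rr r a b then (if toLex (a, b) ∈ Φ then c Φ else 0) else 0 := by
      intro a b
      unfold eps iot
      by_cases h : Rr r a b
      · simp only [h, if_true]; exact num_apply _ _ _
      · simp [h]
    by_cases h0 : c Φ = 0
    · have : ∀ a b, (eps r Y a b) ((iot r Y a b) c) Φ = 0 := by
        intro a b; rw [num, h0]; simp
      have z1 : ∀ a, (if Rr r a p then eps r Y a p * iot r Y a p - eps r Y a q * iot r Y a q else 0) c Φ
          = 0 := by
        intro a; split_ifs
        · simp [this]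
        · simp
      have z2 : ∀ a, (if Rr r q a then eps r Y q a * iot r Y q a - eps r Y p a * iot r Y p a else 0) c Φ
          = 0 := by
        intro a; split_ifs
        · simp [this]
        · simp
      simp only [z1, z2, Finset.sum_const_zero, h0, smul_zero, add_zero]
      simp [Dat.px, h0]
    · have hV := ((h1 Φ).2 h0).1
      have hn : toLex (p, q) ∉ Φ := by
        intro hin
        have h4 := congrFun h2 (Φ.erase (toLex (p, q)))
        unfold iot at h4
        rw [if_pos hp.pq, ann_apply, if_neg (by simp), Finset.insert_erase hin] at h4
        rw [Pi.zero_apply, smul_eq_zero] at h4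
        rcases h4 with h4 | h4
        · unfold sg at h4; exact absurd h4 (pow_ne_zero _ (by norm_num))
        · exact h0 h4
      have z1 : ∀ a, (if Rr r a p then eps r Y a p * iot r Y a p - eps r Y a q * iot r Y a q else 0) c Φ
          = (((if toLex (a, p) ∈ Φ then 1 else 0) - (if toLex (a, q) ∈ Φ then 1 else 0) : ℤ) : ℚ) • c Φ := by
        intro a
        by_cases h : Rr r a p
        · have h' : Rr r a q := (hp.lo a).2 (Or.inr h)
          simp only [h, if_true, LinearMap.sub_apply, Module.End.mul_apply, Pi.sub_apply, num, h']
          split_ifs <;> simp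
        · have m1 : toLex (a, p) ∉ Φ := fun hh => h (hV _ hh)
          have m2 : toLex (a, q) ∉ Φ := fun hh => by
            rcases (hp.lo a).1 (hV _ hh) with h5 | h5
            · subst h5; exact hn hh
            · exact h h5
          simp [h, m1, m2]
      have z2 : ∀ a, (if Rr r q a then eps r Y q a * iot r Y q a - eps r Y p a * iot r Y p a else 0) c Φ
          = (((if toLex (q, a) ∈ Φ then 1 else 0) - (if toLex (p, a) ∈ Φ then 1 else 0) : ℤ) : ℚ) • c Φ := by
        intro a
        by_cases h : Rr r q a
        · have h' : Rr r p a := (hp.up a).2 (Or.inr h)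
          simp only [h, if_true, LinearMap.sub_apply, Module.End.mul_apply, Pi.sub_apply, num, h']
          split_ifs <;> simp
        · have m1 : toLex (q, a) ∉ Φ := fun hh => h (hV _ hh)
          have m2 : toLex (p, a) ∉ Φ := fun hh => by
            rcases (hp.up a).1 (hV _ hh) with h5 | h5
            · subst h5; exact hn hh
            · exact h h5
          simp [h, m1, m2]
      simp only [z1, z2, ← Finset.sum_smul]
      have z3 : (D.px p q) ((pw y) c) Φ - (pw y) ((D.px p q) c) Φ = _ := hxy _ _ (h1 Φ).1
      rw [z3, ← add_smul, ← add_smul]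
      congr 1
      rw [← Int.cast_sum, ← Int.cast_sum, ← Int.cast_add, ← Int.cast_add]
      congr 1
      simp only [Pi.sub_apply, Pi.neg_apply, Finset.sum_sub_distrib, Pi.add_apply, Pi.smul_apply]
      rw [sum_wv, sum_wv]
      have a1 : al p q p = 1 := by simp [al, hpq]
      have a2 : al p q q = -1 := by simp [al, hpq.symm]
      rw [a1, a2]
      simp only [smul_eq_mul]
      ring
  · obtain ⟨B, hB⟩ := D.Cw_bd
    refine ⟨B + |ν p|, fun k hk => ?_⟩
    unfold Dat.Zz
    rw [hB _ p, bot_inf_eq]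
    have a1 : al p q p = 1 := by simp [al, hpq]
    simp only [Pi.add_apply, Pi.smul_apply, a1, smul_eq_mul, mul_one]
    have : |k| - |ν p| ≤ |ν p + k| := by
      have := abs_sub_abs_le_abs_sub k (-ν p)
      rw [abs_neg, sub_neg_eq_add, add_comm k] at this
      exact this
    have h3 : B + |ν p| < |k| := by
      rcases hk with h | h
      · exact h.trans_le (le_abs_self k)
      · have := neg_abs_le k; linarith
    linarith
  · intro k
    have := D.Cw_fd (ν + k • al p q) i
    exact Submodule.finiteDimensional_of_le (inf_le_left : D.Zz p q (ν + k • al p q) i ≤ _)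

theorem chase {y : Module.End ℚ Y} (hy : ∀ κ, ∀ w ∈ D.W κ, y w ∈ D.W (κ + al p q))
    (hxy : ∀ κ, ∀ w ∈ D.W κ, D.x p q (y w) - y (D.x p q w) = ((κ q - κ p : ℤ) : ℚ) • w)
    (ν : Fin n → ℤ) :
    Chase (D.de p q) (D.e p q) (cf (eps r Y) (iot r Y) (pw y) p q)
      (fun k i => D.Zz p q (ν + k • al p q) i) (ν p - ν q) where
  lef i := D.lefsch hp hy hxy ν i
  hd k i := by
    rintro v ⟨h1, h2⟩
    refine ⟨?_, ?_⟩
    · have := D.de_gr hp _ _ _ h1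
      rwa [add_zero] at this
    · have := LinearMap.congr_fun (D.i_de hp) v
      simp only [SetLike.mem_coe, LinearMap.mem_ker] at h2 ⊢
      refine this.trans ?_
      simp [h2]
  hde v := LinearMap.congr_fun (D.de_e hp) v
  d2 k i v hv := LinearMap.congr_fun (D.de_de hp) v

theorem cone_d (a a' : Finset (Tt n) → Y) :
    D.d (a + eps r Y p q a') = D.de p q a + eps r Y p q (D.e p q a - D.de p q a') := by
  have h1 := LinearMap.congr_fun (D.d_eps hp) a'
  simp only [Module.End.mul_apply, LinearMap.neg_apply] at h1
  have h2 := LinearMap.congr_fun (D.eps2 hp) (D.e p q a')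
  simp only [Module.End.mul_apply, LinearMap.zero_apply] at h2
  unfold Dat.de
  simp only [map_add, map_sub, LinearMap.sub_apply, Module.End.mul_apply, h2]
  rw [h1]; abel

theorem cone_inj {a a' : Finset (Tt n) → Y} (h1 : iot r Y p q a = 0)
    (h2 : iot r Y p q a' = 0) (h : a + eps r Y p q a' = 0) : a = 0 ∧ a' = 0 := by
  have h3 := LinearMap.congr_fun (D.i_eps hp) a'
  simp only [Module.End.mul_apply, LinearMap.sub_apply, Module.End.one_apply, h2, map_zero,
    sub_zero] at h3
  have h4 := congrArg (iot r Y p q) h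
  rw [map_add, h1, h3, zero_add, map_zero] at h4
  subst h4
  simpa using h

theorem cone_split {c : Finset (Tt n) → Y} {ν : Fin n → ℤ} {i : ℤ} (hc : c ∈ D.Cw ν i) :
    ∃ a ∈ D.Zz p q ν i, ∃ a' ∈ D.Zz p q (ν + al p q) (i - 1), c = a + eps r Y p q a' := by
  have h2 : iot r Y p q (iot r Y p q c) = 0 := LinearMap.congr_fun (D.iot2 hp) c
  have h0 : iot r Y p q c ∈ D.Cw (ν + al p q) (i - 1) := IsGr.iot p q ν i c hc
  refine ⟨c - eps r Y p q (iot r Y p q c), ⟨?_, ?_⟩, iot r Y p q c, ⟨h0, h2⟩, by abel⟩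
  · refine Submodule.sub_mem _ hc ?_
    have := IsGr.eps p q _ _ _ h0
    rwa [add_neg_cancel_right, sub_add_cancel] at this
  · have h3 := LinearMap.congr_fun (D.i_eps hp) (iot r Y p q c)
    simp only [Module.End.mul_apply, LinearMap.sub_apply, Module.End.one_apply, h2, map_zero,
      sub_zero] at h3
    simp [h3]

theorem cone_mem {a a' : Finset (Tt n) → Y} {ν : Fin n → ℤ} {i : ℤ} (ha : a ∈ D.Zz p q ν i)
    (ha' : a' ∈ D.Zz p q (ν + al p q) (i - 1)) : a + eps r Y p q a' ∈ D.Cw ν i := by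
  refine Submodule.add_mem _ ha.1 ?_
  have := IsGr.eps p q _ _ _ ha'.1
  rwa [add_neg_cancel_right, sub_add_cancel] at this

theorem de_ker {a : Finset (Tt n) → Y} (h : iot r Y p q a = 0) : iot r Y p q (D.de p q a) = 0 := by
  have := LinearMap.congr_fun (D.i_de hp) a
  refine this.trans ?_
  simp [h]
theorem e_ker {a : Finset (Tt n) → Y} (h : iot r Y p q a = 0) : iot r Y p q (D.e p q a) = 0 := by
  have := LinearMap.congr_fun (D.e_iot hp) a
  simp only [Module.End.mul_apply] at this
  rw [← this, h, map_zero]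

theorem van_iff (ν : Fin n → ℤ) (k i : ℤ) : D.Van (ν + k • al p q) i ↔
    CVan (D.de p q) (D.e p q) (fun k i => D.Zz p q (ν + k • al p q) i) k i := by
  have e1 : ν + (k + 1) • al p q = ν + k • al p q + al p q := by rw [add_one_zsmul, add_assoc]
  constructor
  · intro hV a ha a' ha' h1 h2
    dsimp only at ha' ⊢
    rw [e1] at ha' ⊢
    have := hV _ (D.cone_mem hp ha ha') (by rw [D.cone_d hp, h1, h2, sub_self, map_zero, add_zero])
    obtain ⟨x, hx, hx1⟩ := this
    obtain ⟨b, hb, b', hb', rfl⟩ := D.cone_split hp hx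
    rw [show i - 1 - 1 = i - 2 by ring] at hb'
    refine ⟨b, hb, b', hb', ?_⟩
    rw [D.cone_d hp] at hx1
    have := D.cone_inj hp (a := D.de p q b - a) (a' := D.e p q b - D.de p q b' - a') ?_ ?_ ?_
    · exact ⟨sub_eq_zero.1 this.1, sub_eq_zero.1 this.2⟩
    · rw [map_sub, D.de_ker hp hb.2, ha.2, sub_zero]
    · rw [map_sub, map_sub, D.de_ker hp hb'.2, D.e_ker hp hb.2, ha'.2]; simp
    · rw [map_sub (eps r Y p q)]
      rw [sub_add_sub_comm, hx1, sub_self]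
  · intro hV c hc h0
    obtain ⟨a, ha, a', ha', rfl⟩ := D.cone_split hp hc
    rw [D.cone_d hp] at h0
    have h3 := D.cone_inj hp (D.de_ker hp ha.2)
      (by rw [map_sub, D.de_ker hp ha'.2, D.e_ker hp ha.2, sub_zero]) h0
    obtain ⟨b, hb, b', hb', h4, h5⟩ := hV a ha a' (by dsimp only; rwa [e1]) h3.1 (sub_eq_zero.1 h3.2)
    dsimp only at hb'
    rw [e1, show i - 2 = i - 1 - 1 by ring] at hb'
    exact ⟨_, D.cone_mem hp hb hb', by rw [D.cone_d hp, h4, h5]⟩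

theorem VL0 (hs : PSt D p q) (ν : Fin n → ℤ) (i : ℤ) (hj : ν p - ν q = -1) : D.Van ν i := by
  obtain ⟨y, hy, hxy⟩ := hs
  have := (D.van_iff hp ν 0 i).2 ((D.chase hp hy hxy ν).L0 0 i (by simpa using hj))
  simpa using this

theorem VL2 (hs : PSt D p q) (ν : Fin n → ℤ) (i : ℤ) (hj : 0 ≤ ν p - ν q)
    (hv : D.Van (ν - (ν p - ν q + 1) • al p q) (i + 1)) : D.Van ν i := by
  obtain ⟨y, hy, hxy⟩ := hs
  obtain ⟨j, hj⟩ := Int.eq_ofNat_of_zero_le hj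
  have := (D.van_iff hp ν 0 i).2 ((D.chase hp hy hxy ν).L2 0 i j (by simpa using hj) ?_)
  · simpa using this
  · rw [← D.van_iff hp]
    rw [hj] at hv
    convert hv using 1
    rw [zero_sub, neg_smul, sub_eq_add_neg]

theorem VL1 (hs : PSt D p q) (ν : Fin n → ℤ) (i : ℤ) (hj : 0 ≤ ν p - ν q)
    (hv : D.Van ν i) : D.Van (ν - (ν p - ν q + 1) • al p q) (i + 1) := by
  obtain ⟨y, hy, hxy⟩ := hs
  obtain ⟨j, hj⟩ := Int.eq_ofNat_of_zero_le hj
  have := (D.van_iff hp ν (0 - (j + 1)) (i + 1)).2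
    ((D.chase hp hy hxy ν).L1 0 i j (by simpa using hj) ?_)
  · rw [hj]
    convert this using 1
    rw [zero_sub, neg_smul, sub_eq_add_neg]
  · rw [← D.van_iff hp]; simpa using hv

end Dat
end
end KS

namespace KS
set_option linter.unusedSectionVars false
set_option linter.unusedSimpArgs false
section
variable {Y : Type*} [AddCommGroup Y] [Module ℚ Y] {r n : ℕ}

theorem pw_d {D D' : Dat r n Y} {z : Module.End ℚ Y}
    (h : ∀ a b, Rr r a b → ∀ w, D'.x a b (z w) = z (D.x a b w)) :
    (pw z * D.d : Module.End ℚ (Finset (Tt n) → Y)) = D'.d * pw z := by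
  have ye : ∀ a b : Fin n, (pw z * eps r Y a b : Module.End ℚ (Finset (Tt n) → Y)) =
      eps r Y a b * pw z := by
    intro a b; unfold eps; split_ifs
    · exact pw_cre _ _
    · simp
  have yi : ∀ a b : Fin n, (pw z * iot r Y a b : Module.End ℚ (Finset (Tt n) → Y)) =
      iot r Y a b * pw z := by
    intro a b; unfold iot; split_ifs
    · exact pw_ann _ _
    · simp
  unfold Dat.d cd cA cB cO
  rw [mul_sub, sub_mul]
  congr 1
  · rw [Finset.mul_sum, Finset.sum_mul]
    refine Finset.sum_congr rfl fun a _ => ?_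
    rw [Finset.mul_sum, Finset.sum_mul]
    refine Finset.sum_congr rfl fun b _ => ?_
    by_cases hab : Rr r a b
    · rw [← mul_assoc, ye, mul_assoc, mul_assoc]
      congr 1
      refine LinearMap.ext fun c => funext fun Φ => ?_
      exact (h a b hab (c Φ)).symm
    · rw [D.cer.e0 a b hab]; simp
  · rw [Finset.mul_sum, Finset.sum_mul]
    refine Finset.sum_congr rfl fun a _ => ?_
    rw [Finset.mul_sum, Finset.sum_mul]
    refine Finset.sum_congr rfl fun b _ => ?_
    rw [mul_assoc _ (iot r Y a b), ← yi, ← mul_assoc, ← mul_assoc]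
    congr 1
    rw [Finset.mul_sum, Finset.sum_mul]
    refine Finset.sum_congr rfl fun c _ => ?_
    rw [← mul_assoc, ye, mul_assoc, ye, mul_assoc]

theorem T1 {D D' D'' : Dat r n Y} {g mX : Module.End ℚ Y} {β : Fin n → ℤ}
    (hg : ∀ a b, Rr r a b → ∀ w, D'.x a b (g w) = g (D.x a b w))
    (hm : ∀ a b, Rr r a b → ∀ w, D.x a b (mX w) = mX (D''.x a b w))
    (inj : ∀ w, mX w = 0 → w = 0)
    (hW : ∀ κ, D'.W κ ≤ D.W κ) (hid : ∀ κ, ∀ w ∈ D'.W κ, g w = w)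
    (gW : ∀ κ, ∀ w ∈ D.W κ, g w ∈ D'.W κ) (gm : ∀ w, g (mX w) = 0)
    (mW : ∀ κ, ∀ w ∈ D''.W κ, mX w ∈ D.W (κ + β))
    (ker : ∀ κ, ∀ w ∈ D.W κ, g w = 0 → ∃ u ∈ D''.W (κ - β), mX u = w)
    {ν : Fin n → ℤ} {i : ℤ} (v1 : D.Van ν i) (v2 : D''.Van (ν + β) (i + 1)) : D'.Van ν i := by
  intro c hc hdc
  have hgd := pw_d hg
  have hmd := pw_d hm
  have hc1 : c ∈ D.Cw ν i := fun Φ => ⟨hW _ (hc Φ).1, (hc Φ).2⟩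
  have hgc : pw g c = c := by
    ext Φ; exact hid _ _ (hc Φ).1
  have hgdc : pw g (D.d c) = 0 := by
    have := LinearMap.congr_fun hgd c
    refine this.trans ?_
    rw [Module.End.mul_apply, hgc, hdc]
  have hdC := IsGr.d (D := D) _ _ _ hc1
  rw [add_zero] at hdC
  have h1 : ∀ Φ, ∃ u ∈ D''.W (-(ν + β) - ∑ t ∈ Φ, wv t), mX u = D.d c Φ := by
    intro Φ
    have := ker _ _ (hdC Φ).1 (congrFun hgdc Φ)
    rwa [show -(ν + β) - ∑ t ∈ Φ, wv t = -ν - ∑ t ∈ Φ, wv t - β by abel]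
  choose u hu hu1 using h1
  have hmu : pw mX u = D.d c := by ext Φ; exact hu1 Φ
  have huC : u ∈ D''.Cw (ν + β) (i + 1) := by
    refine fun Φ => ⟨hu Φ, fun h0 => (hdC Φ).2 ?_⟩
    rw [← hu1]
    exact fun h => h0 (inj _ h)
  have hdu : D''.d u = 0 := by
    have h2 := LinearMap.congr_fun hmd u
    simp only [Module.End.mul_apply] at h2
    rw [hmu] at h2
    have h3 : D.d (D.d c) = 0 := LinearMap.congr_fun D.dd c
    rw [h3] at h2
    ext Φ
    exact inj _ (congrFun h2 Φ)
  obtain ⟨v, hv, rfl⟩ := v2 u huC hdu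
  rw [add_sub_cancel_right] at hv
  have hmv : pw mX v ∈ D.Cw ν i := by
    refine fun Φ => ⟨?_, fun h0 => (hv Φ).2 ?_⟩
    · have := mW _ _ (hv Φ).1
      rwa [show -(ν + β) - ∑ t ∈ Φ, wv t + β = -ν - ∑ t ∈ Φ, wv t by abel] at this
    · intro h; apply h0; rw [pw_apply, h, map_zero]
  have h2 := LinearMap.congr_fun hmd v
  simp only [Module.End.mul_apply] at h2
  obtain ⟨b, hb, hb1⟩ := v1 (c - pw mX v) (Submodule.sub_mem _ hc1 hmv) (by
    rw [map_sub, ← h2, hmu, sub_self])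
  refine ⟨pw g b, fun Φ => ⟨gW _ _ (hb Φ).1, fun h0 => (hb Φ).2 ?_⟩, ?_⟩
  · intro h; apply h0; rw [pw_apply, h, map_zero]
  · have h3 := LinearMap.congr_fun hgd b
    simp only [Module.End.mul_apply] at h3
    rw [← h3, hb1, map_sub, hgc]
    ext Φ
    simp [gm]
end
end KS

namespace KS
set_option linter.unusedSectionVars false
set_option linter.unusedSimpArgs false
section
variable {n L : ℕ} {Z : Type*} [AddCommGroup Z] [Module ℚ Z]

abbrev Sg (n L : ℕ) := Fin n ×ₗ Fin L

def Aop (Z : Type*) [AddCommGroup Z] [Module ℚ Z] (L : ℕ) {n : ℕ} (a b : Fin n) :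
    Module.End ℚ (Finset (Sg n L) → Z) :=
  ∑ c : Fin L, cre (toLex (a, c)) * ann (toLex (b, c))

theorem Aop_comm (a b c d : Fin n) :
    Aop Z L a b * Aop Z L c d - Aop Z L c d * Aop Z L a b =
      (if b = c then Aop Z L a d else 0) - (if d = a then Aop Z L c b else 0) := by
  unfold Aop
  simp only [Finset.sum_mul_sum]
  rw [Finset.sum_comm (f := fun i j => (cre (toLex (c, i)) * ann (toLex (d, i)) *
    (cre (toLex (a, j)) * ann (toLex (b, j))) : Module.End ℚ (Finset (Sg n L) → Z)))]
  rw [← Finset.sum_sub_distrib]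
  have : ∀ i j : Fin L, _ := fun i j => bil_comm (Y := Z) (toLex (a, i) : Sg n L) (toLex (b, i))
    (toLex (c, j)) (toLex (d, j))
  have h2 : ∀ i : Fin L, (∑ j : Fin L, cre (toLex (a, i)) * ann (toLex (b, i)) *
      (cre (toLex (c, j)) * ann (toLex (d, j))) - ∑ j : Fin L, cre (toLex (c, j)) * ann (toLex (d, j)) *
        (cre (toLex (a, i)) * ann (toLex (b, i))) : Module.End ℚ (Finset (Sg n L) → Z)) =
      (if b = c then cre (toLex (a, i)) * ann (toLex (d, i)) else 0) -
      (if d = a then cre (toLex (c, i)) * ann (toLex (b, i)) else 0) := by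
    intro i
    rw [← Finset.sum_sub_distrib]
    simp only [this]
    rw [Finset.sum_sub_distrib]
    congr 1
    · by_cases h : b = c
      · subst h; simp
      · simp [h]
    · by_cases h : d = a
      · subst h; simp
      · simp [h]
  rw [Finset.sum_congr rfl fun i _ => h2 i, Finset.sum_sub_distrib]
  congr 1
  · split_ifs <;> simp
  · split_ifs <;> simp

theorem pw_Aop (z : Module.End ℚ Z) (a b : Fin n) : pw z * Aop Z L a b = Aop Z L a b * pw z := by
  unfold Aop
  rw [Finset.mul_sum, Finset.sum_mul]
  refine Finset.sum_congr rfl fun c _ => ?_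
  rw [← mul_assoc, pw_cre, mul_assoc, pw_ann, mul_assoc]

/-- weight of a subset -/
def wS {n L : ℕ} (D0 : ℤ) (S : Finset (Sg n L)) : Fin n → ℤ :=
  fun a => ∑ c : Fin L, (if toLex (a, c) ∈ S then 1 else 0) - (L - D0)

theorem wS_insert (D0 : ℤ) (S : Finset (Sg n L)) (a : Fin n) (c : Fin L) (h : toLex (a, c) ∉ S) :
    wS D0 (insert (toLex (a, c)) S) = wS D0 S + Pi.single a 1 := by
  ext b
  simp only [wS, Pi.add_apply, Pi.single_apply]
  have : ∀ c', (if (toLex (b, c') : Sg n L) ∈ insert (toLex (a, c)) S then (1:ℤ) else 0) =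
      (if toLex (b, c') ∈ S then 1 else 0) + (if b = a ∧ c' = c then 1 else 0) := by
    intro c'
    simp only [Finset.mem_insert]
    by_cases h1 : b = a ∧ c' = c
    · obtain ⟨rfl, rfl⟩ := h1; simp [h]
    · have : ¬ (toLex (b, c') = toLex (a, c)) := by
        intro h2; apply h1; simpa using h2
      simp [h1, this]
  simp only [this, Finset.sum_add_distrib]
  by_cases hb : b = a
  · simp [hb]; ring
  · simp [hb]

theorem Aop_wt (D0 : ℤ) (a b : Fin n) (u : Finset (Sg n L) → Z) (κ : Fin n → ℤ)
    (h : ∀ S, u S ≠ 0 → wS D0 S = κ) : ∀ S, Aop Z L a b u S ≠ 0 → wS D0 S = κ + al a b := by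
  intro S hS
  unfold Aop at hS
  rw [LinearMap.sum_apply, Finset.sum_apply] at hS
  obtain ⟨c, -, hc⟩ := Finset.exists_ne_zero_of_sum_ne_zero hS
  rw [Module.End.mul_apply, cre_apply] at hc
  split_ifs at hc with h1
  · rw [ann_apply] at hc
    split_ifs at hc with h2
    · simp at hc
    · have h3 := h (insert (toLex (b, c)) (S.erase (toLex (a, c)))) (by intro h4; simp [h4] at hc)
      rw [wS_insert _ _ _ _ h2] at h3
      have h4 := wS_insert D0 (S.erase (toLex (a, c))) a c (by simp)
      rw [Finset.insert_erase h1] at h4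
      rw [h4, ← h3]; unfold al; abel
  · exact absurd rfl hc

theorem Aop_diag (D0 : ℤ) (a : Fin n) (u : Finset (Sg n L) → Z) (S : Finset (Sg n L)) :
    Aop Z L a a u S = ((wS D0 S a + (L - D0) : ℤ) : ℚ) • u S := by
  unfold Aop wS
  rw [LinearMap.sum_apply, Finset.sum_apply, sub_add_cancel, Int.cast_sum, Finset.sum_smul]
  refine Finset.sum_congr rfl fun c _ => ?_
  rw [num_apply]
  split_ifs <;> simp

/-- pairing -/
def pair {L n : ℕ} (φ : Finset (Sg n L) → ℚ) (y : Finset (Sg n L) → Z) : Z := ∑ S, φ S • y S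

theorem pair_cre (t : Sg n L) (φ : Finset (Sg n L) → ℚ) (y : Finset (Sg n L) → Z) :
    pair φ (cre t y) = pair (ann t φ) y := by
  unfold pair
  simp only [cre_apply, ann_apply, smul_ite, smul_zero, ite_smul, zero_smul]
  rw [← Finset.sum_filter]
  have : ∀ S : Finset (Sg n L), (if t ∈ S then 0 else (sg t S • φ (insert t S)) • y S) =
     (if t ∉ S then (sg t S • φ (insert t S)) • y S else 0) := by
    intro S; split_ifs <;> rfl
  simp only [this]
  rw [← Finset.sum_filter]
  refine Finset.sum_nbij' (fun S => S.erase t) (fun S => insert t S) ?_ ?_ ?_ ?_ ?_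
  · intro S _; simp
  · intro S _; simp
  · intro S h; simp at h; exact Finset.insert_erase h
  · intro S h; simp at h; exact Finset.erase_insert h
  · intro S h
    simp at h
    rw [Finset.insert_erase h, sg_erase h, smul_smul, smul_eq_mul]
    simp [mul_comm]

theorem pair_ann (t : Sg n L) (φ : Finset (Sg n L) → ℚ) (y : Finset (Sg n L) → Z) :
    pair φ (ann t y) = pair (cre t φ) y := by
  unfold pair
  simp only [cre_apply, ann_apply, smul_ite, smul_zero, ite_smul, zero_smul]
  symm
  rw [← Finset.sum_filter]
  have : ∀ S : Finset (Sg n L), (if t ∈ S then 0 else φ S • sg t S • y (insert t S)) =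
     (if t ∉ S then φ S • sg t S • y (insert t S) else 0) := by
    intro S; split_ifs <;> rfl
  simp only [this]
  rw [← Finset.sum_filter]
  refine Finset.sum_nbij' (fun S => S.erase t) (fun S => insert t S) ?_ ?_ ?_ ?_ ?_
  · intro S _; simp
  · intro S _; simp
  · intro S h; simp at h; exact Finset.insert_erase h
  · intro S h; simp at h; exact Finset.erase_insert h
  · intro S h
    simp at h
    rw [Finset.insert_erase h, sg_erase h, smul_smul, smul_eq_mul]
    simp [mul_comm]

theorem pair_sum_right {ι : Type*} (s : Finset ι) (φ : Finset (Sg n L) → ℚ)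
    (y : ι → Finset (Sg n L) → Z) : pair φ (∑ i ∈ s, y i) = ∑ i ∈ s, pair φ (y i) := by
  unfold pair
  rw [Finset.sum_comm]
  simp [Finset.smul_sum]

theorem pair_sum_left {ι : Type*} (s : Finset ι) (φ : ι → Finset (Sg n L) → ℚ)
    (y : Finset (Sg n L) → Z) : pair (∑ i ∈ s, φ i) y = ∑ i ∈ s, pair (φ i) y := by
  unfold pair
  rw [Finset.sum_comm]
  simp [Finset.sum_smul]

theorem pair_Aop (a b : Fin n) (φ : Finset (Sg n L) → ℚ) (y : Finset (Sg n L) → Z) :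
    pair φ (Aop Z L a b y) = pair (Aop ℚ L b a φ) y := by
  unfold Aop
  rw [LinearMap.sum_apply, LinearMap.sum_apply, pair_sum_right, pair_sum_left]
  refine Finset.sum_congr rfl fun c _ => ?_
  rw [Module.End.mul_apply, pair_cre, pair_ann]; rfl

theorem pair_add (φ : Finset (Sg n L) → ℚ) (y z : Finset (Sg n L) → Z) :
    pair φ (y + z) = pair φ y + pair φ z := by
  simp [pair, Finset.sum_add_distrib]
theorem pair_smul (c : ℚ) (φ : Finset (Sg n L) → ℚ) (y : Finset (Sg n L) → Z) :
    pair φ (c • y) = c • pair φ y := by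
  simp only [pair, Finset.smul_sum, Pi.smul_apply, smul_comm c]
theorem pair_add_left (φ ψ : Finset (Sg n L) → ℚ) (z : Finset (Sg n L) → Z) :
    pair (φ + ψ) z = pair φ z + pair ψ z := by
  simp [pair, Finset.sum_add_distrib, add_smul]
theorem pair_smul_left (c : ℚ) (φ : Finset (Sg n L) → ℚ) (y : Finset (Sg n L) → Z) :
    pair (c • φ) y = c • pair φ y := by
  simp only [pair, Finset.smul_sum, Pi.smul_apply, smul_smul, smul_eq_mul]
theorem pair_zero_left (y : Finset (Sg n L) → Z) : pair (0 : Finset (Sg n L) → ℚ) y = 0 := by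
  simp [pair]
theorem pair_zero (φ : Finset (Sg n L) → ℚ) : pair φ (0 : Finset (Sg n L) → Z) = 0 := by
  simp [pair]
theorem pair_comm (φ ψ : Finset (Sg n L) → ℚ) : pair φ ψ = pair ψ φ := by
  simp [pair, mul_comm]
theorem pair_self (φ : Finset (Sg n L) → ℚ) (h : pair φ φ = 0) : φ = 0 := by
  unfold pair at h
  simp only [smul_eq_mul] at h
  rw [Finset.sum_eq_zero_iff_of_nonneg (fun i _ => mul_self_nonneg _)] at h
  ext S
  simpa using h S (Finset.mem_univ _)
end
end KS

namespace KS
set_option linter.unusedSectionVars false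
set_option linter.unusedSimpArgs false
section
variable {n L : ℕ} {Z : Type*} [AddCommGroup Z] [Module ℚ Z]

def lamS (L : ℕ) (D0 : ℤ) (lam : Fin n → ℤ) : Finset (Sg n L) :=
  Finset.univ.filter (fun t => lam (ofLex t).1 + D0 ≤ ((ofLex t).2.val : ℤ))

def vv (L : ℕ) (D0 : ℤ) (lam : Fin n → ℤ) : Finset (Sg n L) → ℚ := Pi.single (lamS L D0 lam) 1

theorem mem_lamS (D0 : ℤ) (lam : Fin n → ℤ) (a : Fin n) (c : Fin L) :
    toLex (a, c) ∈ lamS L D0 lam ↔ lam a + D0 ≤ (c.val : ℤ) := by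
  simp [lamS]

theorem vv_kill (D0 : ℤ) (lam : Fin n → ℤ) (a b : Fin n) (hab : a ≠ b) (h : lam a ≤ lam b) :
    Aop ℚ L a b (vv L D0 lam) = 0 := by
  unfold Aop
  rw [LinearMap.sum_apply]
  refine Finset.sum_eq_zero fun c _ => ?_
  ext S
  rw [Module.End.mul_apply, cre_apply]
  split_ifs with h1
  · rw [ann_apply]
    split_ifs with h2
    · simp
    · have : insert (toLex (b, c)) (S.erase (toLex (a, c))) ≠ lamS L D0 lam := by
        intro h3
        have h4 : toLex (b, c) ∈ lamS L D0 lam := by rw [← h3]; simp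
        have h5 : toLex (a, c) ∉ lamS L D0 lam := by rw [← h3]; simp [hab]
        rw [mem_lamS] at h4 h5
        omega
      simp [vv, Pi.single_apply, this]
  · rfl

theorem wS_lamS (D0 : ℤ) (lam : Fin n → ℤ) (h : ∀ a, 0 ≤ lam a + D0 ∧ lam a + D0 ≤ L) :
    wS D0 (lamS L D0 lam) = -lam := by
  ext a
  simp only [wS, Pi.neg_apply, mem_lamS]
  obtain ⟨k, hk⟩ := Int.eq_ofNat_of_zero_le (h a).1
  have hk' : k ≤ L := by have := (h a).2; omega
  have : ∑ c : Fin L, (if lam a + D0 ≤ (c.val : ℤ) then (1:ℤ) else 0) = L - k := by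
    rw [Fin.sum_univ_eq_sum_range (fun c => if lam a + D0 ≤ (c : ℤ) then (1:ℤ) else 0) L, hk]
    rw [← Finset.sum_filter]
    have h2 : (Finset.range L).filter (fun c : ℕ => (k : ℤ) ≤ (c : ℤ)) = Finset.Ico k L := by
      ext c; simp; omega
    rw [h2]; simp; omega
  rw [this]; omega

theorem vv_supp (D0 : ℤ) (lam : Fin n → ℤ) (h : ∀ a, 0 ≤ lam a + D0 ∧ lam a + D0 ≤ L) :
    ∀ S, vv L D0 lam S ≠ 0 → wS D0 S = -lam := by
  intro S hS
  unfold vv at hS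
  rw [Pi.single_apply] at hS
  split_ifs at hS with h1
  · rw [h1]; exact wS_lamS D0 lam h
  · exact absurd rfl hS

inductive Gen (r : ℕ) (v : Finset (Sg n L) → ℚ) : (Finset (Sg n L) → ℚ) → Prop
  | base : Gen r v v
  | step (a b : Fin n) (u : Finset (Sg n L) → ℚ) : Rr r a b → Gen r v u → Gen r v (Aop ℚ L a b u)

def Vsp (r : ℕ) (v : Finset (Sg n L) → ℚ) : Submodule ℚ (Finset (Sg n L) → ℚ) :=
  Submodule.span ℚ {u | Gen r v u}

theorem Vsp_up (r : ℕ) (v : Finset (Sg n L) → ℚ) (a b : Fin n) (h : Rr r a b) :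
    ∀ u ∈ Vsp r v, Aop ℚ L a b u ∈ Vsp r v := by
  intro u hu
  induction hu using Submodule.span_induction with
  | mem x hx => exact Submodule.subset_span (Gen.step a b x h hx)
  | zero => rw [map_zero]; exact Submodule.zero_mem _
  | add x y _ _ hx hy => rw [map_add]; exact Submodule.add_mem _ hx hy
  | smul c x _ hx => rw [map_smul]; exact Submodule.smul_mem _ _ hx

theorem Vsp_all (r : ℕ) (D0 : ℤ) (lam : Fin n → ℤ) (hl : ∀ a b, Rr r a b → lam b ≤ lam a)
    (a b : Fin n) (h : a.val % r = b.val % r) :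
    ∀ u ∈ Vsp r (vv L D0 lam), Aop ℚ L a b u ∈ Vsp r (vv L D0 lam) := by
  have key : ∀ u, Gen r (vv L D0 lam) u → ∀ a b : Fin n, a.val % r = b.val % r →
      Aop ℚ L a b u ∈ Vsp r (vv L D0 lam) := by
    intro u hu
    induction hu with
    | base =>
      intro a b h
      rcases lt_trichotomy a b with h1 | h1 | h1
      · exact Submodule.subset_span (Gen.step a b _ ⟨h1, h⟩ Gen.base)
      · subst h1
        have : Aop ℚ L a a (vv L D0 lam) =
            ((wS D0 (lamS L D0 lam) a + (L - D0) : ℤ) : ℚ) • vv L D0 lam := by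
          ext S
          rw [Aop_diag D0, Pi.smul_apply]
          by_cases hS : S = lamS L D0 lam
          · rw [hS]
          · simp [vv, Pi.single_apply, hS]
        rw [this]
        exact Submodule.smul_mem _ _ (Submodule.subset_span Gen.base)
      · rw [vv_kill D0 lam a b h1.ne' (hl b a ⟨h1, h.symm⟩)]
        exact Submodule.zero_mem _
    | step c d u hcd _ ih =>
      intro a b h
      have h1 := LinearMap.congr_fun (Aop_comm (Z := ℚ) (L := L) a b c d) u
      rw [LinearMap.sub_apply, Module.End.mul_apply, Module.End.mul_apply, sub_eq_iff_eq_add] at h1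
      rw [h1]
      refine Submodule.add_mem _ (Submodule.sub_mem _ ?_ ?_) (Vsp_up r _ c d hcd _ (ih a b h))
      · split_ifs with h2
        · subst h2; exact ih a d (h.trans hcd.2)
        · exact Submodule.zero_mem _
      · split_ifs with h2
        · subst h2; exact ih c b (hcd.2.trans h)
        · exact Submodule.zero_mem _
  intro u hu
  induction hu using Submodule.span_induction with
  | mem x hx => exact key x hx a b h
  | zero => rw [map_zero]; exact Submodule.zero_mem _
  | add x y _ _ hx hy => rw [map_add]; exact Submodule.add_mem _ hx hy
  | smul c x _ hx => rw [map_smul]; exact Submodule.smul_mem _ _ hx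

def Nn (r : ℕ) (v : Finset (Sg n L) → ℚ) : Set (Finset (Sg n L) → ℚ) :=
  {φ | ∀ u ∈ Vsp r v, pair φ u = 0}

def WV (r : ℕ) (D0 : ℤ) (v : Finset (Sg n L) → ℚ) (κ : Fin n → ℤ) :
    Submodule ℚ (Finset (Sg n L) → ℚ) where
  carrier := {u | (∀ φ ∈ Nn r v, pair φ u = 0) ∧ ∀ S, u S ≠ 0 → wS D0 S = κ}
  add_mem' := by
    rintro u u' ⟨h1, h2⟩ ⟨h1', h2'⟩
    refine ⟨fun φ hφ => by rw [pair_add, h1 φ hφ, h1' φ hφ, add_zero], fun S hS => ?_⟩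
    by_cases h : u S = 0
    · apply h2' S; intro h'; apply hS; simp [h, h']
    · exact h2 S h
  zero_mem' := ⟨fun φ _ => pair_zero φ, fun S h => absurd rfl h⟩
  smul_mem' := by
    rintro c u ⟨h1, h2⟩
    refine ⟨fun φ hφ => by rw [pair_smul, h1 φ hφ, smul_zero], fun S hS => h2 S ?_⟩
    intro h; apply hS; simp [h]

section
variable (r : ℕ) (D0 : ℤ) (lam : Fin n → ℤ) (hl : ∀ a b, Rr r a b → lam b ≤ lam a)
include hl
theorem WV_map (a b : Fin n) (h : a.val % r = b.val % r) (κ : Fin n → ℤ) :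
    ∀ u ∈ WV r D0 (vv L D0 lam) κ, Aop ℚ L a b u ∈ WV r D0 (vv L D0 lam) (κ + al a b) := by
  rintro u ⟨h1, h2⟩
  refine ⟨fun φ hφ => ?_, Aop_wt D0 a b u κ h2⟩
  rw [pair_Aop]
  apply h1
  intro w hw
  rw [pair_comm, pair_Aop, pair_comm]
  exact hφ _ (Vsp_all r D0 lam hl a b h w hw)

theorem WV_low (κ : Fin n → ℤ) (u : Finset (Sg n L) → ℚ) (hu : u ∈ WV r D0 (vv L D0 lam) κ)
    (hk : ∀ a b, Rr r a b → Aop ℚ L b a u = 0) : ∃ c : ℚ, u = c • vv L D0 lam := by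
  set v := vv L D0 lam with hv
  have hvv : pair v v = 1 := by
    simp [pair, hv, vv, Pi.single_apply]
  set u' := u + (-(pair v u)) • v with hu'
  have hk' : ∀ a b, Rr r a b → Aop ℚ L b a u' = 0 := by
    intro a b hab
    rw [hu', map_add, map_smul, hk a b hab, vv_kill D0 lam b a hab.1.ne' (hl a b hab)]; simp
  have h1 : u' ∈ Nn r v := by
    intro w hw
    induction hw using Submodule.span_induction with
    | mem x hx =>
      have hx : Gen r v x := hx
      cases hx with
      | base =>
        rw [pair_comm, hu', pair_add, pair_smul, hvv]; simp
      | step a b w hab hw => rw [pair_Aop, hk' a b hab, pair_zero_left]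
    | zero => exact pair_zero _
    | add x y _ _ hx hy => rw [pair_add, hx, hy, add_zero]
    | smul c x _ hx => rw [pair_smul, hx, smul_zero]
  have h2 : pair u' u' = 0 := by
    conv_lhs => rw [hu']
    rw [← hu', pair_add, pair_smul, hu.1 _ h1, h1 v (Submodule.subset_span Gen.base)]; simp
  have h3 := pair_self _ h2
  refine ⟨pair v u, ?_⟩
  rw [hu', neg_smul, ← sub_eq_add_neg] at h3
  exact sub_eq_zero.1 h3

theorem vv_mem (h : ∀ a, 0 ≤ lam a + D0 ∧ lam a + D0 ≤ L) :
    vv L D0 lam ∈ WV r D0 (vv L D0 lam) (-lam) :=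
  ⟨fun φ hφ => hφ _ (Submodule.subset_span Gen.base), vv_supp D0 lam h⟩

/-- the basic datum of the irreducible module -/
def VD : Dat r n (Finset (Sg n L) → ℚ) where
  x a b := Aop ℚ L b a
  W := WV r D0 (vv L D0 lam)
  comm a b c d _ _ := by
    rw [Aop_comm]
    congr 1
    simp only [eq_comm]
  map a b h κ w hw := by
    have := WV_map r D0 lam hl b a h.2.symm κ w hw
    convert this using 2
    unfold al; abel
  fin κ := inferInstance
  bd := by
    refine ⟨2 * L + |D0|, fun κ a h => ?_⟩
    rw [Submodule.eq_bot_iff]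
    rintro u ⟨-, h2⟩
    ext S
    by_contra h3
    have h4 := congrFun (h2 S h3) a
    unfold wS at h4
    have h5 : 0 ≤ ∑ c : Fin L, (if toLex (a, c) ∈ S then (1:ℤ) else 0) :=
      Finset.sum_nonneg fun c _ => by split_ifs <;> simp
    have h6 : ∑ c : Fin L, (if toLex (a, c) ∈ S then (1:ℤ) else 0) ≤ L := by
      refine (Finset.sum_le_sum (g := fun _ => (1:ℤ)) fun c _ => by split_ifs <;> simp).trans ?_
      simp
    have h7 := le_abs_self D0
    have h8 := neg_abs_le D0
    have : |κ a| ≤ 2 * L + |D0| := by rw [← h4, abs_le]; constructor <;> linarith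
    linarith
end
end
end KS

namespace KS
set_option linter.unusedSectionVars false
set_option linter.unusedSimpArgs false
section
open MvPolynomial
variable {n L : ℕ}

abbrev Pl (n : ℕ) := MvPolynomial (Fin n × Fin n) ℚ

noncomputable def gv (Q : Finset (Fin n × Fin n)) (a b : Fin n) (i : Fin n × Fin n) : Pl n :=
  if i ∈ Q then (if i.1 = b ∧ (a, i.2) ∈ Q then X (a, i.2) else 0) -
    (if i.2 = a ∧ (i.1, b) ∈ Q then X (i.1, b) else 0) else 0

noncomputable def Dp (Q : Finset (Fin n × Fin n)) (a b : Fin n) : Derivation ℚ (Pl n) (Pl n) :=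
  mkDerivation ℚ (gv Q a b)

def Stab (Q : Finset (Fin n × Fin n)) (a b : Fin n) : Prop :=
  (∀ m, (a, m) ∈ Q → (b, m) ∈ Q) ∧ (∀ m, (m, b) ∈ Q → (m, a) ∈ Q)

theorem Dp_X (Q : Finset (Fin n × Fin n)) (a b : Fin n) (i : Fin n × Fin n) :
    Dp Q a b (X i) = gv Q a b i := mkDerivation_X _ _ _

theorem Dp_gv (Q : Finset (Fin n × Fin n)) (a b c d : Fin n) (i : Fin n × Fin n) :
    Dp Q a b (gv Q c d i) = if i ∈ Q then (if i.1 = d ∧ (c, i.2) ∈ Q then gv Q a b (c, i.2) else 0) -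
    (if i.2 = c ∧ (i.1, d) ∈ Q then gv Q a b (i.1, d) else 0) else 0 := by
  conv_lhs => rw [gv]
  split_ifs <;> simp [Dp_X]

theorem Dp_aux (Q : Finset (Fin n × Fin n)) (a b c d m k : Fin n) (h1 : Stab Q a b) (h2 : Stab Q c d)
    (hQ : (m, k) ∈ Q) : Dp Q a b (gv Q c d (m, k)) =
    (if b = c then (if m = d ∧ (a, k) ∈ Q then X (a, k) else 0) else 0)
    - (if m = d ∧ k = a ∧ (c, b) ∈ Q then X (c, b) else 0)
    - (if k = c ∧ m = b ∧ (a, d) ∈ Q then X (a, d) else 0)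
    + (if d = a then (if k = c ∧ (m, b) ∈ Q then X (m, b) else 0) else 0) := by
  rw [Dp_gv]
  obtain ⟨s1, s2⟩ := h1
  obtain ⟨s3, s4⟩ := h2
  simp only [hQ, if_true]
  have e1 : (if m = d ∧ (c, k) ∈ Q then gv Q a b (c, k) else 0) =
    (if b = c then (if m = d ∧ (a, k) ∈ Q then X (a, k) else 0) else 0)
    - (if m = d ∧ k = a ∧ (c, b) ∈ Q then X (c, b) else 0) := by
    have f1 := s1 k
    have f5 := s2 c
    unfold gv
    dsimp only
    by_cases g1 : m = d
    · by_cases g2 : (c, k) ∈ Q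
      · simp only [g1, g2, true_and, if_true]
        congr 1
        by_cases g3 : b = c
        · simp [g3]
        · simp [g3, Ne.symm g3]
      · have z1 : ¬ (b = c ∧ (a, k) ∈ Q) := by rintro ⟨rfl, h⟩; exact g2 (f1 h)
        have z2 : ¬ (k = a ∧ (c, b) ∈ Q) := by rintro ⟨rfl, h⟩; exact g2 (f5 h)
        simp only [g1, g2, true_and, and_false, if_false, z2, ← ite_and, z1, sub_zero]
        try simp
    · simp [g1]
  have e2 : (if k = c ∧ (m, d) ∈ Q then gv Q a b (m, d) else 0) =
    (if k = c ∧ m = b ∧ (a, d) ∈ Q then X (a, d) else 0)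
    - (if d = a then (if k = c ∧ (m, b) ∈ Q then X (m, b) else 0) else 0) := by
    have f1 := s1 d
    have f5 := s2 m
    unfold gv
    dsimp only
    by_cases g1 : k = c
    · by_cases g2 : (m, d) ∈ Q
      · simp only [g1, g2, true_and, if_true]
        congr 1
        by_cases g3 : d = a
        · simp [g3]
        · simp [g3]
      · have z1 : ¬ (d = a ∧ (m, b) ∈ Q) := by rintro ⟨rfl, h⟩; exact g2 (f5 h)
        have z2 : ¬ (m = b ∧ (a, d) ∈ Q) := by rintro ⟨rfl, h⟩; exact g2 (f1 h)
        simp only [g1, g2, true_and, and_false, if_false, z2, ← ite_and, z1, sub_zero]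
    · simp [g1]
  rw [e1, e2]; abel

theorem Dp_comm (Q : Finset (Fin n × Fin n)) (a b c d : Fin n) (h1 : Stab Q a b) (h2 : Stab Q c d) :
    ⁅Dp Q a b, Dp Q c d⁆ = (if b = c then Dp Q a d else 0) - (if d = a then Dp Q c b else 0) := by
  apply MvPolynomial.derivation_ext
  rintro ⟨m, k⟩
  have e1 : ((if b = c then Dp Q a d else 0) - (if d = a then Dp Q c b else 0)) (X (m, k)) =
      (if b = c then gv Q a d (m, k) else 0) - (if d = a then gv Q c b (m, k) else 0) := by
    rw [Derivation.sub_apply]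
    congr 1 <;> split_ifs <;> simp [Dp_X]
  rw [e1, Derivation.commutator_apply, Dp_X, Dp_X]
  by_cases hQ : (m, k) ∈ Q
  swap
  · simp [gv, hQ]
  rw [Dp_aux Q a b c d m k h1 h2 hQ, Dp_aux Q c d a b m k h2 h1 hQ]
  unfold gv
  simp only [hQ, if_true]
  have e2 : (if m = b ∧ k = c ∧ (a, d) ∈ Q then X (a, d) else 0 : Pl n) =
    (if k = c ∧ m = b ∧ (a, d) ∈ Q then X (a, d) else 0) := by congr 1; simp only [and_left_comm]
  have e3 : (if m = d ∧ k = a ∧ (c, b) ∈ Q then X (c, b) else 0 : Pl n) =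
    (if k = a ∧ m = d ∧ (c, b) ∈ Q then X (c, b) else 0) := by congr 1; simp only [and_left_comm]
  rw [e2, e3]
  by_cases g1 : b = c <;> by_cases g2 : d = a <;> simp only [g1, g2, if_true, if_false] <;> abel

end
end KS

namespace KS
set_option linter.unusedSectionVars false
set_option linter.unusedSimpArgs false
section
open MvPolynomial
variable {n L : ℕ}

abbrev Mo (n : ℕ) := (Fin n × Fin n) →₀ ℕ
abbrev YQ (n L : ℕ) := Finset (Sg n L) → Pl n

def wm (m : Mo n) : Fin n → ℤ := ∑ i : Fin n × Fin n, (m i : ℤ) • al i.1 i.2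
def sz (m : Mo n) : ℤ := ∑ i : Fin n × Fin n, (m i : ℤ)

theorem wm_add (m m' : Mo n) : wm (m + m') = wm m + wm m' := by
  simp [wm, add_smul, Finset.sum_add_distrib]
theorem wm_single (i : Fin n × Fin n) : wm (Finsupp.single i 1) = al i.1 i.2 := by
  unfold wm
  rw [Finset.sum_eq_single i]
  · simp
  · intro j _ hj; simp [Finsupp.single_apply, Ne.symm hj]
  · simp
theorem sz_add (m m' : Mo n) : sz (m + m') = sz m + sz m' := by
  simp [sz, Finset.sum_add_distrib]
theorem sz_single (i : Fin n × Fin n) : sz (Finsupp.single i 1) = 1 := by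
  unfold sz
  rw [Finset.sum_eq_single i]
  · simp
  · intro j _ hj; simp [Finsupp.single_apply, Ne.symm hj]
  · simp

theorem abs_wm (m : Mo n) (a : Fin n) : |wm m a| ≤ sz m := by
  unfold wm sz
  rw [Finset.sum_apply]
  refine (Finset.abs_sum_le_sum_abs _ _).trans (Finset.sum_le_sum fun i _ => ?_)
  rw [Pi.smul_apply, smul_eq_mul, abs_mul, Nat.abs_cast]
  have : |al i.1 i.2 a| ≤ 1 := by
    simp only [al, Pi.sub_apply, Pi.single_apply]; split_ifs <;> simp
  have h0 : (0:ℤ) ≤ m i := by positivity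
  nlinarith

def MonP (Q : Finset (Fin n × Fin n)) (k : ℤ) (m : Mo n) : Prop := m.support ⊆ Q ∧ sz m = k

noncomputable def cfm (m : Mo n) : YQ n L →ₗ[ℚ] (Finset (Sg n L) → ℚ) where
  toFun y S := coeff m (y S)
  map_add' _ _ := by ext; simp
  map_smul' _ _ := by ext; simp

theorem cfm_apply (m : Mo n) (y : YQ n L) (S) : cfm m y S = coeff m (y S) := rfl

noncomputable def tens (u : Finset (Sg n L) → ℚ) (p : Pl n) : YQ n L := fun S => u S • p

theorem cfm_tens (m : Mo n) (u : Finset (Sg n L) → ℚ) (p : Pl n) :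
    cfm m (tens u p) = coeff m p • u := by
  ext S; simp [cfm_apply, tens, mul_comm]

theorem cfm_Aop (m : Mo n) (a b : Fin n) (y : YQ n L) :
    cfm m (Aop (Pl n) L a b y) = Aop ℚ L a b (cfm m y) := by
  unfold Aop
  rw [LinearMap.sum_apply, LinearMap.sum_apply, map_sum]
  refine Finset.sum_congr rfl fun c _ => ?_
  ext S
  simp only [Module.End.mul_apply, cfm_apply, cre_apply, ann_apply]
  split_ifs <;> simp [cfm_apply]

theorem YQ_ext {y y' : YQ n L} (h : ∀ m, cfm m y = cfm m y') : y = y' := by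
  ext S m
  exact congrFun (h m) S

theorem YQ_sum (y : YQ n L) : ∃ F : Finset (Mo n), (∀ m ∈ F, cfm m y ≠ 0) ∧
    y = ∑ m ∈ F, tens (cfm m y) (monomial m 1) := by
  classical
  refine ⟨Finset.univ.biUnion fun S => (y S).support, ?_, ?_⟩
  · intro m hm h
    simp only [Finset.mem_biUnion, Finset.mem_univ, true_and, mem_support_iff] at hm
    obtain ⟨S, hS⟩ := hm
    exact hS (congrFun h S)
  · apply YQ_ext
    intro m
    rw [map_sum]
    simp only [cfm_tens, coeff_monomial, ite_smul, one_smul, zero_smul]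
    rw [Finset.sum_ite_eq' (s := Finset.univ.biUnion fun S => (y S).support)]
    split_ifs with h
    · rfl
    · ext S
      simp only [Finset.mem_biUnion, Finset.mem_univ, true_and, mem_support_iff] at h
      push Not at h
      exact h S

theorem gv_coeff (Q : Finset (Fin n × Fin n)) (a b : Fin n) (i : Fin n × Fin n) (s m : Mo n) (c : ℚ)
    (h : coeff m (monomial s c * gv Q a b i) ≠ 0) :
    i ∈ Q ∧ ∃ j ∈ Q, m = s + Finsupp.single j 1 ∧ al j.1 j.2 = al i.1 i.2 + al a b := by
  unfold gv at h
  by_cases hi : i ∈ Q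
  swap
  · simp [hi] at h
  refine ⟨hi, ?_⟩
  rw [if_pos hi, mul_sub, coeff_sub] at h
  by_cases h1 : coeff m (monomial s c * (if i.1 = b ∧ (a, i.2) ∈ Q then X (a, i.2) else 0)) = 0
  · rw [h1, zero_sub, neg_ne_zero] at h
    split_ifs at h with h2
    · refine ⟨(i.1, b), h2.2, ?_, ?_⟩
      · rw [X, monomial_mul, coeff_monomial] at h
        by_contra h3
        exact h (if_neg (Ne.symm h3))
      · rw [← h2.1]; unfold al; abel
    · simp at h
  · split_ifs at h1 with h2
    · refine ⟨(a, i.2), h2.2, ?_, ?_⟩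
      · rw [X, monomial_mul, coeff_monomial] at h1
        by_contra h3
        exact h1 (if_neg (Ne.symm h3))
      · rw [← h2.1]; unfold al; abel
    · simp at h1

theorem Dp_monomial (Q : Finset (Fin n × Fin n)) (a b : Fin n) (s : Mo n) :
    Dp Q a b (monomial s 1) = ∑ i ∈ s.support, monomial (s - Finsupp.single i 1) (s i : ℚ) * gv Q a b i := by
  unfold Dp
  rw [mkDerivation_monomial, one_smul]
  rfl

theorem Dp_coeff (Q : Finset (Fin n × Fin n)) (k : ℤ) (a b : Fin n) (s m : Mo n) (hs : MonP Q k s)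
    (h : coeff m (Dp Q a b (monomial s 1)) ≠ 0) : MonP Q k m ∧ wm m = wm s + al a b := by
  classical
  rw [Dp_monomial, coeff_sum] at h
  obtain ⟨i, hi, h1⟩ := Finset.exists_ne_zero_of_sum_ne_zero h
  obtain ⟨hiQ, j, hj, rfl, h2⟩ := gv_coeff _ _ _ _ _ _ _ h1
  have h3 : s = (s - Finsupp.single i 1) + Finsupp.single i 1 := by
    rw [tsub_add_cancel_of_le]
    rw [Finsupp.single_le_iff]
    have := Finsupp.mem_support_iff.1 hi
    omega
  have hw := wm_add (s - Finsupp.single i 1) (Finsupp.single i 1)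
  have hz := sz_add (s - Finsupp.single i 1) (Finsupp.single i 1)
  rw [← h3, wm_single] at hw
  rw [← h3, sz_single, hs.2] at hz
  refine ⟨⟨?_, ?_⟩, ?_⟩
  · refine Finsupp.support_add.trans (Finset.union_subset ?_ ?_)
    · refine subset_trans ?_ hs.1
      intro x hx
      rw [Finsupp.mem_support_iff] at hx ⊢
      rw [Finsupp.tsub_apply] at hx
      omega
    · refine Finsupp.support_single_subset.trans ?_
      simpa using hj
  · rw [sz_add, sz_single, hz]
  · rw [wm_add, wm_single, h2, hw]; abel

theorem Dp_euler (Q : Finset (Fin n × Fin n)) (a : Fin n) (s : Mo n) (hs : s.support ⊆ Q) :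
    Dp Q a a (monomial s 1) = ((wm s a : ℤ) : ℚ) • monomial s 1 := by
  rw [Dp_monomial]
  have h1 : ∀ i ∈ s.support, monomial (s - Finsupp.single i 1) (s i : ℚ) * gv Q a a i =
      (((s i : ℤ) * al i.1 i.2 a : ℤ) : ℚ) • monomial s 1 := by
    intro i hi
    have hQ := hs hi
    have h3 : (s - Finsupp.single i 1) + Finsupp.single i 1 = s := by
      rw [tsub_add_cancel_of_le]
      rw [Finsupp.single_le_iff]
      have := Finsupp.mem_support_iff.1 hi
      omega
    have h4 : gv Q a a i = (al i.1 i.2 a : ℚ) • X i := by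
      obtain ⟨p, q⟩ := i
      unfold gv al
      simp only [hQ, if_true, Pi.sub_apply, Pi.single_apply]
      by_cases e1 : p = a <;> by_cases e2 : q = a
      · subst e1; subst e2; simp
      · subst e1; simp [hQ, e2, Ne.symm e2]
      · subst e2; simp [hQ, e1, Ne.symm e1]
      · simp [e1, e2, Ne.symm e1, Ne.symm e2]
    rw [h4, mul_smul_comm, X, monomial_mul, h3]
    simp only [smul_monomial, smul_eq_mul]
    push_cast
    congr 1
    ring
  rw [Finset.sum_congr rfl h1, ← Finset.sum_smul]
  congr 1
  unfold wm
  rw [Finset.sum_apply, ← Int.cast_sum]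
  congr 1
  simp only [Pi.smul_apply, smul_eq_mul]
  apply Finset.sum_subset (Finset.subset_univ _)
  intro i _ hi
  rw [Finsupp.notMem_support_iff.1 hi]; simp

end
end KS

namespace KS
set_option linter.unusedSectionVars false
set_option linter.unusedSimpArgs false
section
open MvPolynomial
variable {n L : ℕ}

theorem ring_comm {A : Type*} [Ring A] {x y x' y' : A} (h1 : y * x' = x' * y) (h2 : y' * x = x * y') :
    (x + y) * (x' + y') - (x' + y') * (x + y) = (x * x' - x' * x) + (y * y' - y' * y) := by
  have : (x + y) * (x' + y') - (x' + y') * (x + y) = (x * x' - x' * x) + (y * y' - y' * y)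
    + (y * x' - x' * y) - (y' * x - x * y') := by noncomm_ring
  rw [this, h1, h2]; simp

noncomputable def Eop (L : ℕ) (Q : Finset (Fin n × Fin n)) (a b : Fin n) : Module.End ℚ (YQ n L) :=
  Aop (Pl n) L a b + pw (Dp Q a b).toLinearMap

theorem Eop_comm (Q : Finset (Fin n × Fin n)) (a b c d : Fin n) (h1 : Stab Q a b) (h2 : Stab Q c d) :
    Eop L Q a b * Eop L Q c d - Eop L Q c d * Eop L Q a b =
      (if b = c then Eop L Q a d else 0) - (if d = a then Eop L Q c b else 0) := by
  unfold Eop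
  refine (ring_comm (pw_Aop _ _ _) (pw_Aop _ _ _)).trans ?_
  have h3 := Aop_comm (Z := Pl n) (L := L) a b c d
  have h4 : (pw (Dp Q a b).toLinearMap * pw (Dp Q c d).toLinearMap
      - pw (Dp Q c d).toLinearMap * pw (Dp Q a b).toLinearMap : Module.End ℚ (YQ n L)) =
      (if b = c then pw (Dp Q a d).toLinearMap else 0) - (if d = a then pw (Dp Q c b).toLinearMap else 0) := by
    refine LinearMap.ext fun y => funext fun S => ?_
    have h5 := congrArg (fun D => D (y S)) (Dp_comm Q a b c d h1 h2)
    simp only [Derivation.commutator_apply, Derivation.sub_apply] at h5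
    refine h5.trans ?_
    rw [LinearMap.sub_apply, Pi.sub_apply]
    congr 1
    · split_ifs <;> rfl
    · split_ifs <;> rfl
  rw [h4]
  refine (congrArg (· + _) h3).trans ?_
  split_ifs <;> abel

noncomputable def WQ (r : ℕ) (D0 : ℤ) (v : Finset (Sg n L) → ℚ) (Q : Finset (Fin n × Fin n)) (k : ℤ)
    (κ : Fin n → ℤ) : Submodule ℚ (YQ n L) where
  carrier := {y | ∀ m, cfm m y ∈ WV r D0 v (κ - wm m) ∧ (cfm m y ≠ 0 → MonP Q k m)}
  add_mem' := by
    intro c c' h h' m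
    rw [map_add]
    refine ⟨Submodule.add_mem _ (h m).1 (h' m).1, fun h0 => ?_⟩
    by_cases h1 : cfm m c = 0
    · apply (h' m).2; intro h2; apply h0; rw [h1, h2, add_zero]
    · exact (h m).2 h1
  zero_mem' := by
    intro m
    rw [map_zero]
    exact ⟨Submodule.zero_mem _, fun h => absurd rfl h⟩
  smul_mem' := by
    intro a c h m
    rw [map_smul]
    refine ⟨Submodule.smul_mem _ _ (h m).1, fun h0 => (h m).2 ?_⟩
    intro h1; apply h0; rw [h1, smul_zero]

variable (r : ℕ) (D0 : ℤ) 

theorem tens_mem (v : Finset (Sg n L) → ℚ) (Q : Finset (Fin n × Fin n)) (k : ℤ) (κ : Fin n → ℤ)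
    (u : Finset (Sg n L) → ℚ) (p : Pl n)
    (h : ∀ m, coeff m p ≠ 0 → MonP Q k m ∧ u ∈ WV r D0 v (κ - wm m)) :
    tens u p ∈ WQ r D0 v Q k κ := by
  intro m
  rw [cfm_tens]
  by_cases h0 : coeff m p = 0
  · rw [h0, zero_smul]; exact ⟨Submodule.zero_mem _, fun h => absurd rfl h⟩
  · exact ⟨Submodule.smul_mem _ _ (h m h0).2, fun _ => (h m h0).1⟩

theorem pw_tens (z : Module.End ℚ (Pl n)) (u : Finset (Sg n L) → ℚ) (p : Pl n) :
    pw z (tens u p) = tens u (z p) := by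
  ext1 S; simp [tens]

theorem WQ_ind (v : Finset (Sg n L) → ℚ) (Q : Finset (Fin n × Fin n)) (k : ℤ) (κ : Fin n → ℤ)
    (y : YQ n L) (hy : y ∈ WQ r D0 v Q k κ) : ∃ F : Finset (Mo n), (∀ m ∈ F, MonP Q k m ∧
      cfm m y ∈ WV r D0 v (κ - wm m)) ∧ y = ∑ m ∈ F, tens (cfm m y) (monomial m 1) := by
  obtain ⟨F, h1, h2⟩ := YQ_sum y
  exact ⟨F, fun m hm => ⟨(hy m).2 (h1 m hm), (hy m).1⟩, h2⟩

/-- lower-stability -/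
def LSt (r : ℕ) (Q : Finset (Fin n × Fin n)) : Prop := ∀ a b, Rr r a b → Stab Q b a

variable (lam : Fin n → ℤ) (hl : ∀ a b, Rr r a b → lam b ≤ lam a)
include hl

theorem WQ_map (Q : Finset (Fin n × Fin n)) (k : ℤ) (a b : Fin n) (h : a.val % r = b.val % r)
    (κ : Fin n → ℤ) :
    ∀ u ∈ WQ r D0 (vv L D0 lam) Q k κ, Eop L Q a b u ∈ WQ r D0 (vv L D0 lam) Q k (κ + al a b) := by
  intro y hy
  unfold Eop
  rw [LinearMap.add_apply]
  refine Submodule.add_mem _ ?_ ?_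
  · intro m
    rw [cfm_Aop]
    refine ⟨?_, fun h0 => (hy m).2 ?_⟩
    · rw [add_sub_right_comm]; exact WV_map r D0 lam hl a b h _ _ (hy m).1
    · intro h1; apply h0; rw [h1, map_zero]
  · obtain ⟨F, h1, h2⟩ := WQ_ind r D0 _ Q k κ y hy
    rw [h2, map_sum]
    refine Submodule.sum_mem _ fun s hs => ?_
    rw [pw_tens]
    apply tens_mem
    intro m hm
    obtain ⟨h3, h4⟩ := Dp_coeff Q k a b s m (h1 s hs).1 hm
    refine ⟨h3, ?_⟩
    rw [h4, add_sub_add_right_eq_sub]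
    exact (h1 s hs).2

theorem WQ_diag (Q : Finset (Fin n × Fin n)) (k : ℤ) (a : Fin n) (κ : Fin n → ℤ) :
    ∀ y ∈ WQ r D0 (vv L D0 lam) Q k κ, Eop L Q a a y = ((κ a + (L - D0) : ℤ) : ℚ) • y := by
  intro y hy
  obtain ⟨F, h1, h2⟩ := WQ_ind r D0 _ Q k κ y hy
  rw [h2, map_sum, Finset.smul_sum]
  refine Finset.sum_congr rfl fun m hm => ?_
  have h3 := (h1 m hm).2.2
  set u := cfm m y
  unfold Eop
  rw [LinearMap.add_apply, pw_tens]
  have e : (Dp Q a a).toLinearMap (monomial m 1) = _ := Dp_euler Q a m (h1 m hm).1.1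
  rw [e]
  ext1 S
  rw [Pi.add_apply, Aop_diag D0, Pi.smul_apply]
  unfold tens
  by_cases h0 : u S = 0
  · simp [h0]
  · rw [smul_comm (u S), ← add_smul]
    congr 1
    have := congrFun (h3 S h0) a
    rw [this, ← Int.cast_add]
    congr 1
    rw [Pi.sub_apply]; ring

noncomputable def QD (Q : Finset (Fin n × Fin n)) (hQ : LSt r Q) (k : ℤ) : Dat r n (YQ n L) where
  x a b := Eop L Q b a
  W := WQ r D0 (vv L D0 lam) Q k
  comm a b c d h1 h2 := by
    rw [Eop_comm Q _ _ _ _ (hQ a b h1) (hQ c d h2)]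
    congr 1
    simp only [eq_comm]
  map a b h κ w hw := by
    have := WQ_map r D0 lam hl Q k b a h.2.symm κ w hw
    convert this using 2
    unfold al; abel
  fin κ := by
    let g : WQ r D0 (vv L D0 lam) Q k κ →ₗ[ℚ]
        ((m : {m // m ∈ Finset.finsuppAntidiag Q k.toNat}) → (Finset (Sg n L) → ℚ)) :=
      { toFun := fun c m => cfm m.1 c.1
        map_add' := fun _ _ => by ext; simp
        map_smul' := fun _ _ => by ext; simp }
    refine FiniteDimensional.of_injective g ?_
    rw [← LinearMap.ker_eq_bot, LinearMap.ker_eq_bot']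
    intro c h
    apply Subtype.ext
    apply YQ_ext
    intro m
    by_contra h0
    have h1 := (c.2 m).2 (by intro h; apply h0; rw [h]; exact (map_zero _).symm)
    have h2 : m ∈ Finset.finsuppAntidiag Q k.toNat := by
      rw [Finset.mem_finsuppAntidiag]
      refine ⟨?_, h1.1⟩
      have h3 := h1.2
      unfold sz at h3
      rw [← Finset.sum_subset (Finset.subset_univ Q) (fun i _ hi => by
        rw [Finsupp.notMem_support_iff.1 (fun hh => hi (h1.1 hh))]; rfl)] at h3
      rw [← h3, ← Nat.cast_sum]; rfl
    have h4 := congrFun h ⟨m, h2⟩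
    apply h0
    exact h4.trans (map_zero _).symm
  bd := by
    obtain ⟨B, hB⟩ := (VD (L := L) r D0 lam hl).bd
    refine ⟨B + k, fun κ a h => ?_⟩
    rw [Submodule.eq_bot_iff]
    intro y hy
    apply YQ_ext
    intro m
    rw [map_zero]
    by_contra h0
    have h1 := (hy m).2 h0
    have h2 := (hy m).1
    have h3 : WV r D0 (vv L D0 lam) (κ - wm m) = ⊥ := by
      apply hB _ a
      have h4 := abs_wm m a
      rw [h1.2] at h4
      have := abs_sub_abs_le_abs_sub (κ a) (wm m a)
      rw [Pi.sub_apply]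
      linarith
    rw [h3] at h2
    exact h0 (by simpa using h2)

theorem QD_PSt (Q : Finset (Fin n × Fin n)) (hQ : LSt r Q) (k : ℤ) (p q : Fin n) (h : Rr r p q)
    (hs : Stab Q p q) : PSt (QD (L := L) r D0 lam hl Q hQ k) p q := by
  refine ⟨Eop L Q p q, fun κ w hw => WQ_map r D0 lam hl Q k p q h.2 κ w hw, fun κ w hw => ?_⟩
  have h1 := LinearMap.congr_fun (Eop_comm (L := L) Q q p p q (hQ p q h) hs) w
  simp only [if_true, LinearMap.sub_apply, Module.End.mul_apply] at h1
  refine h1.trans ?_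
  rw [WQ_diag r D0 lam hl Q k q κ w hw, WQ_diag r D0 lam hl Q k p κ w hw, ← sub_smul]
  congr 1
  push_cast; ring

theorem VD_PSt (p q : Fin n) (h : Rr r p q) : PSt (VD (L := L) r D0 lam hl) p q := by
  refine ⟨Aop ℚ L p q, fun κ w hw => WV_map r D0 lam hl p q h.2 κ w hw, fun κ w hw => ?_⟩
  have h1 := LinearMap.congr_fun (Aop_comm (Z := ℚ) (L := L) q p p q) w
  simp only [if_true, LinearMap.sub_apply, Module.End.mul_apply] at h1
  refine h1.trans ?_
  have : ∀ a, Aop ℚ L a a w = ((κ a + (L - D0) : ℤ) : ℚ) • w := by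
    intro a
    ext S
    rw [Aop_diag D0, Pi.smul_apply]
    by_cases h0 : w S = 0
    · simp [h0]
    · rw [hw.2 S h0]
  rw [this, this, ← sub_smul]
  congr 1
  push_cast; ring
end
end KS

namespace KS
set_option linter.unusedSectionVars false
set_option linter.unusedSimpArgs false
section
open MvPolynomial
variable {n L : ℕ}

noncomputable def gk (e : Fin n × Fin n) : Pl n →ₐ[ℚ] Pl n :=
  aeval (fun i => if i = e then 0 else X i)

theorem gk_monomial (e : Fin n × Fin n) (m : Mo n) :
    gk e (monomial m 1) = if m e = 0 then monomial m 1 else 0 := by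
  unfold gk
  rw [aeval_monomial, map_one, one_mul]
  split_ifs with h
  · rw [monomial_eq]
    simp only [map_one, one_mul]
    refine Finset.prod_congr rfl fun i hi => ?_
    have : i ≠ e := by rintro rfl; exact (Finsupp.mem_support_iff.1 hi) h
    simp [this]
  · rw [Finsupp.prod]
    apply Finset.prod_eq_zero (Finsupp.mem_support_iff.2 h)
    simp [h]

theorem gv_erase0 {Q : Finset (Fin n × Fin n)} {e : Fin n × Fin n} {a b : Fin n} (hab : a ≠ b)
    (hs : Stab (Q.erase e) a b) : gv Q a b e = 0 := by
  unfold gv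
  have h1 : ¬ (e.1 = b ∧ (a, e.2) ∈ Q) := by
    rintro ⟨h1, h2⟩
    have h3 : (a, e.2) ∈ Q.erase e := by
      rw [Finset.mem_erase]
      refine ⟨?_, h2⟩
      intro h; apply hab; rw [← h1, ← h]
    have := hs.1 _ h3
    rw [← h1] at this
    simp at this
  have h2 : ¬ (e.2 = a ∧ (e.1, b) ∈ Q) := by
    rintro ⟨h1, h2⟩
    have h3 : (e.1, b) ∈ Q.erase e := by
      rw [Finset.mem_erase]
      refine ⟨?_, h2⟩
      intro h; apply hab; rw [← h1, ← h]
    have := hs.2 _ h3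
    rw [← h1] at this
    simp at this
  simp [h1, h2]

theorem gk_gv (Q : Finset (Fin n × Fin n)) (e i : Fin n × Fin n) (a b : Fin n) (hi : i ≠ e) :
    gk e (gv Q a b i) = gv (Q.erase e) a b i := by
  have hX : ∀ j, gk e (X j) = if j = e then 0 else X j := fun j => by unfold gk; simp
  unfold gv
  simp only [Finset.mem_erase, hi, ne_eq, not_false_eq_true, true_and]
  by_cases h : i ∈ Q
  · simp only [h, if_true, map_sub]
    congr 1
    · by_cases h1 : i.1 = b ∧ (a, i.2) ∈ Q
      · rw [if_pos h1, hX]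
        by_cases h2 : (a, i.2) = e <;> simp [h1, h2]
      · rw [if_neg h1, map_zero, if_neg]
        tauto
    · by_cases h1 : i.2 = a ∧ (i.1, b) ∈ Q
      · rw [if_pos h1, hX]
        by_cases h2 : (i.1, b) = e <;> simp [h1, h2]
      · rw [if_neg h1, map_zero, if_neg]
        tauto
  · simp [h]

theorem gk_Dp {Q : Finset (Fin n × Fin n)} {e : Fin n × Fin n} {a b : Fin n} (hab : a ≠ b)
    (hs : Stab (Q.erase e) a b) (p : Pl n) : Dp (Q.erase e) a b (gk e p) = gk e (Dp Q a b p) := by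
  have hX : ∀ j, gk e (X j) = if j = e then 0 else X j := fun j => by unfold gk; simp
  induction p using MvPolynomial.induction_on with
  | C c =>
    have : gk e (C c) = C c := by unfold gk; simp
    rw [this]
    rw [MvPolynomial.derivation_C, MvPolynomial.derivation_C, map_zero]
  | add p q hp hq => simp only [map_add, hp, hq]
  | mul_X p i hp =>
    rw [map_mul, Derivation.leibniz, Derivation.leibniz, hp, hX, map_add]
    simp only [smul_eq_mul, map_mul, hX, Dp_X]
    congr 1
    by_cases h : i = e
    · subst h; rw [gv_erase0 hab hs]; simp
    · rw [gk_gv _ _ _ _ _ h]; simp [h, Dp_X]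

theorem Eop_pw (Q Q' : Finset (Fin n × Fin n)) (a b : Fin n) (g : Pl n →ₗ[ℚ] Pl n)
    (h : ∀ p, Dp Q' b a (g p) = g (Dp Q b a p)) (w : YQ n L) :
    Eop L Q' b a (pw g w) = pw g (Eop L Q b a w) := by
  have h1 : Aop (Pl n) L b a (pw g w) = pw g (Aop (Pl n) L b a w) :=
    (LinearMap.congr_fun (pw_Aop (L := L) g b a) w).symm
  have h2 : pw (Dp Q' b a).toLinearMap (pw g w) = pw g (pw (Dp Q b a).toLinearMap w) := by
    funext S
    simp only [pw_apply]
    exact h (w S)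
  unfold Eop
  rw [LinearMap.add_apply, LinearMap.add_apply, h1, h2]
  exact (map_add _ _ _).symm

theorem Eop_gk {Q : Finset (Fin n × Fin n)} {e : Fin n × Fin n} {a b : Fin n} (hab : b ≠ a)
    (hs : Stab (Q.erase e) b a) (w : YQ n L) :
    Eop L (Q.erase e) b a (pw (gk e).toLinearMap w) = pw (gk e).toLinearMap (Eop L Q b a w) := by
  refine Eop_pw Q (Q.erase e) a b (gk e).toLinearMap (fun p => ?_) w
  rw [AlgHom.toLinearMap_apply, AlgHom.toLinearMap_apply]
  exact gk_Dp hab hs p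

theorem Eop_mX {Q : Finset (Fin n × Fin n)} {e : Fin n × Fin n} {a b : Fin n} (hab : b ≠ a)
    (hs : Stab (Q.erase e) b a) (w : YQ n L) :
    Eop L Q b a (pw (LinearMap.mulLeft ℚ (X e)) w) = pw (LinearMap.mulLeft ℚ (X e)) (Eop L Q b a w) := by
  refine Eop_pw Q Q a b (LinearMap.mulLeft ℚ (X e)) (fun p => ?_) w
  rw [LinearMap.mulLeft_apply, LinearMap.mulLeft_apply]
  rw [Derivation.leibniz, Dp_X, gv_erase0 hab hs]; simp

theorem gk_cf (e : Fin n × Fin n) (m : Mo n) (y : YQ n L) : cfm m (pw (gk e).toLinearMap y) =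
    if m e = 0 then cfm m y else 0 := by
  obtain ⟨F, -, hF⟩ := YQ_sum y
  have h1 : cfm m y = ∑ s ∈ F, coeff m (monomial s 1 : Pl n) • cfm s y := by
    conv_lhs => rw [hF]
    simp only [map_sum, cfm_tens]
  rw [h1]
  conv_lhs => rw [hF]
  simp only [map_sum, pw_tens, cfm_tens]
  rw [← Finset.sum_filter_add_sum_filter_not F (fun s => s = m)]
  have h2 : ∑ s ∈ F with ¬ s = m, coeff m ((gk e).toLinearMap (monomial s 1)) • cfm s y = 0 := by
    refine Finset.sum_eq_zero fun s hs => ?_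
    have hs := (Finset.mem_filter.1 hs).2
    have : (gk e).toLinearMap (monomial s 1) = _ := gk_monomial e s
    rw [this]
    split_ifs <;> simp [coeff_monomial, hs]
  rw [h2, add_zero]
  split_ifs with h
  · rw [← Finset.sum_filter_add_sum_filter_not F (fun s => s = m)
      (fun s => coeff m (monomial s 1 : Pl n) • cfm s y)]
    have h3 : ∑ s ∈ F with ¬ s = m, coeff m (monomial s 1 : Pl n) • cfm s y = 0 := by
      refine Finset.sum_eq_zero fun s hs => ?_
      have hs := (Finset.mem_filter.1 hs).2
      simp [coeff_monomial, hs]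
    rw [h3, add_zero]
    refine Finset.sum_congr rfl fun s hs => ?_
    have hs := (Finset.mem_filter.1 hs).2
    have : (gk e).toLinearMap (monomial s 1) = _ := gk_monomial e s
    rw [this, hs, if_pos h]
  · refine Finset.sum_eq_zero fun s hs => ?_
    have hs := (Finset.mem_filter.1 hs).2
    have : (gk e).toLinearMap (monomial s 1) = _ := gk_monomial e s
    rw [this, hs, if_neg h]; simp

theorem gk_X (e : Fin n × Fin n) (p : Pl n) : gk e (X e * p) = 0 := by
  rw [map_mul]
  have : gk e (X e) = 0 := by unfold gk; simp
  rw [this, zero_mul]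

theorem gk_pw (e : Fin n × Fin n) (w : YQ n L) :
    pw (gk e).toLinearMap (pw (LinearMap.mulLeft ℚ (X e)) w) = 0 := by
  funext S
  simp only [pw_apply]
  exact gk_X e (w S)

variable (r : ℕ) (D0 : ℤ) (lam : Fin n → ℤ) (hl : ∀ a b, Rr r a b → lam b ≤ lam a)
include hl

set_option maxHeartbeats 1000000 in
theorem QD_T1 (Q : Finset (Fin n × Fin n)) (hQ : LSt r Q) (e : Fin n × Fin n) (he : e ∈ Q)
    (hQ' : LSt r (Q.erase e)) (k : ℤ) (ν : Fin n → ℤ) (i : ℤ)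
    (v1 : (QD (L := L) r D0 lam hl Q hQ k).Van ν i)
    (v2 : (QD (L := L) r D0 lam hl Q hQ (k - 1)).Van (ν + al e.1 e.2) (i + 1)) :
    (QD (L := L) r D0 lam hl (Q.erase e) hQ' k).Van ν i := by
  have hmul : ∀ s : Mo n, (X e * monomial s 1 : Pl n) = monomial (s + Finsupp.single e 1) 1 := by
    intro s; rw [X, monomial_mul, add_comm, mul_one]
  have hgc := fun m (y : YQ n L) => gk_cf e m y
  refine T1 (D := QD (L := L) r D0 lam hl Q hQ k) (D' := QD (L := L) r D0 lam hl (Q.erase e) hQ' k)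
    (D'' := QD (L := L) r D0 lam hl Q hQ (k - 1)) (g := pw (gk e).toLinearMap)
    (mX := pw (LinearMap.mulLeft ℚ (X e))) (β := al e.1 e.2) ?_ ?_ ?_ ?_ ?_ ?_ ?_ ?_ ?_ v1 v2
  · intro a b hab w
    show Eop L (Q.erase e) b a (pw (gk e).toLinearMap w) = pw (gk e).toLinearMap (Eop L Q b a w)
    exact Eop_gk hab.1.ne' (hQ' a b hab) w
  · intro a b hab w
    show Eop L Q b a (pw (LinearMap.mulLeft ℚ (X e)) w) = pw (LinearMap.mulLeft ℚ (X e)) (Eop L Q b a w)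
    exact Eop_mX hab.1.ne' (hQ' a b hab) w
  · intro w hw
    ext1 S
    have : X e * w S = 0 := congrFun hw S
    exact (mul_eq_zero.1 this).resolve_left (X_ne_zero e)
  · intro κ y hy m
    exact ⟨(hy m).1, fun h => ⟨((hy m).2 h).1.trans (Finset.erase_subset _ _), ((hy m).2 h).2⟩⟩
  · intro κ y hy
    apply YQ_ext
    intro m
    rw [hgc]
    split_ifs with h
    · rfl
    · by_contra h0
      have h1 := ((hy m).2 (Ne.symm h0)).1 (Finsupp.mem_support_iff.2 h)
      simp at h1
  · intro κ y hy m
    rw [hgc]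
    split_ifs with h
    · refine ⟨(hy m).1, fun h0 => ⟨?_, ((hy m).2 h0).2⟩⟩
      intro i hi
      rw [Finset.mem_erase]
      refine ⟨?_, ((hy m).2 h0).1 hi⟩
      rintro rfl
      exact (Finsupp.mem_support_iff.1 hi) h
    · exact ⟨Submodule.zero_mem _, fun h => absurd rfl h⟩
  · intro w
    exact gk_pw e w
  · intro κ y hy
    obtain ⟨F, h1, h2⟩ := WQ_ind r D0 _ Q (k - 1) κ y hy
    show _ ∈ WQ r D0 (vv L D0 lam) Q k _
    rw [h2, map_sum]
    refine Submodule.sum_mem _ fun s hs => ?_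
    rw [pw_tens]
    apply tens_mem
    intro m hm
    rw [LinearMap.mulLeft_apply, hmul, coeff_monomial] at hm
    have hm : s + Finsupp.single e 1 = m := by
      by_contra h; exact hm (if_neg h)
    subst hm
    rw [wm_add, wm_single, add_sub_add_right_eq_sub]
    refine ⟨⟨?_, ?_⟩, (h1 s hs).2⟩
    · classical
      refine Finsupp.support_add.trans (Finset.union_subset (h1 s hs).1.1 ?_)
      refine Finsupp.support_single_subset.trans ?_
      simpa using he
    · rw [sz_add, sz_single, (h1 s hs).1.2]; ring
  · intro κ y hy hg
    obtain ⟨F, h1, h2⟩ := WQ_ind r D0 _ Q k κ y hy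
    have h3 : ∀ m, m e = 0 → cfm m y = 0 := by
      intro m hm
      have := hgc m y
      rw [hg, map_zero, if_pos hm] at this
      exact this.symm
    have h5 : ∀ s : Mo n, s e ≠ 0 → (s - Finsupp.single e 1) + Finsupp.single e 1 = s := by
      intro s hs
      rw [tsub_add_cancel_of_le]
      rw [Finsupp.single_le_iff]; omega
    refine ⟨∑ m ∈ F, tens (cfm m y) (monomial (m - Finsupp.single e 1) 1), ?_, ?_⟩
    · show _ ∈ WQ r D0 (vv L D0 lam) Q (k - 1) _
      refine Submodule.sum_mem _ fun s hs => ?_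
      by_cases h4 : s e = 0
      · rw [h3 s h4]
        have : tens (0 : Finset (Sg n L) → ℚ) (monomial (s - Finsupp.single e 1) 1 : Pl n) = 0 := by
          ext1 S; simp [tens]
        rw [this]; exact Submodule.zero_mem _
      · apply tens_mem
        intro m hm
        rw [coeff_monomial] at hm
        have hm : s - Finsupp.single e 1 = m := by
          by_contra h; exact hm (if_neg h)
        subst hm
        have hw := wm_add (s - Finsupp.single e 1) (Finsupp.single e 1)
        have hz := sz_add (s - Finsupp.single e 1) (Finsupp.single e 1)
        rw [h5 s h4, wm_single] at hw
        rw [h5 s h4, sz_single, (h1 s hs).1.2] at hz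
        refine ⟨⟨?_, by linarith⟩, ?_⟩
        · refine subset_trans ?_ (h1 s hs).1.1
          intro x hx
          rw [Finsupp.mem_support_iff] at hx ⊢
          rw [Finsupp.tsub_apply] at hx
          omega
        · have := (h1 s hs).2
          rw [hw] at this
          rwa [show κ - al e.1 e.2 - wm (s - Finsupp.single e 1) =
            κ - (wm (s - Finsupp.single e 1) + al e.1 e.2) by abel]
    · rw [map_sum]
      conv_rhs => rw [h2]
      refine Finset.sum_congr rfl fun s hs => ?_
      rw [pw_tens, LinearMap.mulLeft_apply, hmul]
      by_cases h4 : s e = 0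
      · rw [h3 s h4]; ext1 S; simp [tens]
      · rw [h5 s h4]
end
end KS

namespace KS
set_option linter.unusedSectionVars false
set_option linter.unusedSimpArgs false
section
variable {r n : ℕ}

def th (r : ℕ) (ν : Fin n → ℤ) (a : Fin n) : ℤ := ν a - ((a.val / r : ℕ) : ℤ)

def Inv (r : ℕ) (θ : Fin n → ℤ) : Finset (Fin n × Fin n) :=
  Finset.univ.filter fun x => Rr r x.1 x.2 ∧ θ x.1 < θ x.2

def RR (r n : ℕ) : Finset (Fin n × Fin n) := Finset.univ.filter fun x => Rr r x.1 x.2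

theorem th_adj (hr : 1 ≤ r) {p q : Fin n} (h : q.val = p.val + r) (ν : Fin n → ℤ) :
    th r ν p - th r ν q = ν p - ν q + 1 := by
  unfold th
  rw [h, Nat.add_div_right _ hr]; push_cast; ring

theorem al_self {p q : Fin n} (h : p ≠ q) : al p q p = 1 ∧ al p q q = -1 := by
  unfold al; simp [h, h.symm]

theorem al_other {p q a : Fin n} (h : a ≠ p) (h' : a ≠ q) : al p q a = 0 := by
  unfold al; simp [h, h']

theorem adj_ne (hr : 1 ≤ r) {p q : Fin n} (h : q.val = p.val + r) : p ≠ q := by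
  rintro rfl; omega

theorem th_swap (hr : 1 ≤ r) {p q : Fin n} (h : q.val = p.val + r) (ν : Fin n → ℤ) (a : Fin n) :
    th r (ν - (ν p - ν q + 1) • al p q) a = th r ν (Equiv.swap p q a) := by
  have h0 := th_adj hr h ν
  have h1 := adj_ne hr h
  have h2 := al_self h1
  by_cases ha : a = p
  · subst ha
    rw [Equiv.swap_apply_left]
    have : th r (ν - (ν a - ν q + 1) • al a q) a = th r ν a - (ν a - ν q + 1) := by
      unfold th; simp [h2]; ring
    rw [this]; linarith
  by_cases hb : a = q
  · subst hb
    rw [Equiv.swap_apply_right]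
    have : th r (ν - (ν p - ν a + 1) • al p a) a = th r ν a + (ν p - ν a + 1) := by
      unfold th; simp [h2]; ring
    rw [this]; linarith
  · rw [Equiv.swap_apply_of_ne_of_ne ha hb]
    unfold th; simp [al_other ha hb]

theorem swap_R (hr : 1 ≤ r) {p q a b : Fin n} (h : q.val = p.val + r) (hab : Rr r a b)
    (hn : (a, b) ≠ (p, q)) : Rr r (Equiv.swap p q a) (Equiv.swap p q b) ∧
      (Equiv.swap p q a, Equiv.swap p q b) ≠ (p, q) := by
  have A := adjt_of (n := n) hr h
  have hne := adj_ne hr h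
  have hlt : a ≠ b := hab.1.ne
  constructor
  · by_cases h1 : a = p
    · subst h1
      have hb : b ≠ q := by rintro rfl; exact hn rfl
      rw [Equiv.swap_apply_left, Equiv.swap_apply_of_ne_of_ne hlt.symm hb]
      exact ((A.up b).1 hab).resolve_left hb
    by_cases h2 : a = q
    · subst h2
      have hb : b ≠ p := by rintro rfl; exact A.irr _ _ A.pq hab
      rw [Equiv.swap_apply_right, Equiv.swap_apply_of_ne_of_ne hb hlt.symm]
      exact (A.up b).2 (Or.inr hab)
    rw [Equiv.swap_apply_of_ne_of_ne h1 h2]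
    by_cases h3 : b = p
    · subst h3
      rw [Equiv.swap_apply_left]
      exact (A.lo a).2 (Or.inr hab)
    by_cases h4 : b = q
    · subst h4
      rw [Equiv.swap_apply_right]
      exact ((A.lo a).1 hab).resolve_left h1
    rw [Equiv.swap_apply_of_ne_of_ne h3 h4]; exact hab
  · intro h5
    rw [Prod.mk.injEq, Equiv.swap_apply_eq_iff, Equiv.swap_apply_eq_iff, Equiv.swap_apply_left,
      Equiv.swap_apply_right] at h5
    rw [h5.1, h5.2] at hab
    exact A.irr _ _ A.pq hab

theorem inv_swap (hr : 1 ≤ r) {p q : Fin n} (h : q.val = p.val + r) (θ : Fin n → ℤ) :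
    ((Inv r (fun a => θ (Equiv.swap p q a))).erase (p, q)).card ≤ ((Inv r θ).erase (p, q)).card := by
  refine Finset.card_le_card_of_injOn (fun x => (Equiv.swap p q x.1, Equiv.swap p q x.2)) ?_ ?_
  · rintro ⟨a, b⟩ hx
    simp only [Finset.mem_coe, Finset.mem_erase, Inv, Finset.mem_filter, Finset.mem_univ, true_and] at hx ⊢
    have := swap_R hr h hx.2.1 hx.1
    exact ⟨this.2, this.1, hx.2.2⟩
  · rintro ⟨a, b⟩ _ ⟨c, d⟩ _ hx
    simp only [Prod.mk.injEq, EmbeddingLike.apply_eq_iff_eq] at hx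
    simp [hx]

theorem chain_all (hr : 1 ≤ r) (P : Fin n → Fin n → Prop) (ht : ∀ a b c, P a b → P b c → P a c)
    (h : ∀ p q : Fin n, q.val = p.val + r → P p q) (a b : Fin n) (hab : Rr r a b) : P a b := by
  obtain ⟨t, ht1, hb⟩ := (Rr_iff hr a b).1 hab
  obtain ⟨t, rfl⟩ : ∃ s, t = s + 1 := ⟨t - 1, by omega⟩
  clear hab ht1
  induction t generalizing b with
  | zero => exact h a b (by simpa using hb)
  | succ t ih =>
    have hlt : b.val - r < n := by omega
    have e : r * (t + 1 + 1) = r * (t + 1) + r := by ring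
    refine ht a ⟨b.val - r, hlt⟩ b (ih _ ?_) (h _ _ ?_)
    · simp only; omega
    · simp only; omega

variable {Y : Type*} [AddCommGroup Y] [Module ℚ Y]

theorem Cw_top (D : Dat r n Y) (ν : Fin n → ℤ) (i : ℤ) (h : ((RR r n).card : ℤ) < i) (c : _)
    (hc : c ∈ D.Cw ν i) : c = 0 := by
  funext Φ
  by_contra h0
  obtain ⟨h1, h2⟩ := (hc Φ).2 h0
  have : Φ.card ≤ (RR r n).card := by
    refine Finset.card_le_card_of_injOn (fun t => ofLex t) ?_ ?_
    · intro t ht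
      simp only [RR, Finset.coe_filter, Finset.mem_univ, true_and, Set.mem_setOf_eq]
      exact h1 t ht
    · intro a _ b _ hab; exact hab
  omega

theorem bott (hr : 1 ≤ r) (D : Dat r n Y) (hP : ∀ p q : Fin n, q.val = p.val + r → PSt D p q)
    (ν : Fin n → ℤ) (i : ℤ) (h : ((Inv r (th r ν)).card : ℤ) < i) : D.Van ν i := by
  obtain ⟨k, hk⟩ : ∃ k : ℕ, ((RR r n).card : ℤ) < i + k := ⟨((RR r n).card - i).toNat + 1, by omega⟩
  induction k generalizing ν i with
  | zero =>
    intro c hc _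
    refine ⟨0, Submodule.zero_mem _, ?_⟩
    rw [Cw_top D ν i (by simpa using hk) c hc, map_zero]
  | succ k ih =>
    by_cases h1 : ∀ p q : Fin n, q.val = p.val + r → th r ν p < th r ν q
    · have h2 := chain_all hr (fun a b => th r ν a < th r ν b) (fun a b c => lt_trans) h1
      have h3 : Inv r (th r ν) = RR r n := by
        ext x
        simp only [Inv, RR, Finset.mem_filter, Finset.mem_univ, true_and, and_iff_left_iff_imp]
        exact h2 x.1 x.2
      intro c hc _
      refine ⟨0, Submodule.zero_mem _, ?_⟩
      rw [Cw_top D ν i (by rw [← h3]; exact h) c hc, map_zero]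
    · push Not at h1
      obtain ⟨p, q, hpq, h2⟩ := h1
      have h3 := th_adj hr hpq ν
      have A := adjt_of (n := n) hr hpq
      rcases h2.eq_or_lt with h4 | h4
      · exact D.VL0 A (hP p q hpq) ν i (by linarith)
      · refine D.VL2 A (hP p q hpq) ν i (by linarith) (ih _ _ ?_ (by push_cast at hk; linarith))
        have h5 := inv_swap hr hpq (th r ν)
        have h6 : th r (ν - (ν p - ν q + 1) • al p q) = fun a => th r ν (Equiv.swap p q a) :=
          funext fun a => th_swap hr hpq ν a
        rw [h6]
        have h7 := Finset.pred_card_le_card_erase (s := Inv r fun a => th r ν (Equiv.swap p q a)) (a := (p, q))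
        have h8 := Finset.card_erase_le (s := Inv r (th r ν)) (a := (p, q))
        omega

theorem bott_dom (hr : 1 ≤ r) (D : Dat r n Y) (hP : ∀ p q : Fin n, q.val = p.val + r → PSt D p q)
    (ν : Fin n → ℤ) (i : ℤ) (hi : 1 ≤ i) (h : ∀ p q : Fin n, q.val = p.val + r → ν q ≤ ν p) :
    D.Van ν i := by
  apply bott hr D hP
  have h2 := chain_all hr (fun a b => th r ν b < th r ν a) (fun a b c h h' => lt_trans h' h)
    (fun p q hpq => by have := th_adj hr hpq ν; have := h p q hpq; linarith)
  have : Inv r (th r ν) = ∅ := by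
    rw [Inv, Finset.filter_eq_empty_iff]
    rintro ⟨a, b⟩ _ ⟨h3, h4⟩
    exact absurd (h2 a b h3) (not_lt.2 h4.le)
  rw [this]; simpa using by linarith
end
end KS

namespace KS
set_option linter.unusedSectionVars false
set_option linter.unusedSimpArgs false
section
variable {n L : ℕ}

def QM (r n M : ℕ) : Finset (Fin n × Fin n) :=
  Finset.univ.filter fun x => x.2.val % r = (x.1.val + 1) % r ∧ (x.1.val < x.2.val ∨ x.1.val < M)

def QY (r n m y : ℕ) : Finset (Fin n × Fin n) :=
  Finset.univ.filter fun x => x.2.val % r = (x.1.val + 1) % r ∧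
    (x.1.val < x.2.val ∨ x.1.val < m ∨ (x.1.val = m ∧ y ≤ x.2.val))

theorem QY_zero (r m : ℕ) : QY r n m 0 = QM r n (m + 1) := by
  ext x
  simp only [QY, QM, Finset.mem_filter, Finset.mem_univ, true_and]
  have : (x.1.val < x.2.val ∨ x.1.val < m ∨ (x.1.val = m ∧ 0 ≤ x.2.val)) ↔
    (x.1.val < x.2.val ∨ x.1.val < m + 1) := by omega
  rw [this]

theorem QY_top (r m : ℕ) : QY r n m (m + 1) = QM r n m := by
  ext x
  simp only [QY, QM, Finset.mem_filter, Finset.mem_univ, true_and]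
  have : (x.1.val < x.2.val ∨ x.1.val < m ∨ (x.1.val = m ∧ m + 1 ≤ x.2.val)) ↔
    (x.1.val < x.2.val ∨ x.1.val < m) := by omega
  rw [this]

theorem QY_LSt (r m y : ℕ) : LSt r (QY r n m y) := by
  rintro a b ⟨h1, h2⟩
  have h1 : a.val < b.val := h1
  refine ⟨fun x hx => ?_, fun x hx => ?_⟩
  · simp only [QY, Finset.mem_filter, Finset.mem_univ, true_and] at hx ⊢
    refine ⟨?_, by omega⟩
    rw [hx.1, Nat.add_mod, ← h2, ← Nat.add_mod]
  · simp only [QY, Finset.mem_filter, Finset.mem_univ, true_and] at hx ⊢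
    refine ⟨?_, by omega⟩
    rw [← hx.1, h2]

theorem QM_Stab {r M : ℕ} {p q : Fin n} (h : q.val = p.val + r) (hq : q.val < M) :
    Stab (QM r n M) p q := by
  have h2 : q.val % r = p.val % r := by rw [h]; simp
  refine ⟨fun x hx => ?_, fun x hx => ?_⟩
  · simp only [QM, Finset.mem_filter, Finset.mem_univ, true_and] at hx ⊢
    refine ⟨?_, by omega⟩
    rw [hx.1, Nat.add_mod, ← h2, ← Nat.add_mod]
  · simp only [QM, Finset.mem_filter, Finset.mem_univ, true_and] at hx ⊢
    refine ⟨?_, by omega⟩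
    rw [← hx.1, h2]

variable (r : ℕ) (D0 : ℤ) (lam : Fin n → ℤ) (hl : ∀ a b, Rr r a b → lam b ≤ lam a)

def VQ (L : ℕ) (Q : Finset (Fin n × Fin n)) (k : ℤ) (ν : Fin n → ℤ) (i : ℤ) : Prop :=
  ∀ hQ : LSt r Q, (QD (L := L) r D0 lam hl Q hQ k).Van ν i

def IV (M : ℕ) (ν : Fin n → ℤ) : Prop :=
  ∀ p q : Fin n, q.val = p.val + r → ν q + (if M < q.val then 1 else 0) ≤ ν p

theorem VQ_one (m y : Fin n) (hy : y.val ≤ m.val) (k : ℤ) (ν : Fin n → ℤ) (i : ℤ)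
    (h1 : VQ r D0 lam hl L (QY r n m y) k ν i)
    (h2 : y.val % r = (m.val + 1) % r → VQ r D0 lam hl L (QY r n m y) (k - 1) (ν + al m y) (i + 1)) :
    VQ r D0 lam hl L (QY r n m (y.val + 1)) k ν i := by
  by_cases h : y.val % r = (m.val + 1) % r
  · have e : QY r n m (y.val + 1) = (QY r n m y).erase (m, y) := by
      ext ⟨a, b⟩
      simp only [QY, Finset.mem_filter, Finset.mem_univ, true_and, Finset.mem_erase, ne_eq,
        Prod.mk.injEq, Fin.ext_iff]
      constructor
      · rintro ⟨g1, g2⟩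
        exact ⟨by omega, g1, by omega⟩
      · rintro ⟨g1, g2, g3⟩
        exact ⟨g2, by omega⟩
    rw [e]
    intro hQ'
    refine QD_T1 r D0 lam hl (QY r n m y) (QY_LSt r m y) (m, y) ?_ hQ' k ν i (h1 _) (h2 h _)
    simp [QY, h]
  · have e : QY r n m (y.val + 1) = QY r n m y := by
      ext ⟨a, b⟩
      simp only [QY, Finset.mem_filter, Finset.mem_univ, true_and]
      constructor
      · rintro ⟨g1, g2⟩
        exact ⟨g1, by omega⟩
      · rintro ⟨g1, g2⟩
        refine ⟨g1, ?_⟩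
        by_contra g3
        have g4 : a.val = m.val := by omega
        have g5 : b.val = y.val := by omega
        rw [g4, g5] at g1
        exact h g1
    rw [e]; exact h1

theorem VQ_many (m : Fin n) (y : ℕ) (hy : y ≤ m.val + 1) (k : ℤ) (ν : Fin n → ℤ) (i : ℤ)
    (h : ∀ T : Finset (Fin n), (∀ b ∈ T, b.val < y ∧ b.val % r = (m.val + 1) % r) →
      VQ r D0 lam hl L (QY r n m 0) (k - T.card) (ν + ∑ b ∈ T, al m b) (i + T.card)) :
    VQ r D0 lam hl L (QY r n m y) k ν i := by
  induction y generalizing k ν i with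
  | zero => simpa using h ∅ (by simp)
  | succ y ih =>
    have hyn : y < n := by have := m.2; omega
    refine VQ_one r D0 lam hl m ⟨y, hyn⟩ (by simp only; omega) k ν i ?_ ?_
    · refine ih (by omega) k ν i fun T hT => h T fun b hb => ?_
      have := hT b hb
      exact ⟨by omega, this.2⟩
    · intro hc
      refine ih (by omega) _ _ _ fun T hT => ?_
      have hn : (⟨y, hyn⟩ : Fin n) ∉ T := fun hb => by
        have := (hT _ hb).1
        simp at this
      have := h (insert ⟨y, hyn⟩ T) (by
        intro b hb
        rcases Finset.mem_insert.1 hb with rfl | hb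
        · exact ⟨by simp, hc⟩
        · have := hT b hb
          exact ⟨by omega, this.2⟩)
      rw [Finset.sum_insert hn, Finset.card_insert_of_notMem hn] at this
      convert this using 1
      · push_cast; ring
      · abel
      · push_cast; ring

theorem VQ_sort (hr : 1 ≤ r) (M : ℕ) (k : ℤ)
    (hC : ∀ ν i, IV r M ν → 1 ≤ i → VQ r D0 lam hl L (QM r n M) k ν i)
    (J : ℕ) (x : Fin n) (hx : x.val < M) (κ : Fin n → ℤ)
    (H1 : ∀ p q : Fin n, q.val = p.val + r → q ≠ x → κ q + (if M < q.val then 1 else 0) ≤ κ p)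
    (H2 : ∀ p : Fin n, x.val = p.val + r → -((J : ℤ) + 1) ≤ κ p - κ x)
    (H3 : ∀ p q : Fin n, x.val = p.val + r → q.val = x.val + r →
      κ q + (if M < q.val then 1 else 0) ≤ κ p + 1)
    (i : ℤ) (hi : (J : ℤ) + 1 ≤ i) : VQ r D0 lam hl L (QM r n M) k κ i := by
  induction J generalizing x κ i with
  | zero =>
    by_cases h : ∀ p : Fin n, x.val = p.val + r → κ x ≤ κ p
    · refine hC _ _ (fun p q hpq => ?_) (by simpa using hi)
      by_cases hq : q = x
      · subst hq; rw [if_neg (by omega)]; simpa using h p hpq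
      · exact H1 p q hpq hq
    · push Not at h
      obtain ⟨p, hp, hlt⟩ := h
      intro hQ
      have := H2 p hp
      exact Dat.VL0 _ (adjt_of hr hp) (QD_PSt r D0 lam hl _ hQ k p x (adjt_of hr hp).pq (QM_Stab hp hx))
        κ i (by push_cast at this; linarith)
  | succ J ih =>
    by_cases h : ∀ p : Fin n, x.val = p.val + r → κ x ≤ κ p
    · refine hC _ _ (fun p q hpq => ?_) (by push_cast at hi; linarith)
      by_cases hq : q = x
      · subst hq; rw [if_neg (by omega)]; simpa using h p hpq
      · exact H1 p q hpq hq
    · push Not at h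
      obtain ⟨p, hp, hlt⟩ := h
      intro hQ
      have A := adjt_of hr hp
      have P := QD_PSt (L := L) r D0 lam hl _ hQ k p x A.pq (QM_Stab hp hx)
      have h2 := H2 p hp
      by_cases h3 : κ p - κ x = -1
      · exact Dat.VL0 _ A P κ i h3
      · have hne : p ≠ x := adj_ne hr hp
        have hal := al_self hne
        set κ' : Fin n → ℤ := κ - (κ p - κ x + 1) • al p x with hκ'
        have e1 : κ' p = κ x - 1 := by
          rw [hκ', Pi.sub_apply, Pi.smul_apply, hal.1, smul_eq_mul]; ring
        have e2 : κ' x = κ p + 1 := by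
          rw [hκ', Pi.sub_apply, Pi.smul_apply, hal.2, smul_eq_mul]; ring
        have e3 : ∀ a, a ≠ p → a ≠ x → κ' a = κ a := by
          intro a h1 h2
          rw [hκ', Pi.sub_apply, Pi.smul_apply, al_other h1 h2]; simp
        have hv : VQ r D0 lam hl L (QM r n M) k κ' (i - 1) := by
          refine ih p (by omega) κ' ?_ ?_ ?_ (i - 1) (by push_cast at hi; linarith)
          · intro a b hab hb
            by_cases hbx : b = x
            · subst hbx
              have : a = p := Fin.ext (by omega)
              subst this
              rw [e1, e2, if_neg (by omega)]
              have : κ a - κ b ≤ -2 := by omega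
              linarith
            have hap : a ≠ p := by rintro rfl; apply hbx; exact Fin.ext (by omega)
            rw [e3 b hb hbx]
            by_cases hax : a = x
            · subst hax
              rw [e2]; exact H3 p b hp hab
            · rw [e3 a hap hax]; exact H1 a b hab hbx
          · intro a ha
            have hap : a ≠ p := (adj_ne hr ha)
            have hax : a ≠ x := by rintro rfl; omega
            rw [e1, e3 a hap hax]
            have := H1 a p ha hne
            rw [if_neg (by omega)] at this
            push_cast at h2
            linarith
          · intro a b ha hb
            have hap : a ≠ p := (adj_ne hr ha)
            have hax : a ≠ x := by rintro rfl; omega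
            have : b = x := Fin.ext (by omega)
            subst this
            rw [e2, e3 a hap hax, if_neg (by omega)]
            have := H1 a p ha hne
            rw [if_neg (by omega)] at this
            linarith
        have h4 := Dat.VL1 _ A P κ' (i - 1) (by rw [e1, e2]; omega) (hv hQ)
        convert h4 using 1
        · rw [e1, e2, hκ', sub_sub, ← add_smul]
          rw [show κ p - κ x + 1 + (κ x - 1 - (κ p + 1) + 1) = 0 by ring, zero_smul, sub_zero]
        · ring
end
end KS

namespace KS
set_option linter.unusedSectionVars false
set_option linter.unusedSimpArgs false
section
variable {n L : ℕ}
variable (r : ℕ) (D0 : ℤ) (lam : Fin n → ℤ) (hl : ∀ a b, Rr r a b → lam b ≤ lam a)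

theorem sum_al (m : Fin n) (T : Finset (Fin n)) (a : Fin n) :
    (∑ b ∈ T, al m b) a = (if a = m then (T.card : ℤ) else 0) - (if a ∈ T then 1 else 0) := by
  rw [Finset.sum_apply]
  simp only [al, Pi.sub_apply, Finset.sum_sub_distrib, Pi.single_apply]
  congr 1
  · split_ifs <;> simp
  · simp

theorem VQ_claim (hr : 1 ≤ r) (m : Fin n) (k : ℤ)
    (hC : ∀ k ν i, IV r (m.val + 1) ν → 1 ≤ i → VQ r D0 lam hl L (QM r n (m.val + 1)) k ν i)
    (ν : Fin n → ℤ) (i : ℤ) (hν : IV r m.val ν) (hi : 1 ≤ i) :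
    VQ r D0 lam hl L (QM r n m.val) k ν i := by
  rw [← QY_top]
  refine VQ_many r D0 lam hl m _ le_rfl k ν i fun T hT => ?_
  rw [QY_zero]
  have hTr : ∀ b ∈ T, m.val + 1 - b.val ≥ r := by
    intro b hb
    obtain ⟨h1, h2⟩ := hT b hb
    apply Nat.le_of_dvd (by omega)
    exact (Nat.modEq_iff_dvd' (by omega)).1 h2
  set κ : Fin n → ℤ := ν + ∑ b ∈ T, al m b with hκ
  have e : ∀ a, κ a = ν a + ((if a = m then (T.card : ℤ) else 0) - (if a ∈ T then 1 else 0)) := by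
    intro a; rw [hκ, Pi.add_apply, sum_al]
  have em : κ m = ν m + (T.erase m).card := by
    rw [e, if_pos rfl]
    split_ifs with h
    · have := Finset.card_erase_add_one h
      rw [← this]; push_cast; ring
    · rw [Finset.erase_eq_of_notMem h]; ring
  have en : ∀ a, a ≠ m → κ a = ν a - (if a ∈ T then 1 else 0) := by
    intro a ha; rw [e, if_neg ha]; ring
  have hlow : ∀ a, ν a - (if a ∈ T then 1 else 0) ≤ κ a := by
    intro a; rw [e]
    by_cases ha : a = m
    · rw [if_pos ha]; have : (0:ℤ) ≤ T.card := by positivity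
      linarith
    · rw [if_neg ha]; linarith
  have hgt : ∀ a : Fin n, m.val < a.val → κ a = ν a := by
    intro a ha
    rw [en a (by rintro rfl; omega), if_neg, sub_zero]
    intro h; have := (hT a h).1; omega
  have hcard : (T.erase m).card ≤ T.card := Finset.card_erase_le
  by_cases hm1 : ∃ p q : Fin n, q.val = p.val + r ∧ q.val < m.val ∧ κ p - κ q = -1
  · obtain ⟨p, q, hpq, hq, h⟩ := hm1
    intro hQ
    exact Dat.VL0 _ (adjt_of hr hpq) (QD_PSt r D0 lam hl _ hQ _ p q (adjt_of hr hpq).pq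
      (QM_Stab hpq (by omega))) κ _ h
  · push Not at hm1
    refine VQ_sort r D0 lam hl hr (m.val + 1) _ (hC _) (T.erase m).card m (by omega) κ ?_ ?_ ?_ _
      (by have : ((T.erase m).card : ℤ) ≤ T.card := by exact_mod_cast hcard
          linarith)
    · intro p q hpq hq
      have hνpq := hν p q hpq
      have hp := hlow p
      rcases lt_trichotomy q.val m.val with h | h | h
      · have h1 := hm1 p q hpq h
        have h2 := en q hq
        have h3 := en p (by rintro rfl; omega)
        rw [if_neg (by omega)] at hνpq ⊢
        have : -1 ≤ κ p - κ q := by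
          rw [h2, h3]
          split_ifs <;> linarith
        omega
      · exact absurd (Fin.ext h) hq
      · rw [hgt q h]
        rw [if_pos h] at hνpq
        by_cases hM : m.val + 1 < q.val
        · rw [if_pos hM]
          by_cases hpm : p = m
          · rw [hpm, em]
            have : (0:ℤ) ≤ (T.erase m).card := by positivity
            rw [hpm] at hνpq
            linarith
          · have : p ∉ T := by
              intro hpT
              have h1 := hTr p hpT
              have h2 := (hT p hpT).1
              omega
            rw [if_neg this] at hp
            linarith
        · rw [if_neg hM]
          split_ifs at hp <;> linarith
    · intro p hp
      have h1 := hν p m hp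
      rw [if_neg (by omega)] at h1
      have h2 := hlow p
      rw [em]
      split_ifs at h2 <;> linarith
    · intro p q hp hq
      have h1 := hν p m hp
      have h2 := hν m q hq
      rw [if_neg (by omega)] at h1
      rw [if_pos (by omega)] at h2
      rw [hgt q (by omega)]
      have h3 := hlow p
      split_ifs at h3 ⊢ <;> linarith

theorem VQ_all (hr : 1 ≤ r) (j : ℕ) (M : ℕ) (hM : M + j = n) (k : ℤ) (ν : Fin n → ℤ) (i : ℤ)
    (hν : IV r M ν) (hi : 1 ≤ i) : VQ r D0 lam hl L (QM r n M) k ν i := by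
  induction j generalizing M k ν i with
  | zero =>
    intro hQ
    refine bott_dom hr _ (fun p q hpq => QD_PSt r D0 lam hl _ hQ _ p q (adjt_of hr hpq).pq
      (QM_Stab hpq (by omega))) ν i hi fun p q hpq => ?_
    have := hν p q hpq
    rw [if_neg (by omega)] at this; simpa using this
  | succ j ih =>
    exact VQ_claim r D0 lam hl hr ⟨M, by omega⟩ k (fun k ν i => ih (M + 1) (by omega) k ν i) ν i hν hi

theorem QM_LSt (M : ℕ) : LSt r (QM r n M) := by rw [← QY_top]; exact QY_LSt r M _

/-- main vanishing -/
theorem main_van (hr : 1 ≤ r) (k : ℤ) (mu : Fin n → ℤ)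
    (hmu : ∀ p q : Fin n, q.val = p.val + r → mu q < mu p) (i : ℤ) (hi : 1 ≤ i) :
    (QD (L := L) r D0 lam hl (QM r n 0) (QM_LSt r 0) k).Van mu i := by
  refine VQ_all r D0 lam hl hr n 0 (by omega) k mu i (fun p q hpq => ?_) hi _
  rw [if_pos (by omega)]
  have := hmu p q hpq
  linarith
end
end KS

namespace KS
set_option linter.unusedSectionVars false
set_option linter.unusedSimpArgs false
section
variable {Y : Type*} [AddCommGroup Y] [Module ℚ Y] {r n : ℕ}

noncomputable def ech (D : Dat r n Y) (ν : Fin n → ℤ) : ℤ :=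
  ∑ i ∈ Finset.range ((RR r n).card + 2), (-1) ^ i * (Module.finrank ℚ (D.Cw ν (i : ℤ)) : ℤ)

theorem Cw_big (D : Dat r n Y) (ν : Fin n → ℤ) (i : ℤ) (h : ((RR r n).card : ℤ) < i) : D.Cw ν i = ⊥ := by
  rw [Submodule.eq_bot_iff]; exact Cw_top D ν i h

theorem Cw_neg (D : Dat r n Y) (ν : Fin n → ℤ) (i : ℤ) (h : i < 0) : D.Cw ν i = ⊥ := by
  rw [Submodule.eq_bot_iff]
  intro c hc
  funext Φ
  by_contra h0
  have := ((hc Φ).2 h0).2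
  omega

noncomputable def zf (D : Dat r n Y) (ν : Fin n → ℤ) (i : ℤ) : ℕ :=
  Module.finrank ℚ (LinearMap.ker (D.d.domRestrict (D.Cw ν i)))

theorem euler_step (D : Dat r n Y) (ν : Fin n → ℤ) (i : ℤ) (h : D.Van ν (i + 1)) :
    Module.finrank ℚ (D.Cw ν i) = zf D ν i + zf D ν (i + 1) := by
  have := D.Cw_fd ν i
  have h1 := LinearMap.finrank_range_add_finrank_ker (D.d.domRestrict (D.Cw ν i))
  have h2 : LinearMap.range (D.d.domRestrict (D.Cw ν i)) =
      (LinearMap.ker (D.d.domRestrict (D.Cw ν (i + 1)))).map (D.Cw ν (i + 1)).subtype := by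
    ext c
    constructor
    · rintro ⟨⟨b, hb⟩, rfl⟩
      have h3 : D.d b ∈ D.Cw ν (i + 1) := by
        have := IsGr.d ν i b hb
        rwa [add_zero] at this
      refine ⟨⟨D.d b, h3⟩, ?_, rfl⟩
      rw [SetLike.mem_coe, LinearMap.mem_ker]
      exact LinearMap.congr_fun D.dd b
    · rintro ⟨⟨c, hc⟩, h3, rfl⟩
      obtain ⟨b, hb, h4⟩ := h c hc h3
      rw [add_sub_cancel_right] at hb
      exact ⟨⟨b, hb⟩, h4⟩
  rw [h2, Submodule.finrank_map_subtype_eq] at h1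
  unfold zf
  omega

theorem ech_van (D : Dat r n Y) (ν : Fin n → ℤ) (h : ∀ i : ℤ, 1 ≤ i → D.Van ν i) :
    ech D ν = zf D ν 0 := by
  have key : ∀ K : ℕ, ∑ i ∈ Finset.range K, (-1) ^ i * (Module.finrank ℚ (D.Cw ν (i : ℤ)) : ℤ) =
      zf D ν 0 - (-1) ^ K * zf D ν K := by
    intro K
    induction K with
    | zero => simp
    | succ K ih =>
      rw [Finset.sum_range_succ, ih, euler_step D ν K (h _ (by linarith [Int.natCast_nonneg K]))]
      push_cast
      ring
  unfold ech
  rw [key]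
  have : zf D ν (((RR r n).card + 2 : ℕ) : ℤ) = 0 := by
    unfold zf
    have h1 := Cw_big D ν (((RR r n).card + 2 : ℕ) : ℤ) (by push_cast; linarith)
    have : Subsingleton (D.Cw ν (((RR r n).card + 2 : ℕ) : ℤ)) := by rw [h1]; infer_instance
    exact Module.finrank_zero_of_subsingleton
  rw [this]; simp

namespace Dat
variable (D : Dat r n Y) {p q : Fin n} (hp : Adjt (Rr r) p q)
include D hp

theorem cone_finrank (ν : Fin n → ℤ) (i : ℤ) : Module.finrank ℚ (D.Cw ν i) =
    Module.finrank ℚ (D.Zz p q ν i) + Module.finrank ℚ (D.Zz p q (ν + al p q) (i - 1)) := by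
  have f1 := D.Cw_fd ν i
  have f2 := D.Cw_fd (ν + al p q) (i - 1)
  have g1 : FiniteDimensional ℚ (D.Zz p q ν i) := Submodule.finiteDimensional_of_le (inf_le_left)
  have g2 : FiniteDimensional ℚ (D.Zz p q (ν + al p q) (i - 1)) :=
    Submodule.finiteDimensional_of_le (inf_le_left)
  rw [← Module.finrank_prod]
  symm
  let g : (D.Zz p q ν i × D.Zz p q (ν + al p q) (i - 1)) →ₗ[ℚ] D.Cw ν i :=
    { toFun := fun x => ⟨x.1.1 + eps r Y p q x.2.1, D.cone_mem hp x.1.2 x.2.2⟩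
      map_add' := fun x y => by
        apply Subtype.ext
        simp only [Prod.fst_add, Prod.snd_add, Submodule.coe_add, map_add]; abel
      map_smul' := fun c x => by
        apply Subtype.ext
        simp only [Prod.smul_fst, Prod.smul_snd, Submodule.coe_smul, map_smul, smul_add, RingHom.id_apply] }
  refine (LinearEquiv.ofBijective g ⟨?_, ?_⟩).finrank_eq
  · rw [← LinearMap.ker_eq_bot, LinearMap.ker_eq_bot']
    rintro ⟨⟨a, ha⟩, ⟨a', ha'⟩⟩ h
    have := D.cone_inj hp ha.2 ha'.2 (congrArg Subtype.val h)
    simp [this.1, this.2]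
  · rintro ⟨c, hc⟩
    obtain ⟨a, ha, a', ha', rfl⟩ := D.cone_split hp hc
    exact ⟨(⟨a, ha⟩, ⟨a', ha'⟩), rfl⟩

theorem Zz_refl (hs : PSt D p q) (ν : Fin n → ℤ) (i : ℤ) : Module.finrank ℚ (D.Zz p q ν i) =
    Module.finrank ℚ (D.Zz p q (ν - (ν p - ν q) • al p q) i) := by
  obtain ⟨y, hy, hxy⟩ := hs
  have hL := D.lefsch hp hy hxy ν i
  have e1 : (fun k : ℤ => D.Zz p q (ν + k • al p q) i) (-(ν p - ν q)) =
      D.Zz p q (ν - (ν p - ν q) • al p q) i := by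
    dsimp only
    rw [neg_smul, ← sub_eq_add_neg]
  have e2 : (fun k : ℤ => D.Zz p q (ν + k • al p q) i) 0 = D.Zz p q ν i := by simp
  rw [← e1, ← e2]
  rcases le_total (ν p - ν q) 0 with h | h
  · have := hL.finrank_eq (-(ν p - ν q)).toNat 0 (by omega)
    rwa [show (0:ℤ) + ((-(ν p - ν q)).toNat : ℤ) = -(ν p - ν q) by omega] at this
  · have := hL.finrank_eq (ν p - ν q).toNat (-(ν p - ν q)) (by omega)
    rw [show -(ν p - ν q) + ((ν p - ν q).toNat : ℤ) = 0 by omega] at this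
    exact this.symm

theorem ech_cone (ν : Fin n → ℤ) : ech D ν =
    ∑ i ∈ Finset.range ((RR r n).card + 2), (-1) ^ i * (Module.finrank ℚ (D.Zz p q ν (i : ℤ)) : ℤ) -
    ∑ i ∈ Finset.range ((RR r n).card + 2), (-1) ^ i * (Module.finrank ℚ (D.Zz p q (ν + al p q) (i : ℤ)) : ℤ) := by
  have zb : ∀ ν i, D.Cw ν i = ⊥ → Module.finrank ℚ (D.Zz p q ν i) = 0 := by
    intro ν i h
    have : D.Zz p q ν i = ⊥ := by unfold Dat.Zz; rw [h, bot_inf_eq]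
    rw [this, finrank_bot]
  unfold ech
  simp only [D.cone_finrank hp ν, Nat.cast_add, mul_add, Finset.sum_add_distrib]
  rw [sub_eq_add_neg]
  congr 1
  rw [Finset.sum_range_succ', Finset.sum_range_succ (n := (RR r n).card + 1)]
  rw [zb (ν + al p q) (((RR r n).card + 1 : ℕ) : ℤ) (Cw_big D _ _ (by push_cast; linarith)),
    zb (ν + al p q) (((0 : ℕ) : ℤ) - 1) (Cw_neg D _ _ (by simp)), neg_add, ← Finset.sum_neg_distrib]
  simp only [Nat.cast_zero, mul_zero, add_zero, neg_zero]
  refine Finset.sum_congr rfl fun i _ => ?_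
  rw [pow_succ, show ((i + 1 : ℕ) : ℤ) - 1 = i by push_cast; ring]
  ring

theorem ech_refl (hpq : p ≠ q) (hs : PSt D p q) (ν : Fin n → ℤ) :
    ech D (ν - (ν p - ν q + 1) • al p q) = - ech D ν := by
  have ha := al_self hpq
  rw [D.ech_cone hp, D.ech_cone hp ν]
  have e1 : ν - (ν p - ν q + 1) • al p q + al p q = ν - (ν p - ν q) • al p q := by
    rw [add_smul, one_smul]; abel
  have e2 : ∀ i, Module.finrank ℚ (D.Zz p q (ν + al p q) i) =
      Module.finrank ℚ (D.Zz p q (ν - (ν p - ν q + 1) • al p q) i) := by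
    intro i
    rw [D.Zz_refl hp hs (ν + al p q)]
    have e3 : ν + al p q - ((ν + al p q) p - (ν + al p q) q) • al p q = ν - (ν p - ν q + 1) • al p q := by
      rw [Pi.add_apply, Pi.add_apply, ha.1, ha.2]
      rw [show ν p + 1 - (ν q + -1) = (ν p - ν q + 1) + 1 by ring, add_smul _ (1:ℤ), one_smul]; abel
    rw [e3]
  rw [e1]
  simp only [e2, D.Zz_refl hp hs ν]
  ring
end Dat
end
end KS

namespace KS
set_option linter.unusedSectionVars false
set_option linter.unusedSimpArgs false
section
variable {Y : Type*} [AddCommGroup Y] [Module ℚ Y] {r n : ℕ}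

theorem d_zero_iff (D : Dat r n Y) (c : Finset (Tt n) → Y) (hc : ∀ Φ, Φ ≠ ∅ → c Φ = 0) :
    D.d c = 0 ↔ ∀ a b, Rr r a b → D.x a b (c ∅) = 0 := by
  have hi : ∀ a b : Fin n, iot r Y a b c = 0 := by
    intro a b
    unfold iot
    split_ifs
    · funext Φ
      rw [ann_apply, hc _ (Finset.insert_ne_empty _ _)]
      simp
    · rfl
  have hd : ∀ Φ, D.d c Φ = ∑ a, ∑ b, (eps r Y a b (D.px a b c)) Φ := by
    intro Φ
    have : D.d c = ∑ a, ∑ b, eps r Y a b (D.px a b c) := by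
      unfold Dat.d cd cA cB
      simp only [LinearMap.sub_apply, LinearMap.sum_apply, Module.End.mul_apply, hi, map_zero,
        Finset.sum_const_zero, sub_zero]
    rw [this]; simp only [Finset.sum_apply]
  have he : ∀ (Φ : Finset (Tt n)) (a b : Fin n), (eps r Y a b (D.px a b c)) Φ =
      if Rr r a b ∧ Φ = {toLex (a, b)} then D.x a b (c ∅) else 0 := by
    intro Φ a b
    unfold eps Dat.px
    by_cases h : Rr r a b
    · rw [if_pos h, cre_apply, pw_apply]
      by_cases h2 : Φ = {toLex (a, b)}
      · subst h2
        simp [h, sg, Finset.filter_singleton]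
      · have h5 : ¬ (Rr r a b ∧ Φ = {toLex (a, b)}) := by tauto
        rw [if_neg h5]
        split_ifs with h3
        · rw [hc, map_zero, smul_zero]
          intro h4
          apply h2
          rw [Finset.erase_eq_empty_iff] at h4
          rcases h4 with h4 | h4
          · rw [h4] at h3; simp at h3
          · exact h4
        · rfl
    · rw [if_neg h, if_neg (by tauto)]; rfl
  constructor
  · intro h a b hab
    have h1 := congrFun h {toLex (a, b)}
    rw [hd] at h1
    simp only [he] at h1
    rw [Finset.sum_eq_single a, Finset.sum_eq_single b] at h1
    · simpa [hab] using h1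
    · intro b' _ hb'
      rw [if_neg]
      rintro ⟨_, h2⟩
      have h3 : (toLex (a, b) : Tt n) = toLex (a, b') := by simpa using h2
      rw [toLex_inj, Prod.mk.injEq] at h3
      exact hb' h3.2.symm
    · simp
    · intro a' _ ha'
      refine Finset.sum_eq_zero fun b' _ => ?_
      rw [if_neg]
      rintro ⟨_, h2⟩
      have h3 : (toLex (a, b) : Tt n) = toLex (a', b') := by simpa using h2
      rw [toLex_inj, Prod.mk.injEq] at h3
      exact ha' h3.1.symm
    · simp
  · intro h
    funext Φ
    rw [hd]
    refine Finset.sum_eq_zero fun a _ => Finset.sum_eq_zero fun b _ => ?_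
    rw [he]
    split_ifs with h1
    · exact h a b h1.1
    · rfl

variable {L : ℕ} (D0 : ℤ) (lam : Fin n → ℤ) (hl : ∀ a b, Rr r a b → lam b ≤ lam a)

theorem zf_ne (h : ∀ a, 0 ≤ lam a + D0 ∧ lam a + D0 ≤ L) (ν : Fin n → ℤ) :
    zf (VD (L := L) r D0 lam hl) ν 0 = if ν = lam then 1 else 0 := by
  have hsub : ∀ c ∈ (VD (L := L) r D0 lam hl).Cw ν 0, ∀ Φ, Φ ≠ ∅ → c Φ = 0 := by
    intro c hc Φ hΦ
    by_contra h0
    have := ((hc Φ).2 h0).2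
    rw [Nat.cast_eq_zero, Finset.card_eq_zero] at this
    exact hΦ this
  have hmem : ∀ c ∈ (VD (L := L) r D0 lam hl).Cw ν 0, c ∅ ∈ WV r D0 (vv L D0 lam) (-ν) := by
    intro c hc
    have := (hc ∅).1
    rw [Finset.sum_empty, sub_zero] at this
    exact this
  have hc1 : ∀ c ∈ (VD (L := L) r D0 lam hl).Cw ν 0, (VD (L := L) r D0 lam hl).d c = 0 →
      ∃ q : ℚ, c ∅ = q • vv L D0 lam := by
    intro c hc hd
    rw [d_zero_iff _ c (hsub c hc)] at hd
    exact WV_low r D0 lam hl _ _ (hmem c hc) hd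
  unfold zf
  split_ifs with hν
  · subst hν
    set c0 : Finset (Tt n) → (Finset (Sg n L) → ℚ) := Pi.single ∅ (vv L D0 ν) with hc0
    have m0 : c0 ∈ (VD (L := L) r D0 ν hl).Cw ν 0 := by
      intro Φ
      by_cases hΦ : Φ = ∅
      · subst hΦ
        rw [hc0, Pi.single_eq_same]
        refine ⟨?_, fun _ => ⟨by simp [Valid], by simp⟩⟩
        rw [Finset.sum_empty, sub_zero]
        exact vv_mem r D0 ν hl h
      · rw [hc0, Pi.single_eq_of_ne hΦ]
        exact ⟨Submodule.zero_mem _, fun h => absurd rfl h⟩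
    have d0 : (VD (L := L) r D0 ν hl).d c0 = 0 := by
      rw [d_zero_iff _ c0 (hsub c0 m0)]
      intro a b hab
      rw [hc0, Pi.single_eq_same]
      exact vv_kill D0 ν b a hab.1.ne' (hl a b hab)
    have hne : vv L D0 ν ≠ 0 := by
      intro h0
      have := congrFun h0 (lamS L D0 ν)
      rw [vv, Pi.single_eq_same] at this
      exact one_ne_zero this
    refine finrank_eq_one (⟨⟨c0, m0⟩, d0⟩ : LinearMap.ker ((VD (L := L) r D0 ν hl).d.domRestrict
      ((VD (L := L) r D0 ν hl).Cw ν 0))) ?_ ?_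
    · intro h0
      have h1 : c0 = 0 := congrArg (fun x => x.1.1) h0
      have h2 := congrFun h1 ∅
      rw [hc0, Pi.single_eq_same] at h2
      exact hne h2
    · rintro ⟨⟨c, mc⟩, dc⟩
      obtain ⟨x, hx⟩ := hc1 c mc dc
      refine ⟨x, ?_⟩
      apply Subtype.ext; apply Subtype.ext
      funext Φ
      show x • c0 Φ = c Φ
      by_cases hΦ : Φ = ∅
      · subst hΦ
        rw [hx, hc0, Pi.single_eq_same]
      · rw [hc0, Pi.single_eq_of_ne hΦ, hsub c mc Φ hΦ, smul_zero]
  · have : ∀ x : LinearMap.ker ((VD (L := L) r D0 lam hl).d.domRestrict ((VD (L := L) r D0 lam hl).Cw ν 0)),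
        x = 0 := by
      rintro ⟨⟨c, mc⟩, dc⟩
      apply Subtype.ext; apply Subtype.ext
      show c = 0
      funext Φ
      by_cases hΦ : Φ = ∅
      · subst hΦ
        obtain ⟨x, hx⟩ := hc1 c mc dc
        have hm := hmem c mc
        by_contra h0
        obtain ⟨S, hS⟩ := Function.ne_iff.1 h0
        have h1 := hm.2 S hS
        have h2 := vv_supp D0 lam h S (by
          intro h3; apply hS; rw [hx, Pi.smul_apply, h3]; simp)
        rw [h1] at h2
        exact hν (neg_injective h2)
      · exact hsub c mc Φ hΦ
    have : Subsingleton (LinearMap.ker ((VD (L := L) r D0 lam hl).d.domRestrict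
        ((VD (L := L) r D0 lam hl).Cw ν 0))) := ⟨fun x y => (this x).trans (this y).symm⟩
    exact Module.finrank_zero_of_subsingleton

theorem ech_dom (hr : 1 ≤ r) (h : ∀ a, 0 ≤ lam a + D0 ∧ lam a + D0 ≤ L) (ν : Fin n → ℤ)
    (hν : ∀ p q : Fin n, q.val = p.val + r → ν q ≤ ν p) :
    ech (VD (L := L) r D0 lam hl) ν = if ν = lam then 1 else 0 := by
  rw [ech_van, zf_ne D0 lam hl h]
  · split_ifs <;> rfl
  · intro i hi
    exact bott_dom hr _ (fun p q hpq => VD_PSt r D0 lam hl p q (adjt_of hr hpq).pq) ν i hi hν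

theorem ech_swap (hr : 1 ≤ r) (ν : Fin n → ℤ) (p q : Fin n) (hpq : q.val = p.val + r) :
    ech (VD (L := L) r D0 lam hl) (ν - (ν p - ν q + 1) • al p q) = - ech (VD (L := L) r D0 lam hl) ν :=
  Dat.ech_refl _ (adjt_of hr hpq) (adj_ne hr hpq) (VD_PSt r D0 lam hl p q (adjt_of hr hpq).pq) ν

/-- comparison principle -/
theorem ech_unique (hr : 1 ≤ r) (h : ∀ a, 0 ≤ lam a + D0 ∧ lam a + D0 ≤ L) (F : (Fin n → ℤ) → ℤ)
    (hF : ∀ ν (p q : Fin n), q.val = p.val + r → F (ν - (ν p - ν q + 1) • al p q) = - F ν)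
    (hF1 : ∀ ν, (∀ p q : Fin n, q.val = p.val + r → ν q ≤ ν p) → F ν = if ν = lam then 1 else 0)
    (ν : Fin n → ℤ) : ech (VD (L := L) r D0 lam hl) ν = F ν := by
  obtain ⟨k, hk⟩ : ∃ k, (Inv r (th r ν)).card ≤ k := ⟨_, le_rfl⟩
  induction k generalizing ν with
  | zero =>
    have h0 : Inv r (th r ν) = ∅ := Finset.card_eq_zero.1 (by omega)
    by_cases h1 : ∃ p q : Fin n, q.val = p.val + r ∧ ν p - ν q = -1
    · obtain ⟨p, q, hpq, h2⟩ := h1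
      have h3 := ech_swap (L := L) D0 lam hl hr ν p q hpq
      have h4 := hF ν p q hpq
      rw [h2] at h3 h4
      simp only [neg_add_cancel, zero_smul, sub_zero] at h3 h4
      omega
    · push Not at h1
      have : ∀ p q : Fin n, q.val = p.val + r → ν q ≤ ν p := by
        intro p q hpq
        have h2 := h1 p q hpq
        have h3 := th_adj hr hpq ν
        have h4 : ¬ th r ν p < th r ν q := by
          intro h5
          have : (p, q) ∈ Inv r (th r ν) := by
            simp only [Inv, Finset.mem_filter, Finset.mem_univ, true_and]
            exact ⟨(adjt_of hr hpq).pq, h5⟩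
          rw [h0] at this; simp at this
        omega
      rw [ech_dom D0 lam hl hr h ν this, hF1 ν this]
  | succ k ih =>
    by_cases h1 : ∃ p q : Fin n, q.val = p.val + r ∧ th r ν p < th r ν q
    · obtain ⟨p, q, hpq, h2⟩ := h1
      have h3 := ech_swap (L := L) D0 lam hl hr ν p q hpq
      have h4 := hF ν p q hpq
      have h6 : th r (ν - (ν p - ν q + 1) • al p q) = fun a => th r ν (Equiv.swap p q a) :=
        funext fun a => th_swap hr hpq ν a
      have h5 := ih (ν - (ν p - ν q + 1) • al p q) (by
        rw [h6]
        have h7 := inv_swap hr hpq (th r ν)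
        rw [Finset.erase_eq_of_notMem] at h7
        · have h8 : (p, q) ∈ Inv r (th r ν) := by
            simp only [Inv, Finset.mem_filter, Finset.mem_univ, true_and]
            exact ⟨(adjt_of hr hpq).pq, h2⟩
          have := Finset.card_erase_add_one h8
          omega
        · simp only [Inv, Finset.mem_filter, Finset.mem_univ, true_and, Equiv.swap_apply_left,
            Equiv.swap_apply_right]
          intro h8; exact absurd h8.2 (not_lt.2 h2.le))
      omega
    · push Not at h1
      apply ih
      have h2 := chain_all hr (fun a b => th r ν b ≤ th r ν a) (fun a b c h h' => le_trans h' h) h1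
      have : Inv r (th r ν) = ∅ := by
        rw [Inv, Finset.filter_eq_empty_iff]
        rintro ⟨a, b⟩ _ ⟨h3, h4⟩
        exact absurd (h2 a b h3) (not_le.2 h4)
      rw [this]; simp
end
end KS

namespace KS
set_option linter.unusedSectionVars false
set_option linter.unusedSimpArgs false
section
open MvPolynomial
variable {r n L : ℕ}

theorem MonP_iff (Q : Finset (Fin n × Fin n)) (k : ℕ) (m : Mo n) :
    MonP Q (k : ℤ) m ↔ m ∈ Finset.finsuppAntidiag Q k := by
  rw [Finset.mem_finsuppAntidiag]
  unfold MonP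
  constructor
  · rintro ⟨h1, h2⟩
    refine ⟨?_, h1⟩
    unfold sz at h2
    rw [← Finset.sum_subset (Finset.subset_univ Q) (fun i _ hi => by
        rw [Finsupp.notMem_support_iff.1 (fun hh => hi (h1 hh))]; rfl)] at h2
    exact_mod_cast h2
  · rintro ⟨h2, h1⟩
    refine ⟨h1, ?_⟩
    unfold sz
    rw [← Finset.sum_subset (Finset.subset_univ Q) (fun i _ hi => by
        rw [Finsupp.notMem_support_iff.1 (fun hh => hi (h1 hh))]; rfl)]
    exact_mod_cast h2

variable (D0 : ℤ) (lam : Fin n → ℤ) (hl : ∀ a b, Rr r a b → lam b ≤ lam a)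

theorem wt_shift (ν s w : Fin n → ℤ) : -ν - s - w = -(ν + w) - s := by abel

theorem QD_finrank (Q : Finset (Fin n × Fin n)) (hQ : LSt r Q) (k : ℕ) (ν : Fin n → ℤ) (i : ℤ) :
    Module.finrank ℚ ((QD (L := L) r D0 lam hl Q hQ k).Cw ν i) =
      ∑ m ∈ Finset.finsuppAntidiag Q k, Module.finrank ℚ ((VD (L := L) r D0 lam hl).Cw (ν + wm m) i) := by
  classical
  have hfd := fun m : {m // m ∈ Finset.finsuppAntidiag Q k} =>
    (VD (L := L) r D0 lam hl).Cw_fd (ν + wm m.1) i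
  let g : (QD (L := L) r D0 lam hl Q hQ k).Cw ν i →ₗ[ℚ]
      ((m : {m // m ∈ Finset.finsuppAntidiag Q k}) → (VD (L := L) r D0 lam hl).Cw (ν + wm m.1) i) :=
    { toFun := fun c m => ⟨fun Φ => cfm m.1 (c.1 Φ), fun Φ => by
        have h1 := ((c.2 Φ).1 m.1).1
        refine ⟨?_, fun h0 => (c.2 Φ).2 ?_⟩
        · rw [wt_shift] at h1; exact h1
        · intro h2; apply h0; show cfm m.1 (c.1 Φ) = 0; rw [h2]; exact map_zero _⟩
      map_add' := fun c c' => by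
        funext m; apply Subtype.ext; funext Φ; exact map_add (cfm m.1) (c.1 Φ) (c'.1 Φ)
      map_smul' := fun a c => by
        funext m; apply Subtype.ext; funext Φ; exact map_smul (cfm m.1) a (c.1 Φ) }
  have hg : Function.Bijective g := by
    constructor
    · rw [← LinearMap.ker_eq_bot, LinearMap.ker_eq_bot']
      intro c h
      apply Subtype.ext
      funext Φ
      apply YQ_ext
      intro m
      refine Eq.trans ?_ (map_zero _).symm
      by_contra h0
      have h1 := ((c.2 Φ).1 m).2 h0
      rw [MonP_iff] at h1
      have h4 := congrFun h ⟨m, h1⟩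
      exact h0 (congrFun (congrArg Subtype.val h4) Φ)
    · intro u
      let c : Finset (Tt n) → YQ n L := fun Φ => ∑ m, tens ((u m).1 Φ) (monomial m.1 1)
      have hc : c ∈ (QD (L := L) r D0 lam hl Q hQ k).Cw ν i := by
        intro Φ
        constructor
        · refine Submodule.sum_mem _ fun m _ => ?_
          apply tens_mem
          intro m' hm'
          rw [coeff_monomial] at hm'
          have : m.1 = m' := by by_contra h; rw [if_neg h] at hm'; exact hm' rfl
          subst this
          refine ⟨(MonP_iff _ _ _).2 m.2, ?_⟩
          rw [wt_shift]; exact ((u m).2 Φ).1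
        · intro h0
          by_contra h1
          apply h0
          refine Finset.sum_eq_zero fun m _ => ?_
          have : (u m).1 Φ = 0 := by
            by_contra h2; exact h1 (((u m).2 Φ).2 h2)
          rw [this]; funext S; simp [tens]
      refine ⟨⟨c, hc⟩, ?_⟩
      funext m
      apply Subtype.ext
      funext Φ
      show cfm m.1 (c Φ) = (u m).1 Φ
      rw [map_sum, Finset.sum_eq_single m]
      · rw [cfm_tens]; simp
      · intro m' _ hne
        rw [cfm_tens, coeff_monomial, if_neg (fun h => hne (Subtype.ext h)), zero_smul]
      · simp
  rw [(LinearEquiv.ofBijective g hg).finrank_eq, Module.finrank_pi_fintype]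
  rw [← Finset.sum_coe_sort (Finset.finsuppAntidiag Q k)]

theorem QD_ech (Q : Finset (Fin n × Fin n)) (hQ : LSt r Q) (k : ℕ) (ν : Fin n → ℤ) :
    ech (QD (L := L) r D0 lam hl Q hQ k) ν =
      ∑ m ∈ Finset.finsuppAntidiag Q k, ech (VD (L := L) r D0 lam hl) (ν + wm m) := by
  unfold ech
  rw [Finset.sum_comm]
  refine Finset.sum_congr rfl fun i _ => ?_
  rw [QD_finrank, Nat.cast_sum, Finset.mul_sum]

/-- positivity for any antisymmetric function normalised at `lam` -/
theorem main_pos (hr : 1 ≤ r) (F : (Fin n → ℤ) → ℤ)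
    (hF : ∀ ν (p q : Fin n), q.val = p.val + r → F (ν - (ν p - ν q + 1) • al p q) = - F ν)
    (hF1 : ∀ ν, (∀ p q : Fin n, q.val = p.val + r → ν q ≤ ν p) → F ν = if ν = lam then 1 else 0)
    (hl : ∀ a b, Rr r a b → lam b ≤ lam a)
    (mu : Fin n → ℤ) (hmu : ∀ p q : Fin n, q.val = p.val + r → mu q < mu p) (k : ℕ) :
    0 ≤ ∑ m ∈ Finset.finsuppAntidiag (QM r n 0) k, F (mu + wm m) := by
  obtain ⟨D0, L, h⟩ : ∃ (D0 : ℤ) (L : ℕ), ∀ a, 0 ≤ lam a + D0 ∧ lam a + D0 ≤ L := by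
    refine ⟨∑ a, |lam a|, (2 * ∑ a, |lam a|).toNat, fun a => ?_⟩
    have h1 : |lam a| ≤ ∑ a, |lam a| :=
      Finset.single_le_sum (f := fun a => |lam a|) (fun _ _ => abs_nonneg _) (Finset.mem_univ a)
    have h2 := neg_abs_le (lam a)
    have h3 := le_abs_self (lam a)
    omega
  have h1 := QD_ech (L := L) D0 lam hl (QM r n 0) (QM_LSt r 0) k mu
  rw [ech_van _ _ (fun i hi => main_van r D0 lam hl hr k mu hmu i hi)] at h1
  calc (0:ℤ) ≤ _ := Nat.cast_nonneg _
    _ = _ := h1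
    _ = _ := Finset.sum_congr rfl fun m _ => ech_unique D0 lam hl hr h F hF hF1 _
end
end KS

namespace KS
set_option linter.unusedSectionVars false
set_option linter.unusedSimpArgs false
section
variable {r N : ℕ}

theorem pos_mod (s : Fin r) (j : Fin N) : (pos r N s j).val % r = s.val := by
  simp [pos, Nat.mod_eq_of_lt s.isLt]

theorem pos_div (s : Fin r) (j : Fin N) : (pos r N s j).val / r = j.val := by
  have h : 0 < r := s.pos
  simp [pos, Nat.mul_add_div h, Nat.div_eq_of_lt s.isLt]

theorem pos_surj (i : Fin (r * N)) : ∃ s j, i = pos r N s j :=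
  ⟨⟨i.val % r, mod_lt_of_fin i⟩, ⟨i.val / r, div_lt_of_fin i⟩, Fin.ext (Nat.div_add_mod _ _).symm⟩

theorem pos_inj {s s' : Fin r} {j j' : Fin N} (h : pos r N s j = pos r N s' j') : s = s' ∧ j = j' := by
  constructor
  · apply Fin.ext; rw [← pos_mod s j, h, pos_mod]
  · apply Fin.ext; rw [← pos_div s j, h, pos_div]

theorem permAct_pos (σ : Fin r → Equiv.Perm (Fin N)) (ν : Fin (r * N) → ℤ) (s : Fin r) (j : Fin N) :
    permAct r N σ ν (pos r N s j) = ν (pos r N s ((σ s)⁻¹ j)) := by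
  have h1 : (⟨(pos r N s j).val % r, mod_lt_of_fin _⟩ : Fin r) = s := Fin.ext (pos_mod s j)
  have h2 : (⟨(pos r N s j).val / r, div_lt_of_fin _⟩ : Fin N) = j := Fin.ext (pos_div s j)
  unfold permAct
  rw [h1, h2]

theorem rho_pos (s : Fin r) (j : Fin N) : rhoVec r N (pos r N s j) = (N : ℤ) - (j.val : ℤ) := by
  unfold rhoVec; rw [pos_div]

theorem vec_ext {x y : Fin (r * N) → ℤ} (h : ∀ s j, x (pos r N s j) = y (pos r N s j)) : x = y := by
  funext i
  obtain ⟨s, j, rfl⟩ := pos_surj i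
  exact h s j

theorem permAct_mul (τ σ : Fin r → Equiv.Perm (Fin N)) (x : Fin (r * N) → ℤ) :
    permAct r N τ (permAct r N σ x) = permAct r N (τ * σ) x := by
  apply vec_ext
  intro s j
  rw [permAct_pos, permAct_pos, permAct_pos, Pi.mul_apply, mul_inv_rev]
  rfl

theorem permAct_one (x : Fin (r * N) → ℤ) : permAct r N 1 x = x := by
  apply vec_ext
  intro s j
  rw [permAct_pos]; rfl

theorem signProd_mul (τ σ : Fin r → Equiv.Perm (Fin N)) :
    signProd r N (τ * σ) = signProd r N τ * signProd r N σ := by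
  unfold signProd
  rw [← Finset.prod_mul_distrib]
  refine Finset.prod_congr rfl fun s _ => ?_
  rw [Pi.mul_apply, map_mul]; push_cast; rfl

theorem signProd_one : signProd r N 1 = 1 := by simp [signProd]

theorem signProd_single (s : Fin r) (ρ : Equiv.Perm (Fin N)) :
    signProd r N (Pi.mulSingle s ρ) = Equiv.Perm.sign ρ := by
  unfold signProd
  rw [Finset.prod_eq_single s]
  · simp
  · intro t _ ht; rw [Pi.mulSingle_eq_of_ne ht]; simp
  · simp

open Classical in
noncomputable def FF (r N : ℕ) (lam ν : Fin (r * N) → ℤ) : ℤ :=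
  ∑ σ : Fin r → Equiv.Perm (Fin N), signProd r N σ *
    if ν + rhoVec r N = permAct r N σ (lam + rhoVec r N) then 1 else 0

theorem FF_swap (hr : 1 ≤ r) (lam ν : Fin (r * N) → ℤ) (p q : Fin (r * N)) (hpq : q.val = p.val + r) :
    FF r N lam (ν - (ν p - ν q + 1) • al p q) = - FF r N lam ν := by
  obtain ⟨s, j, rfl⟩ := pos_surj p
  obtain ⟨s', j', rfl⟩ := pos_surj q
  have hs : s' = s := by
    apply Fin.ext; rw [← pos_mod s' j', hpq, Nat.add_mod_right, pos_mod]
  subst hs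
  have hj : j'.val = j.val + 1 := by
    rw [← pos_div s' j', hpq, Nat.add_div_right _ hr, pos_div]
  have hne : j ≠ j' := by intro h; rw [h] at hj; omega
  set τ : Fin r → Equiv.Perm (Fin N) := Pi.mulSingle s' (Equiv.swap j j') with hτ
  have hττ : τ * τ = 1 := by
    rw [hτ, ← Pi.mulSingle_mul, Equiv.swap_mul_self, Pi.mulSingle_one]
  have hsg : signProd r N τ = -1 := by
    rw [hτ, signProd_single, Equiv.Perm.sign_swap hne]; rfl
  have hx : ν - (ν (pos r N s' j) - ν (pos r N s' j') + 1) • al (pos r N s' j) (pos r N s' j') + rhoVec r N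
      = permAct r N τ (ν + rhoVec r N) := by
    have key : ∀ a, (ν - (ν (pos r N s' j) - ν (pos r N s' j') + 1) • al (pos r N s' j) (pos r N s' j') +
        rhoVec r N) a = (ν + rhoVec r N) (Equiv.swap (pos r N s' j) (pos r N s' j') a) := by
      intro a
      have := th_swap hr hpq ν a
      unfold th at this
      rw [Pi.add_apply, Pi.add_apply]
      unfold rhoVec
      linarith
    apply vec_ext
    intro t k
    rw [key, permAct_pos]
    by_cases ht : t = s'
    · subst ht
      rw [hτ, Pi.mulSingle_eq_same, Equiv.swap_inv]
      by_cases h1 : k = j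
      · subst h1; rw [Equiv.swap_apply_left, Equiv.swap_apply_left]
      by_cases h2 : k = j'
      · subst h2; rw [Equiv.swap_apply_right, Equiv.swap_apply_right]
      rw [Equiv.swap_apply_of_ne_of_ne h1 h2, Equiv.swap_apply_of_ne_of_ne]
      · intro h; exact h1 (pos_inj h).2
      · intro h; exact h2 (pos_inj h).2
    · rw [hτ, Pi.mulSingle_eq_of_ne ht, inv_one, Equiv.Perm.one_apply, Equiv.swap_apply_of_ne_of_ne]
      · intro h; exact ht (pos_inj h).1
      · intro h; exact ht (pos_inj h).1
  unfold FF
  rw [hx, ← Equiv.sum_comp (Equiv.mulLeft τ), ← Finset.sum_neg_distrib]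
  refine Finset.sum_congr rfl fun σ _ => ?_
  rw [Equiv.coe_mulLeft, signProd_mul, hsg, ← permAct_mul, neg_one_mul, neg_mul]
  congr 2
  refine if_congr ⟨fun h => ?_, fun h => ?_⟩ rfl rfl
  · have := congrArg (permAct r N τ) h
    rwa [permAct_mul, permAct_mul, hττ, permAct_one, permAct_one] at this
  · rw [h]

theorem FF_dom (hr : 1 ≤ r) (lam ν : Fin (r * N) → ℤ)
    (hl : ∀ a b : Fin (r * N), Rr r a b → lam b ≤ lam a)
    (hν : ∀ p q : Fin (r * N), q.val = p.val + r → ν q ≤ ν p) :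
    FF r N lam ν = if ν = lam then 1 else 0 := by
  have hν' := chain_all hr (fun a b => ν b ≤ ν a) (fun a b c h h' => le_trans h' h) hν
  have hR : ∀ (s : Fin r) (j k : Fin N), j < k → Rr r (pos r N s j) (pos r N s k) := by
    intro s j k h
    refine ⟨?_, by rw [pos_mod, pos_mod]⟩
    have := Nat.mul_lt_mul_of_pos_left (Fin.lt_def.1 h) hr
    rw [Fin.lt_def]
    simp only [pos]
    omega
  have hst : ∀ x : Fin (r * N) → ℤ, (∀ a b, Rr r a b → x b ≤ x a) → ∀ s,
      StrictAnti fun j => (x + rhoVec r N) (pos r N s j) := by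
    intro x hx s j k hjk
    have h1 := hx _ _ (hR s j k hjk)
    have h2 := Fin.lt_def.1 hjk
    simp only [Pi.add_apply, rho_pos]
    omega
  have hone : ∀ σ : Fin r → Equiv.Perm (Fin N),
      ν + rhoVec r N = permAct r N σ (lam + rhoVec r N) → σ = 1 := by
    intro σ h
    funext s
    have h1 : StrictMono ((σ s)⁻¹ : Equiv.Perm (Fin N)) := by
      intro j k hjk
      have h2 := hst ν hν' s hjk
      simp only [h, permAct_pos] at h2
      exact (hst lam hl s).lt_iff_gt.1 h2
    have h3 : StrictMono.orderIsoOfSurjective _ h1 ((σ s)⁻¹).surjective = OrderIso.refl _ :=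
      Subsingleton.elim _ _
    have h4 : (σ s)⁻¹ = 1 := by
      ext j
      have := congrArg (fun e : Fin N ≃o Fin N => (e j).val) h3
      exact this
    rw [Pi.one_apply]
    exact inv_eq_one.1 h4
  unfold FF
  rw [Finset.sum_eq_single 1]
  · rw [signProd_one, one_mul, permAct_one]
    simp only [add_left_inj]
  · intro σ _ h
    rw [if_neg (fun h' => h (hone σ h')), mul_zero]
  · simp
end
end KS

namespace KS
set_option linter.unusedSectionVars false
set_option linter.unusedSimpArgs false
section
variable {r N : ℕ}

def gg {n : ℕ} (x : Fin n × Fin n) : ℕ × ℕ := (x.1.val + 1, x.2.val + 1)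

theorem gg_inj {n : ℕ} : Function.Injective (gg (n := n)) := by
  rintro ⟨a, b⟩ ⟨c, d⟩ h
  simp only [gg, Prod.mk.injEq] at h
  ext
  · simp; omega
  · simp; omega

noncomputable def ph {n : ℕ} (m : Mo n) : Multiset (ℕ × ℕ) := (Finsupp.toMultiset m).map gg

theorem ph_inj {n : ℕ} : Function.Injective (ph (n := n)) := by
  intro m m' h
  classical
  have h1 : Finsupp.toMultiset m = Finsupp.toMultiset m' := Multiset.map_injective gg_inj h
  ext x
  rw [← Finsupp.count_toMultiset, h1, Finsupp.count_toMultiset]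

theorem prVec_gg (x : Fin (r * N) × Fin (r * N)) : prVec r N (gg x) = al x.1 x.2 := by
  funext i
  simp only [prVec, stdVec, gg, al, Pi.sub_apply, Pi.single_apply, add_left_inj, Fin.ext_iff]

theorem wm_ph (m : Mo (r * N)) : ((ph m).map (prVec r N)).sum = wm m := by
  classical
  unfold ph wm
  rw [Multiset.map_map, Finset.sum_multiset_map_count]
  rw [Finset.sum_subset (Finset.subset_univ _)]
  · refine Finset.sum_congr rfl fun i _ => ?_
    rw [Finsupp.count_toMultiset, Function.comp_apply, prVec_gg, natCast_zsmul]
  · intro i _ hi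
    rw [Multiset.mem_toFinset] at hi
    rw [Multiset.count_eq_zero_of_notMem hi, zero_smul]

theorem card_ph {n : ℕ} (Q : Finset (Fin n × Fin n)) (d : ℕ) (m : Mo n)
    (h : m ∈ Finset.finsuppAntidiag Q d) : Multiset.card (ph m) = d := by
  rw [Finset.mem_finsuppAntidiag] at h
  unfold ph
  rw [Multiset.card_map, Finsupp.card_toMultiset, Finsupp.sum, ← h.1]
  refine Finset.sum_subset h.2 fun i _ hi => ?_
  rw [Finsupp.notMem_support_iff.1 hi]; rfl

theorem gg_pair (x : Fin (r * N) × Fin (r * N)) : PseudoPair r N (gg x) ↔ x ∈ QM r (r * N) 0 := by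
  have h1 := x.2.isLt
  have h2 : (x.2.val + 1) % r = (x.1.val + 1 + 1) % r ↔ x.2.val % r = (x.1.val + 1) % r := by
    constructor
    · intro h; exact Nat.ModEq.add_right_cancel' 1 h
    · intro h; exact Nat.ModEq.add_right 1 h
  simp only [PseudoPair, gg, QM, Finset.mem_filter, Finset.mem_univ, true_and]
  rw [h2]
  constructor
  · rintro ⟨_, h3, _, h4⟩; exact ⟨h4, by omega⟩
  · rintro ⟨h3, h4⟩; exact ⟨by omega, by omega, by omega, h3⟩

theorem ph_surj (M : Multiset (ℕ × ℕ)) (h : ∀ p ∈ M, PseudoPair r N p) :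
    ∃ m : Mo (r * N), m ∈ Finset.finsuppAntidiag (QM r (r * N) 0) (Multiset.card M) ∧ ph m = M := by
  classical
  have h1 : ∃ M' : Multiset (Fin (r * N) × Fin (r * N)), M'.map gg = M := by
    induction M using Multiset.induction_on with
    | empty => exact ⟨0, rfl⟩
    | cons p M ih =>
      obtain ⟨M', h2⟩ := ih fun q hq => h q (Multiset.mem_cons_of_mem hq)
      obtain ⟨h3, h4, h5, _⟩ := h p (Multiset.mem_cons_self _ _)
      refine ⟨(⟨p.1 - 1, by omega⟩, ⟨p.2 - 1, by omega⟩) ::ₘ M', ?_⟩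
      rw [Multiset.map_cons, h2]
      congr 1
      ext
      · simp [gg]; omega
      · simp [gg]; omega
  obtain ⟨M', rfl⟩ := h1
  refine ⟨Multiset.toFinsupp M', ?_, ?_⟩
  · have hs : (Multiset.toFinsupp M').support ⊆ QM r (r * N) 0 := by
      intro x hx
      rw [Multiset.toFinsupp_support, Multiset.mem_toFinset] at hx
      exact (gg_pair x).1 (h _ (Multiset.mem_map_of_mem _ hx))
    rw [Finset.mem_finsuppAntidiag]
    refine ⟨?_, hs⟩
    rw [Multiset.card_map]
    rw [← Finset.sum_subset hs fun i _ hi => Finsupp.notMem_support_iff.1 hi]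
    rw [Multiset.toFinsupp_support]
    simp only [Multiset.toFinsupp_apply]
    exact Multiset.toFinset_sum_count_eq M'
  · unfold ph; rw [Multiset.toFinsupp_toMultiset]

def hgt {n : ℕ} (β : Fin n → ℤ) : ℤ := - ∑ i : Fin n, (i.val : ℤ) * β i

theorem hgt_al {n : ℕ} (a b : Fin n) : hgt (al a b) = b.val - a.val := by
  unfold hgt al
  simp [Pi.single_apply, mul_sub, Finset.sum_sub_distrib]

theorem hgt_wm {n : ℕ} (m : Mo n) : hgt (wm m) = ∑ i : Fin n × Fin n, (m i : ℤ) * hgt (al i.1 i.2) := by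
  unfold wm
  have h : ∀ (s : Finset (Fin n × Fin n)), hgt (∑ i ∈ s, (m i : ℤ) • al i.1 i.2) =
      ∑ i ∈ s, (m i : ℤ) * hgt (al i.1 i.2) := by
    intro s
    unfold hgt
    simp only [Finset.sum_apply, Pi.smul_apply, smul_eq_mul, Finset.mul_sum, mul_neg,
      Finset.sum_neg_distrib]
    rw [Finset.sum_comm]
    congr 1
    refine Finset.sum_congr rfl fun i _ => Finset.sum_congr rfl fun j _ => by ring
  exact h _

theorem hgt_bound {n : ℕ} (d : ℕ) (m : Mo n) (h : m ∈ Finset.finsuppAntidiag (QM r n 0) d) :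
    (d : ℤ) ≤ hgt (wm m) := by
  have h1 := (MonP_iff _ _ _).2 h
  rw [← h1.2, hgt_wm]
  unfold sz
  refine Finset.sum_le_sum fun i _ => ?_
  rw [hgt_al]
  by_cases hi : m i = 0
  · simp [hi]
  · have h2 := h1.1 (Finsupp.mem_support_iff.2 hi)
    simp only [QM, Finset.mem_filter] at h2
    have h3 : (1:ℤ) ≤ (i.2.val : ℤ) - i.1.val := by omega
    have h4 : (0:ℤ) ≤ m i := by positivity
    nlinarith

open Classical in
theorem Lone_coeff (β : Fin (r * N) → ℤ) (d : ℕ) : (Lone r N β).coeff d =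
    ∑ m ∈ Finset.finsuppAntidiag (QM r (r * N) 0) d, if wm m = β then (1:ℤ) else 0 := by
  set A : Finset (Mo (r * N)) := ((Finset.range ((hgt β).toNat + 1)).biUnion
    fun e => Finset.finsuppAntidiag (QM r (r * N) 0) e).filter (fun m => wm m = β) with hA
  have hmem : ∀ m, m ∈ A ↔ (∃ e, m ∈ Finset.finsuppAntidiag (QM r (r * N) 0) e) ∧ wm m = β := by
    intro m
    rw [hA, Finset.mem_filter, Finset.mem_biUnion]
    constructor
    · rintro ⟨⟨e, _, h1⟩, h2⟩; exact ⟨⟨e, h1⟩, h2⟩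
    · rintro ⟨⟨e, h1⟩, h2⟩
      have := hgt_bound e m h1
      rw [h2] at this
      exact ⟨⟨e, Finset.mem_range.2 (by omega), h1⟩, h2⟩
  clear_value A
  have hS : {M : Multiset (ℕ × ℕ) | IsDecomp r N β M} = ((A.image ph : Finset _) : Set _) := by
    ext M
    rw [Set.mem_ofPred_eq, Finset.mem_coe, Finset.mem_image]
    constructor
    · rintro ⟨h1, h2⟩
      obtain ⟨m, h3, rfl⟩ := ph_surj M h1
      refine ⟨m, (hmem m).2 ⟨⟨_, h3⟩, ?_⟩, rfl⟩
      rw [← wm_ph, h2]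
    · rintro ⟨m, h1, rfl⟩
      obtain ⟨⟨e, h2⟩, h3⟩ := (hmem m).1 h1
      refine ⟨?_, by rw [wm_ph, h3]⟩
      intro p hp
      obtain ⟨x, hx, rfl⟩ := Multiset.mem_map.1 hp
      rw [gg_pair]
      rw [Finset.mem_finsuppAntidiag] at h2
      apply h2.2
      rwa [Finsupp.mem_toMultiset] at hx
  unfold Lone
  rw [hS, finsum_mem_coe_finset, Finset.sum_image (fun _ _ _ _ h => ph_inj h), Polynomial.finsetSum_coeff]
  simp only [Polynomial.coeff_X_pow]
  rw [← Finset.sum_filter, ← Finset.sum_filter]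
  refine Finset.sum_congr ?_ fun _ _ => rfl
  ext m
  rw [Finset.mem_filter, hmem, Finset.mem_filter]
  constructor
  · rintro ⟨⟨⟨e, h1⟩, h2⟩, h3⟩
    rw [card_ph _ _ _ h1] at h3
    subst h3
    exact ⟨h1, h2⟩
  · rintro ⟨h1, h2⟩
    exact ⟨⟨⟨d, h1⟩, h2⟩, (card_ph _ _ _ h1).symm⟩

theorem Kone_coeff (lam mu : Fin (r * N) → ℤ) (d : ℕ) : (Kone r N lam mu).coeff d =
    ∑ m ∈ Finset.finsuppAntidiag (QM r (r * N) 0) d, FF r N lam (mu + wm m) := by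
  classical
  unfold Kone FF
  rw [Polynomial.finsetSum_coeff, Finset.sum_comm]
  refine Finset.sum_congr rfl fun σ _ => ?_
  rw [Polynomial.coeff_C_mul, Lone_coeff, Finset.mul_sum]
  refine Finset.sum_congr rfl fun m _ => ?_
  congr 1
  refine if_congr ⟨fun h => ?_, fun h => ?_⟩ rfl rfl
  · rw [h]; abel
  · rw [← h]; abel

theorem IsMP_Rr {lam : Fin (r * N) → ℤ} (h : IsMP r N lam) (a b : Fin (r * N)) (hab : Rr r a b) :
    lam b ≤ lam a := by
  obtain ⟨s, j, rfl⟩ := pos_surj a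
  obtain ⟨t, k, rfl⟩ := pos_surj b
  obtain ⟨h1, h2⟩ := hab
  rw [pos_mod, pos_mod] at h2
  obtain rfl := Fin.ext h2
  refine h s j k ?_
  have := Nat.div_le_div_right (c := r) (Fin.lt_def.1 h1).le
  rwa [pos_div, pos_div] at this

theorem Reg_adj (hr : 1 ≤ r) {mu : Fin (r * N) → ℤ} (h : RegularMP r N mu) (p q : Fin (r * N))
    (hpq : q.val = p.val + r) : mu q < mu p := by
  obtain ⟨s, j, rfl⟩ := pos_surj p
  obtain ⟨t, k, rfl⟩ := pos_surj q
  have h2 : t = s := by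
    apply Fin.ext; rw [← pos_mod t k, hpq, Nat.add_mod_right, pos_mod]
  subst h2
  refine h t j k ?_
  have hj : k.val = j.val + 1 := by
    rw [← pos_div t k, hpq, Nat.add_div_right _ hr, pos_div]
  rw [Fin.lt_def]; omega
end
end KS

namespace KS

/-- for a regular multipartition `μ` and a multipartition `λ ≥ μ`,
the one-variable Kostka–Shoji polynomial `K_{λμ}(t)` has nonnegative integer
coefficients. -/
theorem stmt1 (r N : ℕ) (hr : 1 ≤ r) (hN : 1 ≤ N)
    (lam mu : Fin (r * N) → ℤ)
    (hlam : IsMP r N lam) (hmu : IsMP r N mu)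
    (hreg : RegularMP r N mu)
    (hdom : Dominates r N lam mu) :
    ∀ d : ℕ, 0 ≤ (Kone r N lam mu).coeff d := by
  intro d
  rw [Kone_coeff]
  exact main_pos lam hr (FF r N lam) (fun ν p q hpq => FF_swap hr lam ν p q hpq)
    (fun ν hν => FF_dom hr lam ν (IsMP_Rr hlam) hν) (IsMP_Rr hlam) mu (Reg_adj hr hreg) d

end KS
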